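/- The Hochschild homology of A is: HH_0(A) = U^*[h] ⊕ R, HH_1(A) = U^*[h], HH_2(A) = K^*[h], HH_3(A) = K[h], HH_4(A) = U[h], HH_5(A) = U[h], HH_6(A) = U^*[3h], and HH_{6k+i}(A) = HH_i(A)[2kh] for all i ≥ 1 and k ≥ 0, as graded vector spaces. -/

import Mathlib

/-!
STATEMENT 3. Let `A = Π_{T_n}` be the preprojective algebra of the quiver of type `T_n`,
graded with arrows in degree 1; `h = 2n+1`, `R = ⊕_{i∈I} ℂ eᵢ`.  `U` is the
`n`-dimensional graded space with Hilbert series `∑_{i=0}^{n-1} t^{2i}` and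
`K = HH²(A)[2]` is `n`-dimensional in degree `0`.

Claim (Hochschild homology, as graded vector spaces):
`HH_0(A) = U^*[h] ⊕ R`, `HH_1(A) = U^*[h]`, `HH_2(A) = K^*[h]`, `HH_3(A) = K[h]`,
`HH_4(A) = U[h]`, `HH_5(A) = U[h]`, `HH_6(A) = U^*[3h]`, and
`HH_{6k+i}(A) = HH_i(A)[2kh]` for all `i ≥ 1`, `k ≥ 0`.

Below, Hochschild homology is defined from the Hochschild chain complex
`C_m(A) = A^{⊗(m+1)}` with the usual Hochschild boundary (including the cyclic face),
with the grading induced by the path-length grading of `A`.  The identities of graded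
vector spaces are formalized as equalities of dimensions of all graded components.
With the paper's shift and duality conventions these read (where
`w(d) = 1` if `d` is even with `0 ≤ d ≤ 2n-2`, else `0`, is the Hilbert function of `U`):
`HH_0(A)(d) = n·δ_{d,0} + w(2n-1-d)`, `HH_1(A)(d) = w(2n-1-d)`,
`HH_2(A)(d) = HH_3(A)(d) = n·δ_{d,h}`, `HH_4(A)(d) = HH_5(A)(d) = w(d-h-2)`,
`HH_6(A)(d) = w(3h-2-d)`, and `HH_{6k+i}(A)(d + 2kh) = HH_i(A)(d)` for `i ≥ 1`.
-/

/-- Generators of the path algebra of the double of the `T_n` quiver: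
idempotents `e i`, arrows `a i : i → i+1`, reversed arrows `astar i : i+1 → i`,
and the loop `b` at the last vertex. -/
inductive TGen (n : ℕ) : Type
  | e : Fin n → TGen n
  | a : Fin n → TGen n
  | astar : Fin n → TGen n
  | b : TGen n

namespace TPre

open FreeAlgebra

abbrev F (n : ℕ) := FreeAlgebra ℂ (TGen n)

def g {n : ℕ} (x : TGen n) : F n := FreeAlgebra.ι ℂ x

/-- The defining relations of the preprojective algebra `Π_{T_n}`:
the `e i` are orthogonal idempotents summing to `1`, the arrows are compatible with
source and target idempotents (arrows `a i`, `astar i` with `i+1 = n` are spurious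
generators which are set to `0`), the loop `b` sits at the last vertex, and the
preprojective relation `∑_{a ∈ Q'} [a, a*] = b²` holds. -/
inductive TRel (n : ℕ) : F n → F n → Prop
  | idem (i j : Fin n) : TRel n (g (.e i) * g (.e j)) (if i = j then g (.e i) else 0)
  | sum_idem : TRel n (∑ i : Fin n, g (.e i)) 1
  | a_path (i : Fin n) (h : (i : ℕ) + 1 < n) :
      TRel n (g (.e ⟨(i : ℕ) + 1, h⟩) * g (.a i) * g (.e i)) (g (.a i))
  | a_junk (i : Fin n) (h : ¬ (i : ℕ) + 1 < n) : TRel n (g (.a i)) 0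
  | astar_path (i : Fin n) (h : (i : ℕ) + 1 < n) :
      TRel n (g (.e i) * g (.astar i) * g (.e ⟨(i : ℕ) + 1, h⟩)) (g (.astar i))
  | astar_junk (i : Fin n) (h : ¬ (i : ℕ) + 1 < n) : TRel n (g (.astar i)) 0
  | b_path (i : Fin n) (h : (i : ℕ) + 1 = n) :
      TRel n (g (.e i) * g .b * g (.e i)) (g .b)
  | preproj :
      TRel n (∑ i : Fin n, (g (.a i) * g (.astar i) - g (.astar i) * g (.a i)))
        (g .b * g .b)

/-- The preprojective algebra `A = Π_{T_n}` over `ℂ`. -/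
abbrev PiT (n : ℕ) := RingQuot (TRel n)

/-- The image of a generator in `Π_{T_n}`. -/
def gen {n : ℕ} (x : TGen n) : PiT n := RingQuot.mkAlgHom ℂ (TRel n) (g x)

/-- The weight of a generator: trivial paths have degree `0`, arrows degree `1`. -/
def wt {n : ℕ} : TGen n → ℕ
  | .e _ => 0
  | _ => 1

/-- The degree-`d` homogeneous component of `Π_{T_n}` (arrows in degree `1`). -/
def adeg (n d : ℕ) : Submodule ℂ (PiT n) :=
  Submodule.span ℂ {x | ∃ l : List (TGen n), (l.map wt).sum = d ∧ x = (l.map gen).prod}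


-- Hochschild chain complex
noncomputable def ChB (n : ℕ) : ℕ → ModuleCat ℂ
  | 0 => ModuleCat.of ℂ (PiT n)
  | (m+1) => ModuleCat.of ℂ (TensorProduct ℂ (PiT n) (ChB n m))

abbrev Ch (n m : ℕ) : Type := ChB n m

noncomputable def d0 (n : ℕ) : (m : ℕ) → (Ch n (m+1) →ₗ[ℂ] Ch n m)
  | 0 => LinearMap.mul' ℂ (PiT n)
  | (m+1) =>
      (LinearMap.rTensor (Ch n m) (LinearMap.mul' ℂ (PiT n))) ∘ₗ
        (TensorProduct.assoc ℂ (PiT n) (PiT n) (Ch n m)).symm.toLinearMap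

noncomputable def rot (n : ℕ) : (m : ℕ) → (Ch n m →ₗ[ℂ] Ch n m)
  | 0 => LinearMap.id
  | 1 => (TensorProduct.comm ℂ (PiT n) (PiT n)).toLinearMap
  | (m+2) =>
      (TensorProduct.assoc ℂ (PiT n) (PiT n) (Ch n m)).toLinearMap ∘ₗ
      (LinearMap.rTensor (Ch n m) (TensorProduct.comm ℂ (PiT n) (PiT n)).toLinearMap) ∘ₗ
      (TensorProduct.assoc ℂ (PiT n) (PiT n) (Ch n m)).symm.toLinearMap ∘ₗ
      (LinearMap.lTensor (PiT n) (rot n (m+1)))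

noncomputable def bp (n : ℕ) : (m : ℕ) → (Ch n (m+1) →ₗ[ℂ] Ch n m)
  | 0 => LinearMap.mul' ℂ (PiT n)
  | (m+1) =>
      letI T : Ch n (m+2) →ₗ[ℂ] Ch n (m+1) := LinearMap.lTensor (PiT n) (bp n m)
      d0 n (m+1) - T

noncomputable def bmap (n m : ℕ) : Ch n (m+1) →ₗ[ℂ] Ch n m :=
  bp n m + ((-1 : ℂ)^(m+1)) • (d0 n m ∘ₗ rot n (m+1))

noncomputable def tensorSub {M N : Type} [AddCommGroup M] [Module ℂ M]
    [AddCommGroup N] [Module ℂ N] (p : Submodule ℂ M) (q : Submodule ℂ N) :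
    Submodule ℂ (TensorProduct ℂ M N) :=
  LinearMap.range (TensorProduct.map p.subtype q.subtype)

noncomputable def chDeg (n : ℕ) : (m : ℕ) → ℕ → Submodule ℂ (Ch n m)
  | 0, d => adeg n d
  | (m+1), d => ⨆ k ∈ Finset.range (d+1), tensorSub (adeg n k) (chDeg n m (d - k))

noncomputable def hcyc (n : ℕ) : (m : ℕ) → Submodule ℂ (Ch n m)
  | 0 => ⊤
  | (m+1) => LinearMap.ker (bmap n m)

noncomputable def hbnd (n m : ℕ) : Submodule ℂ (Ch n m) := LinearMap.range (bmap n m)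

abbrev HHho (n m : ℕ) := ↥(hcyc n m) ⧸ Submodule.comap (hcyc n m).subtype (hbnd n m)

noncomputable def HHhoDeg (n m d : ℕ) : Submodule ℂ (HHho n m) :=
  Submodule.map (Submodule.mkQ _) (Submodule.comap (hcyc n m).subtype (chDeg n m d))


end TPre

open TPre

/-- The Hilbert function of the `n`-dimensional graded vector space `U` with Hilbert
series `∑_{i=0}^{n-1} t^{2i}`. -/
def wdim (n : ℕ) (d : ℤ) : ℕ :=
  if Even d ∧ 0 ≤ d ∧ d ≤ 2 * (n : ℤ) - 2 then 1 else 0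

namespace TPre

/-! ### Part 1: the algebra -/

theorem gen_rel {n : ℕ} {x y : F n} (h : TRel n x y) :
    RingQuot.mkAlgHom ℂ (TRel n) x = RingQuot.mkAlgHom ℂ (TRel n) y :=
  RingQuot.mkAlgHom_rel ℂ h

theorem gen_e_mul {n : ℕ} (i j : Fin n) :
    (gen (.e i) : PiT n) * gen (.e j) = if i = j then gen (.e i) else 0 := by
  have := gen_rel (TRel.idem i j)
  split_ifs with h <;> simpa [gen, h] using this

theorem gen_e_sum (n : ℕ) : ∑ i : Fin n, (gen (.e i) : PiT n) = 1 := by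
  have := gen_rel (TRel.sum_idem (n := n))
  simpa [gen] using this

theorem gen_a_path {n : ℕ} (i : Fin n) (h : (i : ℕ) + 1 < n) :
    (gen (.e ⟨(i : ℕ) + 1, h⟩) : PiT n) * gen (.a i) * gen (.e i) = gen (.a i) := by
  have := gen_rel (TRel.a_path i h)
  simpa [gen] using this

theorem gen_a_junk {n : ℕ} (i : Fin n) (h : ¬ (i : ℕ) + 1 < n) :
    (gen (.a i) : PiT n) = 0 := by
  have := gen_rel (TRel.a_junk i h)
  simpa [gen] using this

theorem gen_astar_path {n : ℕ} (i : Fin n) (h : (i : ℕ) + 1 < n) :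
    (gen (.e i) : PiT n) * gen (.astar i) * gen (.e ⟨(i : ℕ) + 1, h⟩) = gen (.astar i) := by
  have := gen_rel (TRel.astar_path i h)
  simpa [gen] using this

theorem gen_astar_junk {n : ℕ} (i : Fin n) (h : ¬ (i : ℕ) + 1 < n) :
    (gen (.astar i) : PiT n) = 0 := by
  have := gen_rel (TRel.astar_junk i h)
  simpa [gen] using this

theorem gen_b_path {n : ℕ} (i : Fin n) (h : (i : ℕ) + 1 = n) :
    (gen (.e i) : PiT n) * gen .b * gen (.e i) = gen .b := by
  have := gen_rel (TRel.b_path i h)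
  simpa [gen] using this

theorem gen_preproj (n : ℕ) :
    ∑ i : Fin n, ((gen (.a i) : PiT n) * gen (.astar i) - gen (.astar i) * gen (.a i))
      = gen .b * gen .b := by
  have := gen_rel (TRel.preproj (n := n))
  simpa [gen] using this

/-- idempotent at an integer vertex, zero outside `1..n` -/
noncomputable def ev (n : ℕ) (j : ℤ) : PiT n :=
  if h : 1 ≤ j ∧ j ≤ n then gen (.e ⟨(j - 1).toNat, by omega⟩) else 0

/-- symmetrised idempotent -/
noncomputable def E (n : ℕ) (j : ℤ) : PiT n := ev n j + ev n (2 * n + 1 - j)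

/-- the lifted arrows `j → j+1` -/
noncomputable def xi (n : ℕ) (j : ℤ) : PiT n :=
  if h : 1 ≤ j ∧ j < n then gen (.a ⟨(j - 1).toNat, by omega⟩)
  else if j = n then gen .b
  else if h : n < j ∧ j < 2 * n then gen (.astar ⟨(2 * n - 1 - j).toNat, by omega⟩)
  else 0

theorem ev_zero {n : ℕ} {j : ℤ} (h : ¬ (1 ≤ j ∧ j ≤ n)) : ev n j = 0 := by
  simp [ev, h]

theorem ev_mul {n : ℕ} (i j : ℤ) : ev n i * ev n j = if i = j then ev n i else 0 := by
  by_cases hi : 1 ≤ i ∧ i ≤ n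
  · by_cases hj : 1 ≤ j ∧ j ≤ n
    · simp only [ev, hi, hj, and_self, dite_true, gen_e_mul, Fin.mk.injEq]
      by_cases hij : i = j
      · simp [hij]
      · have : ¬ (i - 1).toNat = (j - 1).toNat := by omega
        rw [if_neg this, if_neg hij]
    · have : i ≠ j := by rintro rfl; exact hj hi
      simp [ev_zero hj, this]
  · simp [ev_zero hi]

theorem E_sigma (n : ℕ) (j : ℤ) : E n (2 * n + 1 - j) = E n j := by
  unfold E; rw [add_comm]; congr 2; ring

theorem E_zero {n : ℕ} {j : ℤ} (h : ¬ (1 ≤ j ∧ j ≤ 2 * n)) : E n j = 0 := by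
  unfold E; rw [ev_zero, ev_zero, add_zero] <;> omega

theorem E_of_le {n : ℕ} {j : ℤ} (h : j ≤ n) : E n j = ev n j := by
  unfold E; rw [ev_zero (j := 2 * n + 1 - j), add_zero]; omega

theorem E_of_ge {n : ℕ} {j : ℤ} (h : n < j) : E n j = ev n (2 * n + 1 - j) := by
  unfold E; rw [ev_zero (j := j), zero_add]; omega

theorem E_mul (n : ℕ) (i j : ℤ) :
    E n i * E n j = if i = j ∨ i = 2 * n + 1 - j then E n j else 0 := by
  unfold E
  simp only [mul_add, add_mul, ev_mul]
  by_cases h1 : i = j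
  · subst h1
    have : ¬ (i = 2 * n + 1 - i) := by omega
    have h2 : ¬ (2 * n + 1 - i = i) := by omega
    simp [this, h2]
  · by_cases h2 : i = 2 * n + 1 - j
    · have h3 : 2 * (n : ℤ) + 1 - i = j := by omega
      have h4 : ¬ (j = 2 * n + 1 - j) := by omega
      have h5 : ¬ (i = j) := h1
      have h6 : ¬ ((2 : ℤ) * n + 1 - j = j) := by omega
      subst h2
      simp [h4, h6]
    · have h3 : ¬ (2 * (n : ℤ) + 1 - i = j) := by omega
      have h4 : ¬ (2 * (n : ℤ) + 1 - i = 2 * n + 1 - j) := by omega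
      simp [h1, h2, h3]

theorem E_self (n : ℕ) (j : ℤ) : E n j * E n j = E n j := by simp [E_mul]

theorem sum_E (n : ℕ) : ∑ k ∈ Finset.Icc (1 : ℤ) n, E n k = 1 := by
  rw [← gen_e_sum n]
  symm
  refine Finset.sum_bij (fun i _ => (i : ℤ) + 1) ?_ ?_ ?_ ?_
  · intro i _; simp
  · intro i _ j _ h; ext; omega
  · intro k hk
    simp at hk
    exact ⟨⟨(k - 1).toNat, by omega⟩, by simp, by simp; omega⟩
  · intro i _
    have : 1 ≤ (i : ℤ) + 1 ∧ (i : ℤ) + 1 ≤ n := by omega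
    rw [E_of_le this.2, ev, dif_pos this]
    congr; simp

theorem ev_gen {n : ℕ} {j : ℤ} (h : 1 ≤ j ∧ j ≤ n) :
    ev n j = gen (.e ⟨(j - 1).toNat, by omega⟩) := dif_pos h

theorem xi_zero {n : ℕ} {j : ℤ} (h : ¬ (1 ≤ j ∧ j < 2 * n)) : xi n j = 0 := by
  unfold xi
  by_cases hn : n = 0
  · subst hn
    by_cases hj : j = 0
    · subst hj
      simp
      have : (1 : PiT 0) = 0 := by rw [← gen_e_sum 0]; simp
      rw [← mul_one (gen TGen.b), this, mul_zero]
    · split_ifs <;> first | rfl | omega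
  · split_ifs <;> first | rfl | omega

theorem idem_left {R : Type*} [Ring R] {e x f : R} (he : e * e = e) (h : e * x * f = x) :
    e * x = x := by
  rw [← h, mul_assoc, ← mul_assoc e e, he]
theorem idem_right {R : Type*} [Ring R] {e x f : R} (hf : f * f = f) (h : e * x * f = x) :
    x * f = x := by
  rw [← h, mul_assoc (e*x), hf]

theorem xi_path (n : ℕ) (j : ℤ) : E n (j + 1) * xi n j * E n j = xi n j := by
  by_cases h : 1 ≤ j ∧ j < n
  · have hx : xi n j = gen (.a ⟨(j - 1).toNat, by omega⟩) := by simp [xi, h]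
    rw [hx, E_of_le (by omega), E_of_le (by omega), ev_gen (by omega), ev_gen (by omega)]
    have := gen_a_path (⟨(j - 1).toNat, by omega⟩ : Fin n) (by simp; omega)
    convert this using 6
    simp; omega
  by_cases h2 : j = n
  · by_cases hn : n = 0
    · rw [xi_zero]; simp; omega
    have hx : xi n j = gen .b := by simp [xi, h2]
    rw [hx, E_of_ge (by omega), E_of_le (by omega), ev_gen (by omega), ev_gen (by omega)]
    have := gen_b_path (⟨(j - 1).toNat, by omega⟩ : Fin n) (by simp; omega)
    convert this using 6
    simp; omega
  by_cases h3 : n < j ∧ j < 2 * n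
  · have hx : xi n j = gen (.astar ⟨(2 * n - 1 - j).toNat, by omega⟩) := by simp [xi, h, h2, h3]
    rw [hx, E_of_ge (by omega), E_of_ge (by omega), ev_gen (by omega), ev_gen (by omega)]
    have := gen_astar_path (⟨(2 * n - 1 - j).toNat, by omega⟩ : Fin n) (by simp; omega)
    convert this using 6
    · simp; omega
    · simp; omega
  · simp [xi, h, h2, h3]

theorem E_xi (n : ℕ) (j : ℤ) : E n (j + 1) * xi n j = xi n j :=
  idem_left (E_self _ _) (xi_path n j)
theorem xi_E (n : ℕ) (j : ℤ) : xi n j * E n j = xi n j :=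
  idem_right (E_self _ _) (xi_path n j)

theorem E_ne {n : ℕ} {i j : ℤ} (h : ¬ (i = j ∨ i = 2 * n + 1 - j)) : E n i * E n j = 0 := by
  rw [E_mul, if_neg h]

theorem ev_E_ne {n : ℕ} {i j : ℤ} (h : ¬ (i = j ∨ i = 2 * n + 1 - j)) (hi : i ≤ n) :
    ev n i * E n j = 0 := by
  rw [← E_of_le hi]; exact E_ne h

theorem xi_comm_aux (n : ℕ) (j : ℤ) (h1 : 1 ≤ j) (h2 : j ≤ n) :
    xi n (2 * n - j) * xi n j = xi n (j - 1) * xi n (2 * n + 1 - j) := by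
  have hp := congrArg (fun z => E n j * z) (gen_preproj n)
  -- rewrite the generators in terms of xi
  have ha : ∀ i : Fin n, (gen (.a i) : PiT n) * gen (.astar i) - gen (.astar i) * gen (.a i)
      = (if (i : ℕ) + 1 < n then xi n (i + 1) * xi n (2 * n - 1 - i)
          - xi n (2 * n - 1 - i) * xi n (i + 1) else 0) := by
    intro i
    by_cases hi : (i : ℕ) + 1 < n
    · have e1 : xi n (i + 1) = gen (.a i) := by
        have : 1 ≤ (i : ℤ) + 1 ∧ (i : ℤ) + 1 < n := by omega
        rw [xi, dif_pos this]; congr; simp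
      have e2 : xi n (2 * n - 1 - i) = gen (.astar i) := by
        have : ¬ (1 ≤ (2 * n - 1 - i : ℤ) ∧ (2 * n - 1 - i : ℤ) < n) := by omega
        have h' : ¬ ((2 * n - 1 - i : ℤ) = n) := by omega
        have h'' : (n < (2 * n - 1 - i : ℤ) ∧ (2 * n - 1 - i : ℤ) < 2 * n) := by omega
        rw [xi, dif_neg this, if_neg h', dif_pos h'']; congr; omega
      rw [if_pos hi, e1, e2]
    · rw [if_neg hi, gen_a_junk i hi, gen_astar_junk i hi]; simp
  have hb : (gen .b : PiT n) = xi n n := by simp [xi]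
  simp only [ha, hb, Finset.mul_sum] at hp
  have hx : ∀ (x y : ℤ), E n j * (xi n x * xi n y) =
      if j = x + 1 ∨ j = 2 * n + 1 - (x + 1) then xi n x * xi n y else 0 := by
    intro x y
    rw [← mul_assoc]
    nth_rewrite 1 [← E_xi n x]
    rw [← mul_assoc, E_mul]
    split_ifs
    · rw [E_xi]
    · simp
  simp only [mul_ite, mul_sub, hx, mul_zero] at hp
  rw [← Finset.sum_erase_add _ _ (Finset.mem_univ (⟨(j - 1).toNat, by omega⟩ : Fin n))] at hp
  by_cases hj : j = 1
  · subst hj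
    rw [xi_zero (j := 1 - 1) (by omega), zero_mul]
    rw [Finset.sum_eq_zero] at hp
    · simp at hp
      by_cases hn : n = 1
      · subst hn; simp at hp ⊢; exact hp.symm
      · rw [if_pos (by omega), if_neg (by omega), if_neg (by omega)] at hp
        simpa using hp
    · intro i hi
      simp [Fin.ext_iff] at hi
      split_ifs <;> first | rfl | omega | simp
  · rw [Finset.sum_eq_single (⟨(j - 2).toNat, by omega⟩ : Fin n)] at hp
    · simp only [Int.toNat_of_nonneg (show 0 ≤ j - 2 by omega),
        Int.toNat_of_nonneg (show 0 ≤ j - 1 by omega)] at hp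
      by_cases hn : j = n
      · subst hn
        rw [if_pos (by omega), if_pos (by omega), if_neg (by omega), if_neg (by omega),
          if_pos (by omega)] at hp
        rw [sub_zero, add_zero] at hp
        have e1 : (2 * (n : ℤ) - n) = n := by ring
        rw [e1, ← hp]
        congr 2 <;> ring
      · rw [if_pos (by omega), if_pos (by omega), if_neg (by omega), if_pos (by omega),
          if_neg (by omega), if_pos (by omega), if_neg (by omega)] at hp
        have e1 : 2 * (n : ℤ) - 1 - (j - 1) = 2 * n - j := by ring
        have e2 : 2 * (n : ℤ) - 1 - (j - 2) = 2 * n + 1 - j := by ring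
        have e3 : j - 1 + 1 = j := by ring
        have e4 : j - 2 + 1 = j - 1 := by ring
        rw [e1, e2, e3, e4, sub_zero, zero_sub] at hp
        exact (sub_eq_zero.mp (by rw [sub_eq_add_neg]; exact hp)).symm
    · intro i hi hne
      simp [Fin.ext_iff] at hi hne
      split_ifs <;> first | rfl | omega | simp
    · intro hne
      exfalso; apply hne
      simp [Fin.ext_iff]; omega

theorem xi_comm (n : ℕ) (j : ℤ) :
    xi n (2 * n - j) * xi n j = xi n (j - 1) * xi n (2 * n + 1 - j) := by
  by_cases h : 1 ≤ j ∧ j ≤ 2 * n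
  · by_cases h2 : j ≤ n
    · exact xi_comm_aux n j h.1 h2
    · have := xi_comm_aux n (2 * n + 1 - j) (by omega) (by omega)
      have e1 : 2 * (n : ℤ) - (2 * n + 1 - j) = j - 1 := by ring
      have e2 : 2 * (n : ℤ) + 1 - (2 * n + 1 - j) = j := by ring
      have e3 : 2 * (n : ℤ) + 1 - j - 1 = 2 * n - j := by ring
      rw [e1, e2, e3] at this
      exact this.symm
  · rw [xi_zero (j := j) (by omega), xi_zero (j := j - 1) (by omega), mul_zero, zero_mul]

/-! monomials -/

noncomputable def m0 (n : ℕ) (k : ℤ) : ℕ → ℕ → PiT n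
  | 0, 0 => E n k
  | 0, q + 1 => xi n (2 * n + 1 - (k - q)) * m0 n k 0 q
  | p + 1, q => xi n (k + p - q) * m0 n k p q

/-- monomial starting at `k` with `q` down steps and `p` up steps -/
noncomputable def mm (n : ℕ) (k p q : ℤ) : PiT n :=
  if 0 ≤ p ∧ 0 ≤ q then m0 n k p.toNat q.toNat else 0

theorem mm_neg {n : ℕ} {k p q : ℤ} (h : ¬ (0 ≤ p ∧ 0 ≤ q)) : mm n k p q = 0 := if_neg h

theorem mm_nat (n : ℕ) (k : ℤ) (p q : ℕ) : mm n k p q = m0 n k p q := by simp [mm]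

theorem mm_zero_zero (n : ℕ) (k : ℤ) : mm n k 0 0 = E n k := by simp [mm, m0]

theorem m0_eta (n : ℕ) (k : ℤ) (p q : ℕ) :
    xi n (2 * n + 1 - (k + p - q)) * m0 n k p q = m0 n k p (q + 1) := by
  induction p with
  | zero => simp [m0]
  | succ p ih =>
    have hr : m0 n k (p + 1) (q + 1) = xi n (k + p - (q + 1 : ℕ)) * m0 n k (p) (q + 1) := by
      rw [m0]
    rw [hr, ← ih, m0, ← mul_assoc, ← mul_assoc]
    have := xi_comm n (k + p - q)
    have e1 : 2 * (n : ℤ) + 1 - (k + (p + 1 : ℕ) - q) = 2 * n - (k + p - q) := by push_cast; ring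
    have e2 : k + p - (q + 1 : ℕ) = k + p - q - 1 := by push_cast; ring
    rw [e1, e2, this]

theorem xi_mm {n : ℕ} {k p q : ℤ} (h : 0 ≤ p) :
    xi n (k + p - q) * mm n k p q = mm n k (p + 1) q := by
  by_cases hq : 0 ≤ q
  · lift p to ℕ using h
    lift q to ℕ using hq
    have : ((p : ℤ) + 1) = (p + 1 : ℕ) := by simp
    rw [this, mm_nat, mm_nat, m0]
  · rw [mm_neg, mm_neg, mul_zero] <;> omega

theorem eta_mm {n : ℕ} {k p q : ℤ} (h : 0 ≤ q) :
    xi n (2 * n + 1 - (k + p - q)) * mm n k p q = mm n k p (q + 1) := by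
  by_cases hp : 0 ≤ p
  · lift q to ℕ using h
    lift p to ℕ using hp
    have : ((q : ℤ) + 1) = (q + 1 : ℕ) := by simp
    rw [this, mm_nat, mm_nat, m0_eta]
  · rw [mm_neg, mm_neg, mul_zero] <;> omega

/-- generic induction principle for monomials -/
theorem pq_ind {P : ℤ → ℤ → Prop} (h0 : P 0 0)
    (hp : ∀ p q, 0 ≤ p → 0 ≤ q → P p q → P (p + 1) q)
    (hq : ∀ p q, 0 ≤ p → 0 ≤ q → P p q → P p (q + 1)) :
    ∀ p q, 0 ≤ p → 0 ≤ q → P p q := by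
  intro p q h1 h2
  lift p to ℕ using h1
  lift q to ℕ using h2
  induction q with
  | zero =>
    induction p with
    | zero => exact h0
    | succ p ih => exact_mod_cast hp p 0 (by omega) (by omega) ih
  | succ q ih => exact_mod_cast hq p q (by omega) (by omega) ih

theorem mm_big_p {n : ℕ} {k p q : ℤ} (h : 2 * n - k < p) (hk : k ≤ 2 * n): mm n k p q = 0 := by
  by_cases hq : 0 ≤ q
  · have key : ∀ r : ℕ, mm n k (2 * n - k + 1 + r) 0 = 0 := by
      intro r
      induction r with
      | zero =>
        have := xi_mm (n := n) (k := k) (p := 2 * n - k) (q := 0) (by omega)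
        rw [xi_zero, zero_mul] at this
        · simpa using this.symm
        · omega
      | succ r ih =>
        have := xi_mm (n := n) (k := k) (p := 2 * n - k + 1 + r) (q := 0) (by omega)
        rw [ih, mul_zero] at this
        rw [this]; congr 1; push_cast; ring
    lift q to ℕ using hq
    induction q with
    | zero =>
      have := key (p - (2 * n - k + 1)).toNat
      rw [← this]; congr 1; omega
    | succ q ih =>
      push_cast
      rw [← eta_mm (by omega), ih, mul_zero]
  · exact mm_neg (by omega)

theorem mm_bad_k {n : ℕ} {k p q : ℤ} (h : ¬ (1 ≤ k ∧ k ≤ 2 * n)) : mm n k p q = 0 := by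
  by_cases hpq : 0 ≤ p ∧ 0 ≤ q
  · refine pq_ind (P := fun p q => mm n k p q = 0) ?_ ?_ ?_ p q hpq.1 hpq.2
    · rw [mm_zero_zero, E_zero h]
    · intro p q hp hq ih; rw [← xi_mm hp, ih, mul_zero]
    · intro p q hp hq ih; rw [← eta_mm hq, ih, mul_zero]
  · exact mm_neg hpq

theorem mm_sigma {n : ℕ} (k p q : ℤ) : mm n (2 * n + 1 - k) q p = mm n k p q := by
  by_cases hpq : 0 ≤ p ∧ 0 ≤ q
  · refine pq_ind (P := fun p q => mm n (2 * n + 1 - k) q p = mm n k p q) ?_ ?_ ?_ p q hpq.1 hpq.2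
    · rw [mm_zero_zero, mm_zero_zero, E_sigma]
    · intro p q hp hq ih
      rw [← xi_mm hp, ← ih, ← eta_mm hp]; congr 2; ring
    · intro p q hp hq ih
      rw [← eta_mm hq, ← ih, ← xi_mm hq]; congr 2; ring
  · rw [mm_neg, mm_neg] <;> omega

theorem mm_bad {n : ℕ} {k p q : ℤ}
    (h : ¬ (1 ≤ k ∧ k ≤ 2 * n ∧ 0 ≤ q ∧ q < k ∧ 0 ≤ p ∧ p ≤ 2 * n - k)) : mm n k p q = 0 := by
  by_cases hk : (1 ≤ k ∧ k ≤ 2 * n)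
  · by_cases h0 : 0 ≤ p ∧ 0 ≤ q
    · by_cases h1 : 2 * n - k < p
      · exact mm_big_p h1 hk.2
      · rw [← mm_sigma]; exact mm_big_p (by omega) (by omega)
    · exact mm_neg h0
  · exact mm_bad_k hk

theorem E_mm {n : ℕ} (j k p q : ℤ) : E n j * mm n k p q =
    if j = k + p - q ∨ j = 2 * n + 1 - (k + p - q) then mm n k p q else 0 := by
  have key : E n (k + p - q) * mm n k p q = mm n k p q := by
    by_cases hpq : 0 ≤ p ∧ 0 ≤ q
    · refine pq_ind (P := fun p q => E n (k + p - q) * mm n k p q = mm n k p q)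
        ?_ ?_ ?_ p q hpq.1 hpq.2
      · simp [mm_zero_zero, E_self]
      · intro p q hp hq ih
        rw [← xi_mm hp, ← mul_assoc]
        congr 1
        convert E_xi n (k + p - q) using 3; ring
      · intro p q hp hq ih
        rw [← eta_mm hq, ← mul_assoc]
        congr 1
        rw [← E_sigma]
        convert E_xi n (2 * n + 1 - (k + p - q)) using 3; ring
    · rw [mm_neg hpq, mul_zero]
  rw [← key, ← mul_assoc, E_mul]
  split_ifs
  · rfl
  · simp

theorem mm_E {n : ℕ} (j k p q : ℤ) : mm n k p q * E n j =
    if k = j ∨ k = 2 * n + 1 - j then mm n k p q else 0 := by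
  by_cases hpq : 0 ≤ p ∧ 0 ≤ q
  · refine pq_ind (P := fun p q => mm n k p q * E n j =
      if k = j ∨ k = 2 * n + 1 - j then mm n k p q else 0) ?_ ?_ ?_ p q hpq.1 hpq.2
    · rw [mm_zero_zero, E_mul]
      split_ifs with h
      · rcases h with h | h
        · rw [h]
        · rw [h, E_sigma]
      · rfl
    · intro p q hp hq ih
      rw [← xi_mm hp, mul_assoc, ih]; split_ifs <;> simp
    · intro p q hp hq ih
      rw [← eta_mm hq, mul_assoc, ih]; split_ifs <;> simp
  · rw [mm_neg hpq]; simp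

theorem mm_mul {n : ℕ} {k p q p' q' : ℤ} (hp : 0 ≤ p) (hq : 0 ≤ q) (hp' : 0 ≤ p') (hq' : 0 ≤ q') :
    mm n (k + p - q) p' q' * mm n k p q = mm n k (p + p') (q + q') := by
  refine pq_ind (P := fun p' q' => mm n (k + p - q) p' q' * mm n k p q = mm n k (p + p') (q + q'))
    ?_ ?_ ?_ p' q' hp' hq'
  · rw [mm_zero_zero, E_mm]; simp
  · intro p' q' hp' hq' ih
    rw [← xi_mm hp', mul_assoc, ih, ← add_assoc, ← xi_mm (by omega)]; congr 2; ring
  · intro p' q' hp' hq' ih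
    rw [← eta_mm hq', mul_assoc, ih, ← add_assoc, ← eta_mm (by omega)]; congr 2; ring

theorem xi_eq_mm (n : ℕ) (k : ℤ) : xi n k = mm n k 1 0 := by
  have := xi_mm (n := n) (k := k) (p := 0) (q := 0) (by omega)
  simp only [mm_zero_zero] at this
  rw [show (1 : ℤ) = 0 + 1 by ring, ← this]
  simp [xi_E]

theorem mm_xi {n : ℕ} {k p q : ℤ} (h : 0 ≤ p) :
    mm n k p q * xi n (k - 1) = mm n (k - 1) (p + 1) q := by
  by_cases hq : 0 ≤ q
  · have := mm_mul (n := n) (k := k - 1) (p := 1) (q := 0) (p' := p) (q' := q)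
      (by omega) (by omega) h hq
    rw [xi_eq_mm, add_comm p, ← zero_add q, ← this]; congr 1; simp
  · rw [mm_neg (by omega), mm_neg (by omega), zero_mul]

theorem mm_eta {n : ℕ} {k p q : ℤ} (h : 0 ≤ q) :
    mm n k p q * xi n (2 * n - k) = mm n (k + 1) p (q + 1) := by
  rw [← mm_sigma k, ← mm_sigma (k + 1)]
  have := mm_xi (n := n) (k := 2 * n + 1 - k) (p := q) (q := p) h
  rw [show 2 * (n : ℤ) + 1 - (k + 1) = 2 * n - k by ring]
  rwa [show 2 * (n : ℤ) + 1 - k - 1 = 2 * n - k by ring] at this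


end TPre

namespace TPre

/-! ### the monomial basis -/

def Sval (n : ℕ) (k p q : ℤ) : Prop := 1 ≤ k ∧ k ≤ n ∧ 0 ≤ q ∧ q < k ∧ 0 ≤ p ∧ p ≤ 2 * n - k

instance (n : ℕ) (k p q : ℤ) : Decidable (Sval n k p q) := by unfold Sval; infer_instance

/-- index type of the monomial basis -/
abbrev S (n : ℕ) := {s : ℤ × ℤ × ℤ // Sval n s.1 s.2.1 s.2.2}

noncomputable instance (n : ℕ) : Fintype (S n) :=
  Fintype.ofInjective
    (β := Fin (n + 1) × Fin (2 * n + 1) × Fin (n + 1))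
    (fun s => (⟨s.1.1.toNat, by have := s.2; unfold Sval at this; omega⟩,
      ⟨s.1.2.1.toNat, by have := s.2; unfold Sval at this; omega⟩,
      ⟨s.1.2.2.toNat, by have := s.2; unfold Sval at this; omega⟩)) (by
    rintro ⟨⟨k, p, q⟩, h⟩ ⟨⟨k', p', q'⟩, h'⟩ hh
    have h1 : 1 ≤ k ∧ k ≤ n ∧ 0 ≤ q ∧ q < k ∧ 0 ≤ p ∧ p ≤ 2 * n - k := h
    have h2 : 1 ≤ k' ∧ k' ≤ n ∧ 0 ≤ q' ∧ q' < k' ∧ 0 ≤ p' ∧ p' ≤ 2 * n - k' := h'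
    simp only [Prod.mk.injEq, Fin.mk.injEq] at hh
    simp only [Subtype.mk.injEq, Prod.mk.injEq]
    omega)

abbrev VS (n : ℕ) := S n →₀ ℂ

noncomputable def vv (n : ℕ) (k p q : ℤ) : VS n :=
  if h : Sval n k p q then Finsupp.single ⟨(k, p, q), h⟩ 1 else 0

theorem vv_bad {n : ℕ} {k p q : ℤ} (h : ¬ Sval n k p q) : vv n k p q = 0 := dif_neg h

noncomputable def tg {n : ℕ} (s : S n) : ℤ := s.1.1 + s.1.2.1 - s.1.2.2

noncomputable def opX (n : ℕ) (j : ℤ) : Module.End ℂ (VS n) :=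
  Finsupp.linearCombination ℂ (fun s : S n =>
    (if tg s = j then vv n s.1.1 (s.1.2.1 + 1) s.1.2.2 else 0) +
    (if tg s = 2 * n + 1 - j then vv n s.1.1 s.1.2.1 (s.1.2.2 + 1) else 0))

noncomputable def opE (n : ℕ) (j : ℤ) : Module.End ℂ (VS n) :=
  Finsupp.linearCombination ℂ (fun s : S n =>
    (if tg s = j ∨ tg s = 2 * n + 1 - j then Finsupp.single s 1 else 0))

theorem opX_vv {n : ℕ} {j k p q : ℤ} (hp : 0 ≤ p) (hq : 0 ≤ q) : opX n j (vv n k p q) =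
    (if k + p - q = j then vv n k (p + 1) q else 0) +
    (if k + p - q = 2 * n + 1 - j then vv n k p (q + 1) else 0) := by
  by_cases h : Sval n k p q
  · rw [vv, dif_pos h, opX, Finsupp.linearCombination_single, one_smul]; rfl
  · rw [vv_bad h, vv_bad, vv_bad]
    · simp
    · simp only [Sval] at *; omega
    · simp only [Sval] at *; omega

theorem opE_vv {n : ℕ} {j k p q : ℤ} : opE n j (vv n k p q) =
    (if k + p - q = j ∨ k + p - q = 2 * n + 1 - j then vv n k p q else 0) := by
  by_cases h : Sval n k p q
  · rw [vv, dif_pos h, opE, Finsupp.linearCombination_single, one_smul]; rfl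
  · rw [vv_bad h]; simp

theorem VS_ext {n : ℕ} {f g : Module.End ℂ (VS n)}
    (h : ∀ k p q, Sval n k p q → f (vv n k p q) = g (vv n k p q)) : f = g := by
  apply Finsupp.lhom_ext'
  rintro ⟨⟨k, p, q⟩, hs⟩
  apply LinearMap.ext_ring
  have := h k p q hs
  simpa [vv, dif_pos hs] using this

theorem opE_mul (n : ℕ) (i j : ℤ) :
    opE n i * opE n j = if i = j ∨ i = 2 * n + 1 - j then opE n j else 0 := by
  apply VS_ext
  intro k p q h
  rw [Module.End.mul_apply, opE_vv]
  by_cases h1 : k + p - q = j ∨ k + p - q = 2 * n + 1 - j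
  · rw [if_pos h1, opE_vv]
    by_cases h2 : i = j ∨ i = 2 * n + 1 - j
    · rw [if_pos h2, if_pos (by omega), opE_vv, if_pos h1]
    · rw [if_neg h2, if_neg (by omega)]; rfl
  · rw [if_neg h1, map_zero]
    split_ifs
    · rw [opE_vv, if_neg h1]
    · rfl

theorem opE_sum (n : ℕ) : ∑ i : Fin n, opE n (i + 1) = 1 := by
  apply VS_ext
  intro k p q h
  rw [LinearMap.sum_apply]
  simp only [opE_vv]
  have hh := h
  unfold Sval at hh
  by_cases ht : k + p - q ≤ n
  · rw [Finset.sum_eq_single ⟨(k + p - q - 1).toNat, by omega⟩]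
    · rw [if_pos (by left; simp; omega)]; rfl
    · intro i _ hi
      simp only [ne_eq, Fin.ext_iff] at hi
      rw [if_neg (by omega)]
    · simp
  · rw [Finset.sum_eq_single ⟨(2 * n - (k + p - q)).toNat, by omega⟩]
    · rw [if_pos (by right; simp; omega)]; rfl
    · intro i _ hi
      simp only [ne_eq, Fin.ext_iff] at hi
      rw [if_neg (by omega)]
    · simp

theorem opX_path (n : ℕ) (i j l : ℤ) (hi : i = j + 1 ∨ i = 2 * n - j)
    (hl : l = j ∨ l = 2 * n + 1 - j) :
    opE n i * opX n j * opE n l = opX n j := by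
  apply VS_ext
  intro k p q h
  have hh := h
  unfold Sval at hh
  rw [Module.End.mul_apply, Module.End.mul_apply, opE_vv]
  by_cases h1 : k + p - q = l ∨ k + p - q = 2 * n + 1 - l
  · rw [if_pos h1, opX_vv (by omega) (by omega), map_add]
    congr 1
    · split_ifs with h3
      · rw [opE_vv, if_pos (by omega)]
      · simp
    · split_ifs with h3
      · rw [opE_vv, if_pos (by omega)]
      · simp
  · rw [if_neg h1, opX_vv (by omega) (by omega), if_neg (by omega), if_neg (by omega)]; simp

theorem opX_opX {n : ℕ} {j k p q : ℤ} (h : Sval n k p q) :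
    opX n (2 * n - j) (opX n j (vv n k p q)) =
      if k + p - q = j ∨ k + p - q = 2 * n + 1 - j then vv n k (p + 1) (q + 1) else 0 := by
  have hh := h
  unfold Sval at hh
  rw [opX_vv (by omega) (by omega), map_add]
  by_cases h1 : k + p - q = j
  · rw [if_pos h1, if_neg (by omega), if_pos (by omega), opX_vv (by omega) (by omega),
      if_neg (by omega), if_pos (by omega)]; simp
  · by_cases h2 : k + p - q = 2 * n + 1 - j
    · rw [if_neg h1, if_pos h2, if_pos (by omega), opX_vv (by omega) (by omega),
        if_pos (by omega), if_neg (by omega)]; simp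
    · rw [if_neg h1, if_neg h2, if_neg (by omega)]; simp

theorem opX_zero {n : ℕ} {j : ℤ} (hj : ¬ (1 ≤ j ∧ j < 2 * n)) : opX n j = 0 := by
  apply VS_ext
  intro k p q h
  have hh := h
  unfold Sval at hh
  rw [opX_vv (by omega) (by omega)]
  have h1 : k + p - q = j → vv n k (p + 1) q = 0 := by
    intro h1; apply vv_bad; unfold Sval; omega
  have h2 : k + p - q = 2 * n + 1 - j → vv n k p (q + 1) = 0 := by
    intro h1; apply vv_bad; unfold Sval; omega
  split_ifs with h3 h4 h4
  · rw [h1 h3, h2 h4]; simp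
  · rw [h1 h3]; simp
  · rw [h2 h4]; simp
  · simp

theorem opX_preproj (n : ℕ) :
    ∑ i : Fin n, ((if (i : ℕ) + 1 < n then opX n (i + 1) else 0) *
        (if (i : ℕ) + 1 < n then opX n (2 * n - 1 - i) else 0)
      - (if (i : ℕ) + 1 < n then opX n (2 * n - 1 - i) else 0) *
        (if (i : ℕ) + 1 < n then opX n (i + 1) else 0)) = opX n n * opX n n := by
  apply VS_ext
  intro k p q h
  have hh := h
  unfold Sval at hh
  rw [LinearMap.sum_apply]
  set W := vv n k (p + 1) (q + 1) with hW
  set t := k + p - q with ht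
  let f : ℕ → VS n := fun i => if t = i + 1 ∨ t = 2 * n - i then W else 0
  obtain ⟨m, rfl⟩ : ∃ m, n = m + 1 := ⟨n - 1, by omega⟩
  have key : ∀ i : Fin (m + 1), ((if (i : ℕ) + 1 < m + 1 then opX (m + 1) (i + 1) else 0) *
        (if (i : ℕ) + 1 < m + 1 then opX (m + 1) (2 * (m + 1 : ℕ) - 1 - i) else 0)
      - (if (i : ℕ) + 1 < m + 1 then opX (m + 1) (2 * (m + 1 : ℕ) - 1 - i) else 0) *
        (if (i : ℕ) + 1 < m + 1 then opX (m + 1) (i + 1) else 0)) (vv (m + 1) k p q)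
      = if (i : ℕ) < m then f (i + 1) - f i else 0 := by
    intro i
    by_cases hi : (i : ℕ) < m
    · have hi' : (i : ℕ) + 1 < m + 1 := by omega
      simp only [hi, hi', if_true, LinearMap.sub_apply, Module.End.mul_apply]
      have e1 := opX_opX (n := m + 1) (j := i + 1) h
      have e2 := opX_opX (n := m + 1) (j := 2 * (m + 1 : ℕ) - 1 - i) h
      rw [show 2 * ((m + 1 : ℕ) : ℤ) - (i + 1) = 2 * (m + 1 : ℕ) - 1 - i by ring] at e1
      rw [show 2 * ((m + 1 : ℕ) : ℤ) - (2 * (m + 1 : ℕ) - 1 - i) = i + 1 by ring] at e2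
      rw [e1, e2]
      congr 1
      · simp only [f, ← ht, ← hW]
        congr 1; push_cast; simp only [eq_iff_iff]; omega
      · simp only [f, ← ht, ← hW]
        congr 1; push_cast; simp only [eq_iff_iff]; omega
    · have hi' : ¬ ((i : ℕ) + 1 < m + 1) := by omega
      simp [hi]
  rw [Finset.sum_congr rfl (fun i _ => key i), Fin.sum_univ_castSucc]
  simp only [Fin.val_castSucc, Fin.is_lt, if_true, Fin.val_last, lt_irrefl, if_false, add_zero]
  rw [Fin.sum_univ_eq_sum_range (fun i => f (i + 1) - f i), Finset.sum_range_sub]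
  have h0 : f 0 = 0 := by
    simp only [f]
    split_ifs with h1
    · apply vv_bad; unfold Sval; push_cast at *; omega
    · rfl
  rw [h0, sub_zero, Module.End.mul_apply]
  have e3 := opX_opX (n := m + 1) (j := (m + 1 : ℕ)) h
  rw [show 2 * ((m + 1 : ℕ) : ℤ) - (m + 1 : ℕ) = (m + 1 : ℕ) by ring] at e3
  rw [e3]
  simp only [f, ← ht, ← hW]
  congr 1; push_cast; simp only [eq_iff_iff]; omega

noncomputable def repGen (n : ℕ) : TGen n → Module.End ℂ (VS n)
  | .e i => opE n (i + 1)
  | .a i => if (i : ℕ) + 1 < n then opX n (i + 1) else 0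
  | .astar i => if (i : ℕ) + 1 < n then opX n (2 * n - 1 - i) else 0
  | .b => opX n n

theorem repGen_rel (n : ℕ) : ∀ ⦃x y : F n⦄, TRel n x y →
    FreeAlgebra.lift ℂ (repGen n) x = FreeAlgebra.lift ℂ (repGen n) y := by
  have hg : ∀ x : TGen n, FreeAlgebra.lift ℂ (repGen n) (g x) = repGen n x := fun x => by
    simp [g]
  intro x y h
  induction h with
  | idem i j =>
    rw [map_mul, hg, hg, apply_ite (FreeAlgebra.lift ℂ (repGen n)), hg, map_zero]
    simp only [repGen, opE_mul]
    by_cases hij : i = j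
    · simp [hij]
    · rw [if_neg hij, if_neg]
      simp only [Fin.ext_iff] at hij
      omega
  | sum_idem => rw [map_sum, map_one]; simp only [hg, repGen, opE_sum]
  | a_path i h =>
    simp only [map_mul, hg, repGen, if_pos h]
    exact opX_path n _ _ _ (by simp) (by simp)
  | a_junk i h => simp only [hg, repGen, if_neg h, map_zero]
  | astar_path i h =>
    simp only [map_mul, hg, repGen, if_pos h]
    exact opX_path n _ _ _ (by right; ring) (by right; push_cast; ring)
  | astar_junk i h => simp only [hg, repGen, if_neg h, map_zero]
  | b_path i h =>
    simp only [map_mul, hg, repGen]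
    exact opX_path n _ _ _ (by omega) (by omega)
  | preproj =>
    rw [map_sum]
    simp only [map_mul, map_sub, hg, repGen]
    exact opX_preproj n

noncomputable def rep (n : ℕ) : PiT n →ₐ[ℂ] Module.End ℂ (VS n) :=
  RingQuot.liftAlgHom ℂ ⟨FreeAlgebra.lift ℂ (repGen n), repGen_rel n⟩

theorem rep_gen {n : ℕ} (x : TGen n) : rep n (gen x) = repGen n x := by
  simp [rep, gen, g]

theorem rep_E {n : ℕ} (j : ℤ) (h : 1 ≤ j ∧ j ≤ n) : rep n (E n j) = opE n j := by
  rw [E_of_le h.2, ev_gen h, rep_gen, repGen]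
  congr 1; simp; omega

theorem rep_xi {n : ℕ} (j : ℤ) : rep n (xi n j) = opX n j := by
  by_cases h : (1 ≤ j ∧ j < 2 * n)
  · unfold xi
    split_ifs with h1 h2 h3
    · rw [rep_gen, repGen, if_pos (by simp; omega)]; congr 1; simp; omega
    · rw [rep_gen, repGen, h2]
    · rw [rep_gen, repGen, if_pos (by simp; omega)]; congr 1; simp; omega
    · omega
  · rw [xi_zero h, opX_zero h, map_zero]

noncomputable def crd (n : ℕ) : PiT n →ₗ[ℂ] VS n :=
  LinearMap.applyₗ (∑ k ∈ Finset.Icc (1 : ℤ) n, vv n k 0 0) ∘ₗ (rep n).toLinearMap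

theorem crd_mul {n : ℕ} (x y : PiT n) : crd n (x * y) = rep n x (crd n y) := by
  simp [crd]

theorem crd_mm {n : ℕ} {k p q : ℤ} (hk : 1 ≤ k ∧ k ≤ n) (hp : 0 ≤ p) (hq : 0 ≤ q) :
    crd n (mm n k p q) = vv n k p q := by
  refine pq_ind (P := fun p q => crd n (mm n k p q) = vv n k p q) ?_ ?_ ?_ p q hp hq
  · rw [mm_zero_zero]
    have : crd n (E n k) = rep n (E n k) (∑ k ∈ Finset.Icc (1 : ℤ) n, vv n k 0 0) := rfl
    rw [this, rep_E k hk, map_sum]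
    simp only [opE_vv]
    rw [Finset.sum_eq_single k]
    · simp
    · intro i hi hne
      simp at hi
      rw [if_neg (by omega)]
    · simp; omega
  · intro p q hp hq ih
    rw [← xi_mm hp, crd_mul, ih, rep_xi, opX_vv hp hq, if_pos rfl, if_neg (by omega), add_zero]
  · intro p q hp hq ih
    rw [← eta_mm hq, crd_mul, ih, rep_xi, opX_vv hp hq, if_neg (by omega), if_pos (by omega),
      zero_add]

noncomputable def bs (n : ℕ) : VS n →ₗ[ℂ] PiT n :=
  Finsupp.linearCombination ℂ (fun s : S n => mm n s.1.1 s.1.2.1 s.1.2.2)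

theorem bs_vv {n : ℕ} {k p q : ℤ} (h : Sval n k p q) : bs n (vv n k p q) = mm n k p q := by
  rw [vv, dif_pos h, bs, Finsupp.linearCombination_single, one_smul]

theorem crd_bs (n : ℕ) : crd n ∘ₗ bs n = LinearMap.id := by
  apply VS_ext
  intro k p q h
  have hh := h
  unfold Sval at hh
  rw [LinearMap.comp_apply, bs_vv h, crd_mm (by omega) (by omega) (by omega)]; rfl

theorem mm_mem_range {n : ℕ} (k p q : ℤ) : mm n k p q ∈ LinearMap.range (bs n) := by
  by_cases h : Sval n k p q
  · exact ⟨_, bs_vv h⟩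
  · by_cases h2 : Sval n (2 * n + 1 - k) q p
    · rw [← mm_sigma]; exact ⟨_, bs_vv h2⟩
    · rw [mm_bad]
      · exact zero_mem _
      · unfold Sval at h h2; omega

theorem xi_mul_mm {n : ℕ} (j k p q : ℤ) (hp : 0 ≤ p) (hq : 0 ≤ q) : xi n j * mm n k p q =
    if k + p - q = j then mm n k (p + 1) q else
    if k + p - q = 2 * n + 1 - j then mm n k p (q + 1) else 0 := by
  split_ifs with h1 h2
  · rw [← h1, xi_mm hp]
  · rw [← eta_mm hq, h2]; congr 2; ring
  · rw [← xi_E, mul_assoc, E_mm, if_neg (by omega), mul_zero]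

theorem gen_cases {n : ℕ} (x : TGen n) : (∃ j, 1 ≤ j ∧ j ≤ (n:ℤ) ∧ gen x = E n j ∧ wt x = 0) ∨
    ((∃ j, gen x = xi n j) ∧ wt x = 1) ∨ (gen x = 0 ∧ wt x = 1) := by
  cases x with
  | e i =>
    left; refine ⟨i + 1, by omega, by omega, ?_, rfl⟩
    rw [E_of_le (by omega), ev_gen (by omega)]; congr; simp
  | a i =>
    by_cases hi : (i : ℕ) + 1 < n
    · right; left; refine ⟨⟨i + 1, ?_⟩, rfl⟩
      rw [xi, dif_pos (by omega)]; congr; simp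
    · right; right; exact ⟨gen_a_junk i hi, rfl⟩
  | astar i =>
    by_cases hi : (i : ℕ) + 1 < n
    · right; left; refine ⟨⟨2 * n - 1 - i, ?_⟩, rfl⟩
      rw [xi, dif_neg (by omega), if_neg (by omega), dif_pos (by omega)]; congr; simp
    · right; right; exact ⟨gen_astar_junk i hi, rfl⟩
  | b => right; left; exact ⟨⟨n, by simp [xi]⟩, rfl⟩

theorem gen_induction {n : ℕ} {P : PiT n → Prop} (hg : ∀ x, P (gen x))
    (hs : ∀ c, P (algebraMap ℂ _ c))
    (ha : ∀ x y, P x → P y → P (x + y)) (hm : ∀ x y, P x → P y → P (x * y)) (a : PiT n) : P a := by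
  obtain ⟨x, rfl⟩ := RingQuot.mkAlgHom_surjective ℂ (TRel n) a
  induction x using FreeAlgebra.induction with
  | grade0 r => rw [AlgHom.commutes]; exact hs r
  | grade1 x => exact hg x
  | mul a b h1 h2 => rw [map_mul]; exact hm _ _ h1 h2
  | add a b h1 h2 => rw [map_add]; exact ha _ _ h1 h2

theorem gen_mul_mem {n : ℕ} (x : TGen n) (s : S n) :
    gen x * mm n s.1.1 s.1.2.1 s.1.2.2 ∈ LinearMap.range (bs n) := by
  obtain ⟨⟨k, p, q⟩, hs⟩ := s
  have h1 : 1 ≤ k ∧ k ≤ n ∧ 0 ≤ q ∧ q < k ∧ 0 ≤ p ∧ p ≤ 2 * n - k := hs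
  show gen x * mm n k p q ∈ _
  rcases gen_cases x with ⟨j, _, _, hj, _⟩ | ⟨⟨j, hj⟩, _⟩ | ⟨h0, _⟩
  · rw [hj, E_mm]; split_ifs
    · exact mm_mem_range _ _ _
    · exact zero_mem _
  · rw [hj, xi_mul_mm _ _ _ _ (by omega) (by omega)]; split_ifs
    · exact mm_mem_range _ _ _
    · exact mm_mem_range _ _ _
    · exact zero_mem _
  · rw [h0, zero_mul]; exact zero_mem _

theorem bs_surj (n : ℕ) : LinearMap.range (bs n) = ⊤ := by
  have key : ∀ a : PiT n, ∀ y ∈ LinearMap.range (bs n), a * y ∈ LinearMap.range (bs n) := by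
    intro a
    induction a using gen_induction with
    | hg x =>
      rintro _ ⟨v, rfl⟩
      induction v using Finsupp.induction_linear with
      | zero => simp
      | add f g hf hg => rw [map_add, mul_add]; exact add_mem hf hg
      | single s c =>
        rw [bs, Finsupp.linearCombination_single, mul_smul_comm]
        exact Submodule.smul_mem _ _ (gen_mul_mem x s)
    | hs c =>
      intro y hy
      rw [← Algebra.smul_def]; exact Submodule.smul_mem _ _ hy
    | ha x y hx hy => intro z hz; rw [add_mul]; exact add_mem (hx z hz) (hy z hz)
    | hm x y hx hy => intro z hz; rw [mul_assoc]; exact hx _ (hy z hz)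
  rw [eq_top_iff]
  intro a _
  rw [← mul_one a]
  apply key
  rw [← sum_E]
  apply Submodule.sum_mem
  intro k _
  rw [← mm_zero_zero]; exact mm_mem_range _ _ _

theorem bs_crd (n : ℕ) : bs n ∘ₗ crd n = LinearMap.id := by
  ext1 a
  obtain ⟨v, rfl⟩ : a ∈ LinearMap.range (bs n) := by rw [bs_surj]; trivial
  have := LinearMap.congr_fun (crd_bs n) v
  simp only [LinearMap.comp_apply, LinearMap.id_apply] at this ⊢
  rw [this]

/-- coordinate functional, zero for invalid indices -/
noncomputable def co (n : ℕ) (k p q : ℤ) : PiT n →ₗ[ℂ] ℂ :=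
  if h : Sval n k p q then (Finsupp.lapply ⟨(k, p, q), h⟩) ∘ₗ crd n else 0

theorem co_bad {n : ℕ} {k p q : ℤ} (h : ¬ Sval n k p q) : co n k p q = 0 := dif_neg h

theorem co_mm {n : ℕ} {k p q k' p' q' : ℤ} (h : Sval n k p q) (h' : Sval n k' p' q') :
    co n k p q (mm n k' p' q') = if k = k' ∧ p = p' ∧ q = q' then 1 else 0 := by
  have hh := h'
  unfold Sval at hh
  rw [co, dif_pos h, LinearMap.comp_apply, crd_mm (by omega) (by omega) (by omega), vv, dif_pos h']
  simp only [Finsupp.lapply_apply, Finsupp.single_apply, Subtype.mk.injEq, Prod.mk.injEq]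
  congr 1
  simp only [eq_iff_iff]; omega

theorem sum_co {n : ℕ} (a : PiT n) :
    ∑ s : S n, co n s.1.1 s.1.2.1 s.1.2.2 a • mm n s.1.1 s.1.2.1 s.1.2.2 = a := by
  have := LinearMap.congr_fun (bs_crd n) a
  simp only [LinearMap.comp_apply, LinearMap.id_apply] at this
  conv_rhs => rw [← this, bs, Finsupp.linearCombination_apply, Finsupp.sum_fintype _ _ (by simp)]
  apply Finset.sum_congr rfl
  intro s _
  rw [co, dif_pos s.2]; rfl

theorem span_mm (n : ℕ) : Submodule.span ℂ (Set.range fun s : S n => mm n s.1.1 s.1.2.1 s.1.2.2) = ⊤ := by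
  rw [eq_top_iff]; intro a _
  rw [← sum_co a]
  exact Submodule.sum_mem _ fun s _ => Submodule.smul_mem _ _ (Submodule.subset_span ⟨s, rfl⟩)

/-! the grading automorphism -/

theorem phi_rel (n : ℕ) : ∀ ⦃x y : F n⦄, TRel n x y →
    FreeAlgebra.lift ℂ (fun z : TGen n => (2 : ℂ) ^ wt z • gen z) x
      = FreeAlgebra.lift ℂ (fun z : TGen n => (2 : ℂ) ^ wt z • gen z) y := by
  have hg : ∀ x : TGen n, FreeAlgebra.lift ℂ (fun z : TGen n => (2 : ℂ) ^ wt z • gen z) (g x)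
     = (2 : ℂ) ^ wt x • gen x := fun x => by
    simp [g]
  generalize FreeAlgebra.lift ℂ (fun z : TGen n => (2 : ℂ) ^ wt z • gen z) = L at hg
  intro x y h
  induction h with
  | idem i j =>
    rw [apply_ite L]
    simp only [map_mul, hg, map_zero, wt, pow_zero, one_smul, gen_e_mul]
  | sum_idem => rw [map_sum, map_one]; simp only [hg, wt, pow_zero, one_smul, gen_e_sum]
  | a_path i h => simp [hg, wt, gen_a_path]
  | a_junk i h => simp [hg, wt, gen_a_junk i h]
  | astar_path i h => simp [hg, wt, gen_astar_path]
  | astar_junk i h => simp [hg, wt, gen_astar_junk i h]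
  | b_path i h => simp [hg, wt, gen_b_path i h]
  | preproj =>
    rw [map_sum, map_mul, hg]
    simp only [map_mul, map_sub, hg, wt, pow_one, smul_mul_assoc, mul_smul_comm]
    rw [← gen_preproj, Finset.smul_sum, Finset.smul_sum]
    simp only [smul_sub]

noncomputable def phi (n : ℕ) : PiT n →ₐ[ℂ] PiT n :=
  RingQuot.liftAlgHom ℂ ⟨FreeAlgebra.lift ℂ (fun z : TGen n => (2 : ℂ) ^ wt z • gen z), phi_rel n⟩

theorem phi_gen {n : ℕ} (x : TGen n) : phi n (gen x) = (2 : ℂ) ^ wt x • gen x := by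
  simp [phi, gen, g]

theorem phi_E {n : ℕ} (j : ℤ) : phi n (E n j) = E n j := by
  have : ∀ j, phi n (ev n j) = ev n j := by
    intro j; unfold ev; split_ifs
    · rw [phi_gen]; simp [wt]
    · simp
  rw [E, map_add, this, this]

theorem phi_xi {n : ℕ} (j : ℤ) : phi n (xi n j) = (2 : ℂ) • xi n j := by
  unfold xi; split_ifs <;> simp [phi_gen, wt]

theorem phi_mm {n : ℕ} (k p q : ℤ) : phi n (mm n k p q) = (2 : ℂ) ^ (p + q) • mm n k p q := by
  by_cases hpq : 0 ≤ p ∧ 0 ≤ q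
  · refine pq_ind (P := fun p q => phi n (mm n k p q) = (2 : ℂ) ^ (p + q) • mm n k p q)
      ?_ ?_ ?_ p q hpq.1 hpq.2
    · simp [mm_zero_zero, phi_E]
    · intro p q hp hq ih
      rw [← xi_mm hp, map_mul, ih, phi_xi, smul_mul_smul_comm, add_right_comm, zpow_add_one₀ (by simp),
        mul_comm]
    · intro p q hp hq ih
      rw [← eta_mm hq, map_mul, ih, phi_xi, smul_mul_smul_comm, ← add_assoc, zpow_add_one₀ (by simp),
        mul_comm]
  · rw [mm_neg hpq]; simp

end TPre

namespace TPre
open TensorProduct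

/-! ### Part 2: operators on the bar complex -/

noncomputable def tm (n m : ℕ) : PiT n →ₗ[ℂ] Ch n m →ₗ[ℂ] Ch n (m + 1) :=
  TensorProduct.mk ℂ (PiT n) (Ch n m)

theorem Ch_ind {n m : ℕ} {P : Ch n (m + 1) → Prop} (x : Ch n (m + 1))
    (ha : ∀ x y, P x → P y → P (x + y)) (ht : ∀ a t, P (tm n m a t)) : P x := by
  refine TensorProduct.induction_on (R := ℂ) (M := PiT n) (N := Ch n m) (motive := P) x ?_ ?_ ?_
  · have := ht 0 0
    rw [map_zero] at this
    exact this
  · intro a t; exact ht a t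
  · intro x y hx hy; exact ha x y hx hy

theorem Ch_ext {n m : ℕ} {M : Type*} [AddCommGroup M] [Module ℂ M] {f g : Ch n (m + 1) →ₗ[ℂ] M}
    (h : ∀ a t, f (tm n m a t) = g (tm n m a t)) : f = g := by
  apply LinearMap.ext
  intro x
  induction x using Ch_ind with
  | ha x y hx hy => rw [map_add, map_add, hx, hy]
  | ht a t => exact h a t

noncomputable def lft (n m : ℕ) {M : Type} [AddCommGroup M] [Module ℂ M]
    (f : PiT n →ₗ[ℂ] Ch n m →ₗ[ℂ] M) : Ch n (m + 1) →ₗ[ℂ] M :=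
  (TensorProduct.lift f : PiT n ⊗[ℂ] Ch n m →ₗ[ℂ] M)

theorem lft_tm {n m : ℕ} {M : Type} [AddCommGroup M] [Module ℂ M]
    (f : PiT n →ₗ[ℂ] Ch n m →ₗ[ℂ] M) (a t) : lft n m f (tm n m a t) = f a t :=
  TensorProduct.lift.tmul _ _

/-- inclusion of `A` in `Ch n 0` (identity) -/
noncomputable def c0 (n : ℕ) : PiT n →ₗ[ℂ] Ch n 0 := (LinearMap.id : PiT n →ₗ[ℂ] PiT n)

theorem c0_surj {n : ℕ} (x : Ch n 0) : ∃ a, c0 n a = x := ⟨x, rfl⟩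
theorem c0_inj {n : ℕ} {a b} (h : c0 n a = c0 n b) : a = b := h

noncomputable def Fst (n : ℕ) : (m : ℕ) → (PiT n →ₗ[ℂ] Module.End ℂ (Ch n m))
  | 0 => LinearMap.mul ℂ (PiT n)
  | (m + 1) => (LinearMap.rTensorHom (Ch n m) :
      (PiT n →ₗ[ℂ] PiT n) →ₗ[ℂ] (PiT n ⊗[ℂ] Ch n m →ₗ[ℂ] PiT n ⊗[ℂ] Ch n m)) ∘ₗ LinearMap.mul ℂ (PiT n)

noncomputable def Lst (n : ℕ) : (m : ℕ) → (PiT n →ₗ[ℂ] Module.End ℂ (Ch n m))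
  | 0 => (LinearMap.mul ℂ (PiT n)).flip
  | (m + 1) => (LinearMap.lTensorHom (PiT n) :
      (Ch n m →ₗ[ℂ] Ch n m) →ₗ[ℂ] (PiT n ⊗[ℂ] Ch n m →ₗ[ℂ] PiT n ⊗[ℂ] Ch n m)) ∘ₗ Lst n m

noncomputable def Rf (n : ℕ) : (m : ℕ) → (PiT n →ₗ[ℂ] Module.End ℂ (Ch n m))
  | 0 => (LinearMap.mul ℂ (PiT n)).flip
  | (m + 1) => (LinearMap.rTensorHom (Ch n m) :
      (PiT n →ₗ[ℂ] PiT n) →ₗ[ℂ] (PiT n ⊗[ℂ] Ch n m →ₗ[ℂ] PiT n ⊗[ℂ] Ch n m)) ∘ₗ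
        (LinearMap.mul ℂ (PiT n)).flip

noncomputable def phc (n : ℕ) : (m : ℕ) → Module.End ℂ (Ch n m)
  | 0 => (phi n).toLinearMap
  | (m + 1) => (TensorProduct.map (phi n).toLinearMap (phc n m) :
      PiT n ⊗[ℂ] Ch n m →ₗ[ℂ] PiT n ⊗[ℂ] Ch n m)

/-- left multiplication on the second factor -/
noncomputable def Sec (n m : ℕ) (a : PiT n) : Module.End ℂ (Ch n (m + 1)) :=
  (LinearMap.lTensor (PiT n) (Fst n m a) : PiT n ⊗[ℂ] Ch n m →ₗ[ℂ] PiT n ⊗[ℂ] Ch n m)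

/-- insertion after the first factor -/
noncomputable def ins (n : ℕ) : (m : ℕ) → PiT n → (Ch n m →ₗ[ℂ] Ch n (m + 1))
  | 0, a => (tm n 0).flip (c0 n a) 
  | (m + 1), a => lft n m (LinearMap.compr₂ (LinearMap.compl₂ (tm n (m+1)) (tm n m a)) LinearMap.id)

theorem Fst_c0 {n : ℕ} (a b : PiT n) : Fst n 0 a (c0 n b) = c0 n (a * b) := rfl
theorem Lst_c0 {n : ℕ} (a b : PiT n) : Lst n 0 a (c0 n b) = c0 n (b * a) := rfl
theorem Rf_c0 {n : ℕ} (a b : PiT n) : Rf n 0 a (c0 n b) = c0 n (b * a) := rfl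
theorem phc_c0 {n : ℕ} (b : PiT n) : phc n 0 (c0 n b) = c0 n (phi n b) := rfl
theorem Fst_tm {n m : ℕ} (a b : PiT n) (t) : Fst n (m + 1) a (tm n m b t) = tm n m (a * b) t := rfl
theorem Lst_tm {n m : ℕ} (a b : PiT n) (t) :
    Lst n (m + 1) a (tm n m b t) = tm n m b (Lst n m a t) := rfl
theorem Rf_tm {n m : ℕ} (a b : PiT n) (t) : Rf n (m + 1) a (tm n m b t) = tm n m (b * a) t := rfl
theorem phc_tm {n m : ℕ} (b : PiT n) (t) :
    phc n (m + 1) (tm n m b t) = tm n m (phi n b) (phc n m t) := rfl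
theorem Sec_tm {n m : ℕ} (a b : PiT n) (t) : Sec n m a (tm n m b t) = tm n m b (Fst n m a t) := rfl
theorem ins_c0 {n : ℕ} (a b : PiT n) : ins n 0 a (c0 n b) = tm n 0 b (c0 n a) := rfl
theorem ins_tm {n m : ℕ} (a b : PiT n) (t) :
    ins n (m + 1) a (tm n m b t) = tm n (m + 1) b (tm n m a t) := by
  rw [ins, lft_tm]; rfl

theorem d0_tm {n m : ℕ} (a : PiT n) (t) : d0 n m (tm n m a t) = Fst n m a t := by
  cases m with
  | zero => rfl
  | succ m =>
    induction t using Ch_ind with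
    | ha x y hx hy => rw [map_add, map_add, hx, hy, map_add]
    | ht b s => rfl

theorem bp_zero {n : ℕ} (x) : bp n 0 x = d0 n 0 x := rfl
theorem bp_tm {n m : ℕ} (a : PiT n) (t) :
    bp n (m + 1) (tm n (m + 1) a t) = Fst n (m + 1) a t - tm n m a (bp n m t) := by
  have : bp n (m + 1) (tm n (m + 1) a t) = d0 n (m + 1) (tm n (m + 1) a t) - tm n m a (bp n m t) := rfl
  rw [this, d0_tm]
theorem bp_tm0 {n : ℕ} (a : PiT n) (t) : bp n 0 (tm n 0 a t) = Fst n 0 a t := rfl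

theorem rot_zero {n : ℕ} (x) : rot n 0 x = x := rfl
theorem rot_tm {n m : ℕ} (a : PiT n) (t) :
    rot n (m + 1) (tm n m a t) = ins n m a (rot n m t) := by
  cases m with
  | zero => rfl
  | succ m =>
    have : ∀ u : Ch n (m + 1), ((TensorProduct.assoc ℂ (PiT n) (PiT n) (Ch n m)).toLinearMap ∘ₗ
      (LinearMap.rTensor (Ch n m) (TensorProduct.comm ℂ (PiT n) (PiT n)).toLinearMap) ∘ₗ
      (TensorProduct.assoc ℂ (PiT n) (PiT n) (Ch n m)).symm.toLinearMap) (tm n (m + 1) a u)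
        = ins n (m + 1) a u := by
      intro u
      induction u using Ch_ind with
      | ha x y hx hy => 
        rw [map_add, map_add]
        erw [map_add]
        rw [hx, hy]
        rfl
      | ht b s => rw [ins_tm]; rfl
    exact this _

theorem Fst_mul {n m : ℕ} (a b : PiT n) (x) : Fst n m (a * b) x = Fst n m a (Fst n m b x) := by
  cases m with
  | zero => obtain ⟨c, rfl⟩ := c0_surj x; simp only [Fst_c0, mul_assoc]
  | succ m =>
    induction x using Ch_ind with
    | ha x y hx hy => simp only [map_add, hx, hy]
    | ht c s => simp only [Fst_tm, mul_assoc]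

theorem Lst_mul {n m : ℕ} (a b : PiT n) (x) : Lst n m (a * b) x = Lst n m b (Lst n m a x) := by
  induction m with
  | zero => obtain ⟨c, rfl⟩ := c0_surj x; simp only [Lst_c0, mul_assoc]
  | succ m ih =>
    induction x using Ch_ind with
    | ha x y hx hy => simp only [map_add, hx, hy]
    | ht c s => simp only [Lst_tm, ih]

theorem Fst_one {n m : ℕ} (x) : Fst n m 1 x = x := by
  cases m with
  | zero => obtain ⟨c, rfl⟩ := c0_surj x; simp only [Fst_c0, one_mul]
  | succ m =>
    induction x using Ch_ind with
    | ha x y hx hy => simp only [map_add, hx, hy]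
    | ht c s => simp only [Fst_tm, one_mul]

theorem Lst_one {n m : ℕ} (x) : Lst n m 1 x = x := by
  induction m with
  | zero => obtain ⟨c, rfl⟩ := c0_surj x; simp only [Lst_c0, mul_one]
  | succ m ih =>
    induction x using Ch_ind with
    | ha x y hx hy => simp only [map_add, hx, hy]
    | ht c s => simp only [Lst_tm, ih]

theorem Fst_Lst {n m : ℕ} (a b : PiT n) (x) :
    Fst n m a (Lst n m b x) = Lst n m b (Fst n m a x) := by
  cases m with
  | zero => obtain ⟨c, rfl⟩ := c0_surj x; simp only [Fst_c0, Lst_c0, mul_assoc]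
  | succ m =>
    induction x using Ch_ind with
    | ha x y hx hy => simp only [map_add, hx, hy]
    | ht c s => simp only [Fst_tm, Lst_tm]

theorem d0_Lst {n m : ℕ} (a : PiT n) (x) : d0 n m (Lst n (m + 1) a x) = Lst n m a (d0 n m x) := by
  induction x using Ch_ind with
  | ha x y hx hy => simp only [map_add, hx, hy]
  | ht c s => rw [Lst_tm, d0_tm, d0_tm, Fst_Lst]

theorem d0_Fst {n m : ℕ} (a : PiT n) (x) : d0 n m (Fst n (m + 1) a x) = Fst n m a (d0 n m x) := by
  induction x using Ch_ind with
  | ha x y hx hy => simp only [map_add, hx, hy]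
  | ht c s => rw [Fst_tm, d0_tm, d0_tm, Fst_mul]

theorem bp_Lst {n m : ℕ} (a : PiT n) (x) : bp n m (Lst n (m + 1) a x) = Lst n m a (bp n m x) := by
  induction m with
  | zero => exact d0_Lst a x
  | succ m ih =>
    induction x using Ch_ind with
    | ha x y hx hy => simp only [map_add, hx, hy]
    | ht c s => rw [Lst_tm, bp_tm, bp_tm, map_sub, ih, Fst_Lst, Lst_tm]

theorem bp_Fst {n m : ℕ} (a : PiT n) (x) : bp n m (Fst n (m + 1) a x) = Fst n m a (bp n m x) := by
  cases m with
  | zero => exact d0_Fst a x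
  | succ m =>
    induction x using Ch_ind with
    | ha x y hx hy => simp only [map_add, hx, hy]
    | ht c s => rw [Fst_tm, bp_tm, bp_tm, map_sub, Fst_mul, Fst_tm]

theorem bp_bp {n m : ℕ} (x) : bp n m (bp n (m + 1) x) = 0 := by
  induction m with
  | zero =>
    induction x using Ch_ind with
    | ha x y hx hy => simp only [map_add, hx, hy, add_zero]
    | ht c s => rw [bp_tm, map_sub, bp_tm0, bp_Fst, sub_self]
  | succ m ih =>
    induction x using Ch_ind with
    | ha x y hx hy => simp only [map_add, hx, hy, add_zero]
    | ht c s => rw [bp_tm, map_sub, bp_tm, bp_Fst, ih, map_zero, sub_zero, sub_self]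

theorem Rf_ins {n m : ℕ} (y a : PiT n) (u) :
    Rf n (m + 1) y (ins n m a u) = ins n m a (Rf n m y u) := by
  cases m with
  | zero => obtain ⟨b, rfl⟩ := c0_surj u; rw [ins_c0, Rf_tm, Rf_c0, ins_c0]
  | succ m =>
    induction u using Ch_ind with
    | ha x y hx hy => simp only [map_add, hx, hy]
    | ht c s => rw [ins_tm, Rf_tm, Rf_tm, ins_tm]

theorem rot_Lst {n m : ℕ} (y : PiT n) (t) : rot n m (Lst n m y t) = Rf n m y (rot n m t) := by
  induction m with
  | zero => rfl
  | succ m ih =>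
    induction t using Ch_ind with
    | ha x y hx hy => simp only [map_add, hx, hy]
    | ht c s => rw [Lst_tm, rot_tm, rot_tm, ih, Rf_ins]

theorem d0_ins {n m : ℕ} (a : PiT n) (u) : d0 n m (ins n m a u) = Rf n m a u := by
  cases m with
  | zero => obtain ⟨b, rfl⟩ := c0_surj u; rw [ins_c0, d0_tm, Rf_c0, Fst_c0]
  | succ m =>
    induction u using Ch_ind with
    | ha x y hx hy => simp only [map_add, hx, hy]
    | ht c s => rw [ins_tm, d0_tm, Rf_tm, Fst_tm]

/-- the cyclic face -/
noncomputable def cc (n m : ℕ) : Ch n (m + 1) →ₗ[ℂ] Ch n m := d0 n m ∘ₗ rot n (m + 1)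

theorem cc_tm {n m : ℕ} (y : PiT n) (t) : cc n m (tm n m y t) = rot n m (Lst n m y t) := by
  rw [cc, LinearMap.comp_apply, rot_tm, d0_ins, rot_Lst]

theorem cc_Fst {n m : ℕ} (y : PiT n) (x) : cc n m (Fst n (m + 1) y x) = cc n m (Lst n (m + 1) y x) := by
  induction x using Ch_ind with
  | ha x y hx hy => simp only [map_add, hx, hy]
  | ht c s => rw [Fst_tm, Lst_tm, cc_tm, cc_tm, Lst_mul]

theorem rot_Fst {n m : ℕ} (a : PiT n) (t) :
    rot n (m + 1) (Fst n (m + 1) a t) = Sec n m a (rot n (m + 1) t) := by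
  induction t using Ch_ind with
  | ha x y hx hy => simp only [map_add, hx, hy]
  | ht c s =>
    rw [Fst_tm, rot_tm, rot_tm]
    generalize rot n m s = u
    cases m with
    | zero => obtain ⟨b, rfl⟩ := c0_surj u; rw [ins_c0, ins_c0, Sec_tm, Fst_c0]
    | succ m =>
      induction u using Ch_ind with
      | ha x y hx hy => simp only [map_add, hx, hy]
      | ht c s => rw [ins_tm, ins_tm, Sec_tm, Fst_tm]

theorem add_comb {M : Type*} [AddCommGroup M] {a b c d x y : M} (h1 : a = b) (h2 : c = d)
    (hx : x = a + c) (hy : y = b + d) : x = y := by rw [hx, hy, h1, h2]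

theorem bp_ins {n m : ℕ} (a : PiT n) (w) :
    bp n (m + 1) (ins n (m + 1) a w) + ins n m a (bp n m w) =
      Rf n (m + 1) a w - Sec n m a w + ins n m a (d0 n m w) := by
  induction w using Ch_ind with
  | ha x y hx hy =>
    simp only [map_add]
    exact add_comb hx hy (by abel) (by abel)
  | ht b s =>
    rw [ins_tm, bp_tm, Fst_tm, Rf_tm, Sec_tm, d0_tm]
    cases m with
    | zero => rw [bp_tm0, bp_tm0]
    | succ m => rw [bp_tm, bp_tm, map_sub, map_sub, ins_tm]; abel

theorem d0_rot_ins {n m : ℕ} (a : PiT n) (w) :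
    d0 n (m + 1) (rot n (m + 2) (ins n (m + 1) a w)) = ins n m a (d0 n m (rot n (m + 1) w)) := by
  induction w using Ch_ind with
  | ha x y hx hy => simp only [map_add, hx, hy]
  | ht b s => rw [ins_tm, rot_tm, rot_tm, rot_tm, d0_ins, d0_ins, Rf_ins]

theorem bp_rot {n m : ℕ} (u) :
    bp n m (rot n (m + 1) u) + rot n m (bp n m u) =
      cc n m u + (-1 : ℂ) ^ m • d0 n m (rot n (m + 1) (rot n (m + 1) u)) := by
  induction m with
  | zero =>
    induction u using Ch_ind with
    | ha x y hx hy =>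
      simp only [map_add, smul_add]
      exact add_comb hx hy (by abel) (by abel)
    | ht a t =>
      obtain ⟨b, rfl⟩ := c0_surj t
      rw [cc_tm, rot_tm, rot_zero, ins_c0, rot_tm, rot_zero, rot_zero, rot_zero, ins_c0, bp_tm0, bp_tm0, d0_tm, Fst_c0,
        Fst_c0, Lst_c0]
      simp [rot_zero]
  | succ m ih =>
    induction u using Ch_ind with
    | ha x y hx hy =>
      simp only [map_add, smul_add]
      exact add_comb hx hy (by abel) (by abel)
    | ht a t =>
      have h1 := bp_ins a (rot n (m + 1) t)
      have h2 := congrArg (ins n m a) (ih t)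
      rw [map_add, map_add, map_smul] at h2
      have h3 : cc n m t = d0 n m (rot n (m + 1) t) := rfl
      rw [cc_tm, rot_tm, bp_tm, map_sub, rot_tm, rot_Fst, rot_Lst, d0_rot_ins]
      rw [h3] at h2
      rw [pow_succ, mul_neg_one, neg_smul]
      rw [← sub_eq_zero] at h1 h2 ⊢
      rw [← sub_eq_zero.mpr (h1.trans h2.symm)]
      abel

theorem bmap_eq {n m : ℕ} (x) : bmap n m x = bp n m x + (-1 : ℂ) ^ (m + 1) • cc n m x := rfl

theorem bmap_cc {n m : ℕ} (x) : bmap n m (cc n (m + 1) x) = cc n m (bp n (m + 1) x) := by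
  induction x using Ch_ind with
  | ha x y hx hy => simp only [map_add, hx, hy]
  | ht y t =>
    rw [cc_tm, bmap_eq, bp_tm, map_sub, cc_Fst, cc_tm, ← bp_Lst]
    have := bp_rot (Lst n (m + 1) y t)
    have h3 : cc n m (rot n (m + 1) (Lst n (m + 1) y t)) =
      d0 n m (rot n (m + 1) (rot n (m + 1) (Lst n (m + 1) y t))) := rfl
    rw [h3, pow_succ, mul_neg_one, neg_smul, ← sub_eq_add_neg, sub_eq_sub_iff_add_eq_add]
    exact this

theorem ins_surj {n m : ℕ} (x : Ch n (m + 1)) (P : Ch n (m + 1) → Prop)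
    (ha : ∀ x y, P x → P y → P (x + y)) (hi : ∀ a u, P (ins n m a u)) : P x := by
  induction x using Ch_ind with
  | ha x y hx hy => exact ha _ _ hx hy
  | ht a t =>
    cases m with
    | zero => obtain ⟨b, rfl⟩ := c0_surj t; rw [← ins_c0]; exact hi _ _
    | succ m =>
      induction t using Ch_ind with
      | ha x y hx hy => rw [map_add]; exact ha _ _ hx hy
      | ht b s => rw [← ins_tm]; exact hi _ _

theorem rot_surj {n m : ℕ} : Function.Surjective (rot n m) := by
  induction m with
  | zero => exact fun x => ⟨x, rfl⟩
  | succ m ih =>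
    intro x
    refine ins_surj x (fun x => ∃ y, rot n (m + 1) y = x) ?_ ?_
    · rintro _ _ ⟨y, rfl⟩ ⟨z, rfl⟩; exact ⟨y + z, map_add _ _ _⟩
    · intro a u
      obtain ⟨v, rfl⟩ := ih u
      exact ⟨_, rot_tm a v⟩

instance PiT_finite (n : ℕ) : Module.Finite ℂ (PiT n) :=
  Module.Finite.of_surjective (bs n) (LinearMap.range_eq_top.mp (bs_surj n))

instance Ch_finite (n m : ℕ) : Module.Finite ℂ (Ch n m) := by
  induction m with
  | zero => exact PiT_finite n
  | succ m ih => exact (Module.Finite.tensorProduct ℂ (PiT n) (Ch n m))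

theorem rot_inj {n m : ℕ} : Function.Injective (rot n m) :=
  LinearMap.injective_iff_surjective.mpr rot_surj

/-! grading -/

theorem phc_Fst {n m : ℕ} (a : PiT n) (x) :
    phc n m (Fst n m a x) = Fst n m (phi n a) (phc n m x) := by
  cases m with
  | zero => obtain ⟨c, rfl⟩ := c0_surj x; simp only [Fst_c0, phc_c0, map_mul]
  | succ m =>
    induction x using Ch_ind with
    | ha x y hx hy => simp only [map_add, hx, hy]
    | ht c s => rw [Fst_tm, phc_tm, phc_tm, Fst_tm, map_mul]

theorem phc_Lst {n m : ℕ} (a : PiT n) (x) :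
    phc n m (Lst n m a x) = Lst n m (phi n a) (phc n m x) := by
  induction m with
  | zero => obtain ⟨c, rfl⟩ := c0_surj x; simp only [Lst_c0, phc_c0, map_mul]
  | succ m ih =>
    induction x using Ch_ind with
    | ha x y hx hy => simp only [map_add, hx, hy]
    | ht c s => rw [Lst_tm, phc_tm, phc_tm, Lst_tm, ih]

theorem phc_d0 {n m : ℕ} (x) : phc n m (d0 n m x) = d0 n m (phc n (m + 1) x) := by
  induction x using Ch_ind with
  | ha x y hx hy => simp only [map_add, hx, hy]
  | ht c s => rw [d0_tm, phc_tm, d0_tm, phc_Fst]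

theorem phc_bp {n m : ℕ} (x) : phc n m (bp n m x) = bp n m (phc n (m + 1) x) := by
  induction m with
  | zero => exact phc_d0 x
  | succ m ih =>
    induction x using Ch_ind with
    | ha x y hx hy => simp only [map_add, hx, hy]
    | ht c s => rw [bp_tm, phc_tm, bp_tm, map_sub, phc_Fst, phc_tm, ih]

theorem phc_ins {n m : ℕ} (a : PiT n) (u) :
    phc n (m + 1) (ins n m a u) = ins n m (phi n a) (phc n m u) := by
  cases m with
  | zero => obtain ⟨b, rfl⟩ := c0_surj u; rw [ins_c0, phc_tm, phc_c0, phc_c0, ins_c0]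
  | succ m =>
    induction u using Ch_ind with
    | ha x y hx hy => simp only [map_add, hx, hy]
    | ht c s => rw [ins_tm, phc_tm, phc_tm, phc_tm, ins_tm]

theorem phc_rot {n m : ℕ} (x) : phc n m (rot n m x) = rot n m (phc n m x) := by
  induction m with
  | zero => rfl
  | succ m ih =>
    induction x using Ch_ind with
    | ha x y hx hy => simp only [map_add, hx, hy]
    | ht c s => rw [rot_tm, phc_tm, rot_tm, phc_ins, ih]

theorem phc_cc {n m : ℕ} (x) : phc n m (cc n m x) = cc n m (phc n (m + 1) x) := by
  rw [cc, LinearMap.comp_apply, LinearMap.comp_apply, phc_d0, phc_rot]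

theorem phc_bmap {n m : ℕ} (x) : phc n m (bmap n m x) = bmap n m (phc n (m + 1) x) := by
  rw [bmap_eq, bmap_eq, map_add, map_smul, phc_bp, phc_cc]

end TPre

namespace TPre
open TensorProduct

/-! ### the grading through eigenspaces -/

theorem eig_indep {M : Type*} [AddCommGroup M] [Module ℂ M] (f : Module.End ℂ M) :
    iSupIndep (fun e : ℤ => f.eigenspace ((2 : ℂ) ^ e)) := by
  have h := f.eigenspaces_iSupIndep
  apply h.comp (f := fun e : ℤ => (2 : ℂ) ^ e)
  intro a b hab
  simp only at hab
  have : ((2 : ℝ) ^ a) = (2 : ℝ) ^ b := by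
    have h2 := congrArg norm hab
    simpa [norm_zpow] using h2
  exact zpow_right_injective₀ (by norm_num) (by norm_num) this

theorem eig_eq {M : Type*} [AddCommGroup M] [Module ℂ M] (f : Module.End ℂ M)
    (N : ℕ → Submodule ℂ M) (hN : ∀ e : ℕ, N e ≤ f.eigenspace ((2 : ℂ) ^ e)) (ht : ⨆ e, N e = ⊤)
    (d : ℕ) : N d = f.eigenspace ((2 : ℂ) ^ d) := by
  refine le_antisymm (hN d) ?_
  intro x hx
  have hi := eig_indep f (d : ℤ)
  have h1 : N d ⊔ ⨆ (e : ℕ) (_ : e ≠ d), N e = ⊤ := by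
    rw [← top_le_iff, ← ht]
    apply iSup_le
    intro e
    by_cases h : e = d
    · subst h; exact le_sup_left
    · exact le_trans (le_iSup₂_of_le e h le_rfl) le_sup_right
  have hx1 : x ∈ N d ⊔ ⨆ (e : ℕ) (_ : e ≠ d), N e := by rw [h1]; trivial
  obtain ⟨y, hy, z, hz, rfl⟩ := Submodule.mem_sup.mp hx1
  have hz1 : z ∈ f.eigenspace ((2 : ℂ) ^ d) := by
    have := Submodule.sub_mem _ hx (hN d hy)
    simpa using this
  have hz2 : z ∈ ⨆ (e : ℤ) (_ : e ≠ d), f.eigenspace ((2 : ℂ) ^ e) := by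
    refine (iSup₂_le ?_ : (⨆ (e : ℕ) (_ : e ≠ d), N e) ≤ _) hz
    intro e he
    refine le_trans (hN e) ?_
    exact le_iSup₂_of_le (e : ℤ) (by exact_mod_cast he) (by simp)
  have hz3 : z ∈ (⊥ : Submodule ℂ M) := by
    rw [disjoint_iff] at hi
    rw [← hi]; exact ⟨by simpa using hz1, hz2⟩
  rw [Submodule.mem_bot] at hz3
  subst hz3
  simpa using hy

theorem eig_proj {M : Type*} [AddCommGroup M] [Module ℂ M] (f : Module.End ℂ M)
    (ht : ⨆ e : ℤ, f.eigenspace ((2 : ℂ) ^ e) = ⊤) (d : ℤ) : ∃ π : Module.End ℂ M,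
    (∀ x, f x = (2 : ℂ) ^ d • x → π x = x) ∧
    (∀ e x, e ≠ d → f x = (2 : ℂ) ^ e • x → π x = 0) ∧
    (∀ x, f (π x) = (2 : ℂ) ^ d • π x) := by
  have hc : IsCompl (f.eigenspace ((2 : ℂ) ^ d))
      (⨆ (e : ℤ) (_ : e ≠ d), f.eigenspace ((2 : ℂ) ^ e)) := by
    refine ⟨eig_indep f d, ?_⟩
    rw [codisjoint_iff, ← top_le_iff, ← ht]
    apply iSup_le
    intro e
    by_cases h : e = d
    · subst h; exact le_sup_left
    · exact le_trans (le_iSup₂_of_le (f := fun (e : ℤ) (_ : e ≠ d) => f.eigenspace ((2 : ℂ) ^ e)) e h le_rfl) le_sup_right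
  refine ⟨Submodule.subtype _ ∘ₗ Submodule.projectionOnto _ _ hc, ?_, ?_, ?_⟩
  · intro x hx
    have hx' : x ∈ f.eigenspace ((2 : ℂ) ^ d) := Module.End.mem_eigenspace_iff.mpr hx
    have := Submodule.projectionOnto_apply_left hc ⟨x, hx'⟩
    simp only at this
    rw [LinearMap.comp_apply, this]; rfl
  · intro e x he hx
    have hx' : x ∈ f.eigenspace ((2 : ℂ) ^ e) := Module.End.mem_eigenspace_iff.mpr hx
    have hx2 : x ∈ (⨆ (e : ℤ) (_ : e ≠ d), f.eigenspace ((2 : ℂ) ^ e)) :=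
      (le_iSup₂_of_le (f := fun (e : ℤ) (_ : e ≠ d) => f.eigenspace ((2 : ℂ) ^ e)) e he le_rfl) hx'
    have := (Submodule.projectionOnto_apply_eq_zero_iff hc (x := x)).mpr hx2
    rw [LinearMap.comp_apply, this]; simp
  · intro x
    exact Module.End.mem_eigenspace_iff.mp
      (Submodule.projectionOnto _ _ hc x).2

theorem adeg_le (n d : ℕ) : adeg n d ≤ 
    Module.End.eigenspace ((phi n).toLinearMap : Module.End ℂ (PiT n)) ((2 : ℂ) ^ d) := by
  unfold adeg
  rw [Submodule.span_le]
  rintro _ ⟨l, hl, rfl⟩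
  rw [SetLike.mem_coe, Module.End.mem_eigenspace_iff, ← hl]
  clear hl
  induction l with
  | nil => simp
  | cons x l ih =>
    simp only [AlgHom.toLinearMap_apply] at ih
    simp only [List.map_cons, List.prod_cons, List.sum_cons, AlgHom.toLinearMap_apply, map_mul, ih,
      phi_gen, smul_mul_smul_comm, pow_add]

theorem adeg_top (n : ℕ) : ⨆ d, adeg n d = ⊤ := by
  have hl : ∀ l : List (TGen n), (l.map gen).prod ∈ ⨆ d, adeg n d := by
    intro l
    exact (le_iSup (fun d => adeg n d) (l.map wt).sum) (Submodule.subset_span ⟨l, rfl, rfl⟩)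
  have key : ∀ a : PiT n, ∀ y ∈ ⨆ d, adeg n d, a * y ∈ ⨆ d, adeg n d := by
    intro a
    induction a using gen_induction with
    | hg x =>
      intro y hy
      refine Submodule.iSup_induction (fun d => adeg n d) (motive := fun y => gen x * y ∈ _) hy ?_ ?_ ?_
      · intro d y hy
        refine Submodule.span_induction (p := fun y _ => gen x * y ∈ ⨆ d, adeg n d) ?_ ?_ ?_ ?_ hy
        · rintro _ ⟨l, _, rfl⟩
          have := hl (x :: l)
          simpa using this
        · simp
        · intro a b _ _ ha hb; rw [mul_add]; exact add_mem ha hb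
        · intro c a _ ha; rw [mul_smul_comm]; exact Submodule.smul_mem _ _ ha
      · simp
      · intro a b ha hb; rw [mul_add]; exact add_mem ha hb
    | hs c => intro y hy; rw [← Algebra.smul_def]; exact Submodule.smul_mem _ _ hy
    | ha x y hx hy => intro z hz; rw [add_mul]; exact add_mem (hx z hz) (hy z hz)
    | hm x y hx hy => intro z hz; rw [mul_assoc]; exact hx _ (hy z hz)
  rw [eq_top_iff]
  intro a _
  rw [← mul_one a]
  apply key
  simpa using hl []

theorem tm_mem_chDeg {n m k e : ℕ} {a t} (ha : a ∈ adeg n k) (ht : t ∈ chDeg n m e) :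
    tm n m a t ∈ chDeg n (m + 1) (k + e) := by
  have : tm n m a t ∈ tensorSub (adeg n k) (chDeg n m (k + e - k)) := by
    rw [Nat.add_sub_cancel_left]
    exact ⟨⟨a, ha⟩ ⊗ₜ ⟨t, ht⟩, rfl⟩
  exact (le_iSup₂_of_le (f := fun k' (_ : k' ∈ Finset.range (k + e + 1)) =>
    tensorSub (adeg n k') (chDeg n m (k + e - k'))) k (by simp) le_rfl) this

theorem chDeg_top (n m : ℕ) : ⨆ d, chDeg n m d = ⊤ := by
  induction m with
  | zero => exact adeg_top n
  | succ m ih =>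
    rw [eq_top_iff]
    intro x _
    induction x using Ch_ind with
    | ha x y hx hy => exact add_mem (hx trivial) (hy trivial)
    | ht a t =>
      have ha : a ∈ ⨆ d, adeg n d := by rw [adeg_top]; trivial
      have ht : t ∈ ⨆ d, chDeg n m d := by rw [ih]; trivial
      refine Submodule.iSup_induction (fun d => adeg n d) (motive := fun a => tm n m a t ∈ _) ha ?_ ?_ ?_
      · intro k a ha
        refine Submodule.iSup_induction (fun d => chDeg n m d) (motive := fun t => tm n m a t ∈ _) ht ?_ ?_ ?_
        · intro e t ht
          exact (le_iSup (fun d => chDeg n (m + 1) d) (k + e)) (tm_mem_chDeg ha ht)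
        · rw [map_zero]; exact zero_mem _
        · intro x y hx hy; rw [map_add]; exact add_mem hx hy
      · rw [map_zero]; exact zero_mem _
      · intro x y hx hy; rw [map_add]; exact add_mem hx hy

theorem chDeg_le (n m d : ℕ) : chDeg n m d ≤ (phc n m).eigenspace ((2 : ℂ) ^ d) := by
  induction m generalizing d with
  | zero => exact adeg_le n d
  | succ m ih =>
    refine (iSup₂_le ?_ : (⨆ k ∈ Finset.range (d+1), tensorSub (adeg n k) (chDeg n m (d - k))) ≤ _)
    intro k hk
    simp at hk
    rintro _ ⟨x, rfl⟩
    induction x using TensorProduct.induction_on with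
    | zero => rw [map_zero]; exact zero_mem _
    | add x y hx hy => rw [map_add]; exact add_mem hx hy
    | tmul a t =>
      have e : (TensorProduct.map (adeg n k).subtype (chDeg n m (d - k)).subtype) (a ⊗ₜ t)
        = tm n m a t := rfl
      have h1 := Module.End.mem_eigenspace_iff.mp (adeg_le n k a.2)
      have h2 := Module.End.mem_eigenspace_iff.mp (ih (d - k) t.2)
      rw [AlgHom.toLinearMap_apply] at h1
      have h3 : phc n (m + 1) (tm n m a t) = (2 : ℂ) ^ d • tm n m a t := by
        rw [phc_tm, h1, h2, map_smul, map_smul, LinearMap.smul_apply, smul_smul, ← pow_add]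
        congr 2; omega
      have h4 : tm n m a t ∈ (phc n (m + 1)).eigenspace ((2 : ℂ) ^ d) :=
        Module.End.mem_eigenspace_iff.mpr h3
      exact h4

theorem chDeg_eq (n m d : ℕ) : chDeg n m d = (phc n m).eigenspace ((2 : ℂ) ^ d) :=
  eig_eq _ (chDeg n m) (chDeg_le n m) (chDeg_top n m) d

theorem mem_chDeg {n m d : ℕ} {x} : x ∈ chDeg n m d ↔ phc n m x = (2 : ℂ) ^ (d : ℤ) • x := by
  rw [chDeg_eq, Module.End.mem_eigenspace_iff, zpow_natCast]

theorem eig_top (n m : ℕ) : ⨆ e : ℤ, (phc n m).eigenspace ((2 : ℂ) ^ e) = ⊤ := by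
  rw [eq_top_iff, ← chDeg_top n m]
  apply iSup_le
  intro d
  refine le_trans (chDeg_le n m d) ?_
  exact le_iSup_of_le (f := fun e : ℤ => (phc n m).eigenspace ((2 : ℂ) ^ e)) (d : ℤ) (by simp)

noncomputable def pj (n m : ℕ) (d : ℤ) : Module.End ℂ (Ch n m) :=
  Classical.choose (eig_proj (phc n m) (eig_top n m) d)

theorem pj_self {n m : ℕ} {d : ℤ} {x} (h : phc n m x = (2 : ℂ) ^ d • x) : pj n m d x = x :=
  (Classical.choose_spec (eig_proj (phc n m) (eig_top n m) d)).1 x h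
theorem pj_ne {n m : ℕ} {d e : ℤ} {x} (he : e ≠ d) (h : phc n m x = (2 : ℂ) ^ e • x) :
    pj n m d x = 0 :=
  (Classical.choose_spec (eig_proj (phc n m) (eig_top n m) d)).2.1 e x he h
theorem phc_pj {n m : ℕ} (d : ℤ) (x) : phc n m (pj n m d x) = (2 : ℂ) ^ d • pj n m d x :=
  (Classical.choose_spec (eig_proj (phc n m) (eig_top n m) d)).2.2 x

theorem pj_comm {n m m' : ℕ} (Φ : Ch n m →ₗ[ℂ] Ch n m') (s : ℤ)
    (h : ∀ x, phc n m' (Φ x) = (2 : ℂ) ^ s • Φ (phc n m x)) (d : ℤ) (x) :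
    pj n m' (d + s) (Φ x) = Φ (pj n m d x) := by
  have hx : x ∈ ⨆ e : ℤ, (phc n m).eigenspace ((2 : ℂ) ^ e) := by rw [eig_top]; trivial
  refine Submodule.iSup_induction (fun e : ℤ => (phc n m).eigenspace ((2 : ℂ) ^ e))
    (motive := fun x => pj n m' (d + s) (Φ x) = Φ (pj n m d x)) hx ?_ ?_ ?_
  · intro e x hx
    rw [Module.End.mem_eigenspace_iff] at hx
    have hx' : phc n m' (Φ x) = (2 : ℂ) ^ (e + s) • Φ x := by
      rw [h, hx, map_smul, smul_smul, zpow_add₀ (by simp), mul_comm]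
    by_cases he : e = d
    · subst he; rw [pj_self hx, pj_self hx']
    · rw [pj_ne he hx, pj_ne (e := e + s) (by omega) hx', map_zero]
  · simp
  · intro x y hx hy; simp only [map_add, hx, hy]

end TPre

namespace TPre

/-! ### Part 3: the double complex -/

abbrev CF (n q : ℕ) := ℤ → Ch n q

noncomputable def D1 (n q : ℕ) (ε : ℂ) : CF n q →ₗ[ℂ] CF n q :=
  LinearMap.pi fun j =>
    (Lst n q (xi n j) ∘ₗ LinearMap.proj j - Fst n q (xi n (j - 1)) ∘ₗ LinearMap.proj (j - 1)) +
    ε • (Lst n q (xi n (2 * n + 1 - j)) ∘ₗ LinearMap.proj (2 * n + 1 - j)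
      - Fst n q (xi n (2 * n - j)) ∘ₗ LinearMap.proj (2 * n - j))

noncomputable def D2 (n q : ℕ) : CF n q →ₗ[ℂ] CF n q :=
  LinearMap.pi fun j =>
    (Lst n q (xi n (2 * n - j)) ∘ₗ LinearMap.proj j
      - Fst n q (xi n (2 * n - j)) ∘ₗ LinearMap.proj (j + 1))

noncomputable def box (n : ℕ) : Finset (ℤ × ℤ) := Finset.Icc 1 (2 * (n : ℤ)) ×ˢ Finset.Icc 0 (2 * (n : ℤ))

theorem mem_box {n : ℕ} {x : ℤ × ℤ} : x ∈ box n ↔ (1 ≤ x.1 ∧ x.1 ≤ 2 * n) ∧ (0 ≤ x.2 ∧ x.2 ≤ 2 * n) := by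
  simp [box, Finset.mem_product]

noncomputable def D3 (n q : ℕ) : CF n q →ₗ[ℂ] CF n q :=
  LinearMap.pi fun m => ∑ x ∈ box n,
    Fst n q (mm n x.1 x.2 (x.1 + x.2 - m)) ∘ₗ
      Lst n q (mm n m (2 * n - x.1 - x.2) (m - 1 - x.2)) ∘ₗ LinearMap.proj x.1

noncomputable def aug (n m : ℕ) : CF n (m + 1) →ₗ[ℂ] Ch n m :=
  ∑ k ∈ Finset.Icc (1 : ℤ) n, cc n m ∘ₗ LinearMap.proj k

noncomputable def bpF (n q : ℕ) : CF n (q + 1) →ₗ[ℂ] CF n q :=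
  LinearMap.pi fun j => bp n q ∘ₗ LinearMap.proj j

theorem D1_apply {n q : ℕ} (ε : ℂ) (f : CF n q) (j : ℤ) : D1 n q ε f j =
    (Lst n q (xi n j) (f j) - Fst n q (xi n (j - 1)) (f (j - 1))) +
    ε • (Lst n q (xi n (2 * n + 1 - j)) (f (2 * n + 1 - j))
      - Fst n q (xi n (2 * n - j)) (f (2 * n - j))) := rfl
theorem D2_apply {n q : ℕ} (f : CF n q) (j : ℤ) : D2 n q f j =
    Lst n q (xi n (2 * n - j)) (f j) - Fst n q (xi n (2 * n - j)) (f (j + 1)) := rfl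
theorem D3_apply {n q : ℕ} (f : CF n q) (m : ℤ) : D3 n q f m =
    ∑ x ∈ box n, Fst n q (mm n x.1 x.2 (x.1 + x.2 - m))
      (Lst n q (mm n m (2 * n - x.1 - x.2) (m - 1 - x.2)) (f x.1)) := by
  simp [D3, LinearMap.sum_apply]
theorem aug_apply {n m : ℕ} (f : CF n (m + 1)) :
    aug n m f = ∑ k ∈ Finset.Icc (1 : ℤ) n, cc n m (f k) := by
  simp [aug, LinearMap.sum_apply]
theorem bpF_apply {n q : ℕ} (f : CF n (q + 1)) (j : ℤ) : bpF n q f j = bp n q (f j) := rfl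

def XV (n q : ℕ) (ε : ℂ) : Submodule ℂ (CF n q) where
  carrier := {f | ∀ j, Fst n q (E n j) (f j) = f j ∧ Lst n q (E n j) (f j) = f j ∧
    f (2 * n + 1 - j) = ε • f j}
  add_mem' := by
    intro f g hf hg j
    simp [(hf j).1, (hf j).2.1, (hf j).2.2, (hg j).1, (hg j).2.1, (hg j).2.2]
  zero_mem' := by intro j; simp
  smul_mem' := by
    intro c f hf j
    simp [(hf j).1, (hf j).2.1, (hf j).2.2, smul_comm c ε]

def XE (n q : ℕ) : Submodule ℂ (CF n q) where
  carrier := {f | ∀ j, Fst n q (E n j) (f j) = f j ∧ Lst n q (E n (j + 1)) (f j) = f j}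
  add_mem' := by
    intro f g hf hg j
    simp [(hf j).1, (hf j).2, (hg j).1, (hg j).2]
  zero_mem' := by intro j; simp
  smul_mem' := by
    intro c f hf j
    simp [(hf j).1, (hf j).2]

def XG (n q : ℕ) (δ : ℤ) : Submodule ℂ (CF n q) where
  carrier := {f | ∀ j, phc n q (f j) = (2 : ℂ) ^ δ • f j}
  add_mem' := by
    intro f g hf hg j
    simp [hf j, hg j]
  zero_mem' := by intro j; simp
  smul_mem' := by
    intro c f hf j
    simp [hf j, smul_comm c]

theorem sum_shift {α M : Type*} [AddCommGroup M] (s : Finset α) (e : α ≃ α) (G : α → M)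
    (h : ∀ x, x ∉ s → G x = 0) (h' : ∀ x, x ∉ s → G (e x) = 0) :
    ∑ x ∈ s, G (e x) = ∑ x ∈ s, G x := by
  rw [← finsum_eq_sum_of_support_subset G (s := s), ← finsum_eq_sum_of_support_subset _ (s := s)]
  · exact finsum_comp_equiv e
  · intro x hx
    by_contra hc
    exact hx (h' x hc)
  · intro x hx
    by_contra hc
    exact hx (h x hc)

theorem D1_D2 {n q : ℕ} {ε : ℂ} (hε : ε * ε = 1) {f : CF n q} (hf : f ∈ XV n q (-ε)) :
    D1 n q ε (D2 n q f) = 0 := by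
  funext j
  have e1 := (hf j).2.2
  have e2 := (hf (j - 1)).2.2
  have e3 := (hf (j + 1)).2.2
  rw [D1_apply]
  simp only [D2_apply]
  rw [show (2 * (n : ℤ) + 1 - (j - 1)) = 2 * n + 1 - j + 1 by ring] at e2
  rw [show (2 * (n : ℤ) + 1 - (j + 1)) = 2 * n - j by ring] at e3
  rw [show (2 * (n : ℤ) - j + 1) = 2 * n + 1 - j by ring,
    show 2 * (n : ℤ) - (2 * n + 1 - j) = j - 1 by ring,
    show 2 * (n : ℤ) - (2 * n - j) = j by ring,
    show j - 1 + 1 = j by ring, show 2 * (n : ℤ) - (j - 1) = 2 * n + 1 - j by ring, e1, e2, e3]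
  simp only [map_sub, map_smul, smul_sub, smul_smul, mul_neg, hε, ← Lst_mul, ← Fst_mul, ← Fst_Lst]
  have := xi_comm n j
  rw [this]
  simp only [Pi.zero_apply, neg_smul, one_smul]
  abel

theorem Fst_zero' {n q : ℕ} (x) : Fst n q 0 x = 0 := by simp
theorem Lst_zero' {n q : ℕ} (x) : Lst n q 0 x = 0 := by simp

theorem FL_bad {n q : ℕ} {k p r k' p' r' : ℤ} (x : Ch n q)
    (h : ¬ ((1 ≤ k ∧ k ≤ 2 * n ∧ 0 ≤ r ∧ r < k ∧ 0 ≤ p ∧ p ≤ 2 * n - k) ∧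
      (1 ≤ k' ∧ k' ≤ 2 * n ∧ 0 ≤ r' ∧ r' < k' ∧ 0 ≤ p' ∧ p' ≤ 2 * n - k'))) :
    Fst n q (mm n k p r) (Lst n q (mm n k' p' r') x) = 0 := by
  by_cases h1 : (1 ≤ k ∧ k ≤ 2 * n ∧ 0 ≤ r ∧ r < k ∧ 0 ≤ p ∧ p ≤ 2 * n - k)
  · rw [mm_bad (n := n) (k := k') (p := p') (q := r') (by tauto)]; simp
  · rw [mm_bad (n := n) (k := k) (p := p) (q := r) h1]; simp

theorem D2_D3 {n q : ℕ} (f : CF n q) : D2 n q (D3 n q f) = 0 := by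
  funext m
  rw [D2_apply, D3_apply, D3_apply, map_sum, map_sum, ← Finset.sum_sub_distrib, Pi.zero_apply]
  apply Finset.sum_eq_zero
  rintro ⟨k, p⟩ hx
  rw [mem_box] at hx
  simp only at hx ⊢
  have h1 : Lst n q (xi n (2 * n - m)) (Fst n q (mm n k p (k + p - m))
      (Lst n q (mm n m (2 * n - k - p) (m - 1 - p)) (f k))) =
      Fst n q (mm n k p (k + p - m)) (Lst n q (mm n (m + 1) (2 * n - k - p) (m - p)) (f k)) := by
    rw [← Fst_Lst, ← Lst_mul]
    by_cases h : 0 ≤ m - 1 - p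
    · rw [mm_eta (n := n) h, show m - 1 - p + 1 = m - p by ring]
    · rw [mm_bad (n := n) (k := m) (by omega), zero_mul, Lst_zero', map_zero, FL_bad]
      omega
  have h2 : Fst n q (xi n (2 * n - m)) (Fst n q (mm n k p (k + p - (m + 1)))
      (Lst n q (mm n (m + 1) (2 * n - k - p) (m + 1 - 1 - p)) (f k))) =
      Fst n q (mm n k p (k + p - m)) (Lst n q (mm n (m + 1) (2 * n - k - p) (m - p)) (f k)) := by
    rw [← Fst_mul, show m + 1 - 1 - p = m - p by ring]
    by_cases h : 0 ≤ k + p - (m + 1)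
    · have := eta_mm (n := n) (k := k) (p := p) h
      rw [show 2 * (n : ℤ) + 1 - (k + p - (k + p - (m + 1))) = 2 * n - m by ring,
        show k + p - (m + 1) + 1 = k + p - m by ring] at this
      rw [this]
    · rw [mm_bad (n := n) (k := k) (by omega), mul_zero, Fst_zero', FL_bad]
      omega
  rw [h1, h2, sub_self]

def eq1 : ℤ × ℤ ≃ ℤ × ℤ where
  toFun x := (x.1 - 1, x.2 + 1)
  invFun x := (x.1 + 1, x.2 - 1)
  left_inv x := by simp
  right_inv x := by simp
def eq2 : ℤ × ℤ ≃ ℤ × ℤ where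
  toFun x := (x.1 + 1, x.2)
  invFun x := (x.1 - 1, x.2)
  left_inv x := by simp
  right_inv x := by simp
def eq3 (a m : ℤ) : ℤ × ℤ ≃ ℤ × ℤ where
  toFun x := (a - x.1, x.1 + x.2 - m)
  invFun x := (a - x.1, x.2 - (a - x.1) + m)
  left_inv x := by ext <;> simp <;> ring
  right_inv x := by ext <;> simp <;> ring

theorem D3_D1 {n q : ℕ} (ε : ℂ) (f : CF n q) : D3 n q (D1 n q ε f) = 0 := by
  funext m
  rw [D3_apply]
  set T1 : ℤ × ℤ → Ch n q := fun x => Fst n q (mm n x.1 x.2 (x.1 + x.2 - m))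
        (Lst n q (mm n m (2 * n - x.1 - x.2) (m - x.2)) (f x.1)) with hT1
  set T3 : ℤ × ℤ → Ch n q := fun x => Fst n q (mm n x.1 x.2 (x.1 + x.2 - m))
        (Lst n q (mm n m (2 * n + 1 - x.1 - x.2) (m - 1 - x.2)) (f (2 * n + 1 - x.1))) with hT3
  have key : ∀ x ∈ box n, Fst n q (mm n x.1 x.2 (x.1 + x.2 - m))
      (Lst n q (mm n m (2 * n - x.1 - x.2) (m - 1 - x.2)) (D1 n q ε f x.1)) =
      T1 x - T1 (eq1 x) + ε • (T3 x - T3 (eq2 x)) := by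
    rintro ⟨k, p⟩ hx
    rw [mem_box] at hx
    simp only [hT1, hT3, eq1, eq2, Equiv.coe_fn_mk] at hx ⊢
    rw [D1_apply]
    simp only [map_add, map_sub, map_smul]
    congr 1
    · congr 1
      · rw [← Lst_mul]
        by_cases h : 0 ≤ m - 1 - p
        · have := eta_mm (n := n) (k := m) (p := 2 * n - k - p) (q := m - 1 - p) h
          rw [show 2 * (n : ℤ) + 1 - (m + (2 * n - k - p) - (m - 1 - p)) = k by ring,
            show m - 1 - p + 1 = m - p by ring] at this
          rw [this]
        · rw [mm_bad (n := n) (k := m) (by omega), mul_zero, Lst_zero', map_zero, FL_bad]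
          omega
      · rw [← Fst_Lst, ← Fst_mul, mm_xi (n := n) hx.2.1]
        rw [show k - 1 + (p + 1) - m = k + p - m by ring,
          show 2 * (n : ℤ) - (k - 1) - (p + 1) = 2 * n - k - p by ring,
          show m - (p + 1) = m - 1 - p by ring]
    · congr 1
      congr 1
      · rw [← Lst_mul]
        by_cases h : 0 ≤ 2 * n - k - p
        · have := xi_mm (n := n) (k := m) (p := 2 * n - k - p) (q := m - 1 - p) h
          rw [show (m + (2 * n - k - p) - (m - 1 - p)) = 2 * (n : ℤ) + 1 - k by ring,
            show 2 * (n : ℤ) - k - p + 1 = 2 * n + 1 - k - p by ring] at this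
          rw [this]
        · rw [mm_bad (n := n) (k := m) (by omega), mul_zero, Lst_zero', map_zero, FL_bad]
          omega
      · rw [← Fst_Lst, ← Fst_mul]
        by_cases h : 0 ≤ k + p - m
        · rw [mm_eta (n := n) h]
          rw [show k + 1 + p - m = k + p - m + 1 by ring,
          show 2 * (n : ℤ) + 1 - (k + 1) - p = 2 * n - k - p by ring,
          show 2 * (n : ℤ) + 1 - (k + 1) = 2 * n - k by ring]
        · rw [mm_bad (n := n) (k := k) (by omega), zero_mul, Fst_zero', FL_bad]
          omega
  rw [Finset.sum_congr rfl key, Finset.sum_add_distrib, ← Finset.smul_sum, Finset.sum_sub_distrib,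
    Finset.sum_sub_distrib, sum_shift (box n) eq1 T1, sum_shift (box n) eq2 T3, sub_self, sub_self,
    smul_zero, add_zero]
  · rfl
  all_goals
    rintro ⟨k, p⟩ hx
    rw [mem_box] at hx
    simp only [hT1, hT3, eq1, eq2, Equiv.coe_fn_mk] at hx ⊢
    rw [FL_bad]
    omega

theorem D3_XV {n q : ℕ} {ε : ℂ} (hε : ε * ε = 1) {f : CF n q} (hf : f ∈ XV n q ε) : D3 n q f ∈ XV n q ε := by
  intro m
  refine ⟨?_, ?_, ?_⟩
  · rw [D3_apply, map_sum]
    apply Finset.sum_congr rfl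
    rintro ⟨k, p⟩ hx
    simp only
    rw [← Fst_mul, E_mm, if_pos (by left; ring)]
  · rw [D3_apply, map_sum]
    apply Finset.sum_congr rfl
    rintro ⟨k, p⟩ hx
    simp only
    rw [← Fst_Lst, ← Lst_mul, mm_E, if_pos (by left; ring)]
  · rw [D3_apply, D3_apply, Finset.smul_sum, ← sum_shift (box n) (eq3 (2 * n + 1) (2 * n + 1 - m))
      (fun x : ℤ × ℤ => ε • Fst n q (mm n x.1 x.2 (x.1 + x.2 - m))
        (Lst n q (mm n m (2 * n - x.1 - x.2) (m - 1 - x.2)) (f x.1)))]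
    · apply Finset.sum_congr rfl
      rintro ⟨k, p⟩ hx
      simp only [eq3, Equiv.coe_fn_mk]
      rw [(hf k).2.2, map_smul, map_smul, smul_smul, hε, one_smul, ← mm_sigma (n := n) k,
        ← mm_sigma (n := n) (2 * n + 1 - m)]
      rw [show (2 * (n : ℤ) + 1 - k + (k + p - (2 * n + 1 - m)) - m) = p by ring,
        show 2 * (n : ℤ) + 1 - (2 * n + 1 - m) = m by ring,
        show 2 * (n : ℤ) - (2 * n + 1 - k) - (k + p - (2 * n + 1 - m)) = 2 * n + 1 - m - 1 - p by ring,
        show m - 1 - (k + p - (2 * (n : ℤ) + 1 - m)) = 2 * n - k - p by ring]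
    all_goals
      rintro ⟨k, p⟩ hx
      rw [mem_box] at hx
      simp only [eq3, Equiv.coe_fn_mk] at hx ⊢
      rw [FL_bad, smul_zero]
      omega

theorem Fst_E_xi {n q : ℕ} (j : ℤ) (x) : Fst n q (E n (j + 1)) (Fst n q (xi n j) x) = Fst n q (xi n j) x := by
  rw [← Fst_mul, E_xi]
theorem Lst_E_xi {n q : ℕ} (j : ℤ) (x) : Lst n q (E n j) (Lst n q (xi n j) x) = Lst n q (xi n j) x := by
  rw [← Lst_mul, xi_E]

theorem D1_XV {n q : ℕ} {ε : ℂ} (hε : ε * ε = 1) {f : CF n q} (hf : f ∈ XE n q) :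
    D1 n q ε f ∈ XV n q ε := by
  intro j
  have a1 := hf j
  have a2 := hf (j - 1)
  have a3 := hf (2 * n + 1 - j)
  have a4 := hf (2 * n - j)
  have e1 := Fst_E_xi (n := n) (q := q) (j - 1)
  have e2 := Fst_E_xi (n := n) (q := q) (2 * n - j)
  have e3 := Lst_E_xi (n := n) (q := q) j
  have e4 := Lst_E_xi (n := n) (q := q) (2 * n + 1 - j)
  have h1 : E n (2 * n - j + 1) = E n j := by
    rw [← E_sigma n j]; congr 1; ring
  rw [show j - 1 + 1 = j by ring] at a2 e1
  rw [h1] at a4 e2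
  rw [E_sigma] at a3 e4
  refine ⟨?_, ?_, ?_⟩
  · rw [D1_apply]
    simp only [map_add, map_sub, map_smul, e1, e2, Fst_Lst, a1.1, a3.1]
  · rw [D1_apply]
    simp only [map_add, map_sub, map_smul, e3, e4, ← Fst_Lst, a2.2, a4.2]
  · rw [D1_apply, D1_apply]
    rw [show 2 * (n : ℤ) + 1 - (2 * n + 1 - j) = j by ring,
      show 2 * (n : ℤ) - (2 * n + 1 - j) = j - 1 by ring,
      show 2 * (n : ℤ) + 1 - j - 1 = 2 * n - j by ring, smul_add, smul_smul, hε, one_smul, add_comm]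

theorem D2_XE {n q : ℕ} {ε : ℂ} {f : CF n q} (hf : f ∈ XV n q ε) : D2 n q f ∈ XE n q := by
  intro j
  have a1 := hf j
  have a2 := hf (j + 1)
  have e1 := Fst_E_xi (n := n) (q := q) (2 * n - j)
  have e2 := Lst_E_xi (n := n) (q := q) (2 * n - j)
  have h1 : E n (2 * n - j + 1) = E n j := by
    rw [← E_sigma n j]; congr 1; ring
  have h2 : E n (2 * n - j) = E n (j + 1) := by
    rw [← E_sigma n (j + 1)]; congr 1; ring
  rw [h1] at e1
  rw [h2] at e2
  constructor
  · rw [D2_apply]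
    simp only [map_sub, Fst_Lst, e1, a1.1]
  · rw [D2_apply]
    simp only [map_sub, ← Fst_Lst, e2, a2.2.1]

theorem D1_XG {n q : ℕ} {ε : ℂ} {δ : ℤ} {f : CF n q} (hf : f ∈ XG n q δ) :
    D1 n q ε f ∈ XG n q (δ + 1) := by
  intro j
  rw [D1_apply]
  simp only [map_add, map_sub, map_smul, phc_Fst, phc_Lst, phi_xi, hf _, smul_add, smul_sub, smul_smul,
    LinearMap.smul_apply, zpow_add₀ (two_ne_zero (α := ℂ)), zpow_one]
  simp only [mul_comm, mul_left_comm]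

theorem D2_XG {n q : ℕ} {δ : ℤ} {f : CF n q} (hf : f ∈ XG n q δ) : D2 n q f ∈ XG n q (δ + 1) := by
  intro j
  rw [D2_apply]
  simp only [map_add, map_sub, map_smul, phc_Fst, phc_Lst, phi_xi, hf _, smul_add, smul_sub, smul_smul,
    LinearMap.smul_apply, zpow_add₀ (two_ne_zero (α := ℂ)), zpow_one]

theorem D3_XG {n q : ℕ} {δ : ℤ} {f : CF n q} (hf : f ∈ XG n q δ) :
    D3 n q f ∈ XG n q (δ + (2 * n - 1)) := by
  intro m
  rw [D3_apply, map_sum, Finset.smul_sum]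
  apply Finset.sum_congr rfl
  rintro ⟨k, p⟩ hx
  simp only [map_smul, phc_Fst, phc_Lst, phi_mm, hf _, smul_smul, LinearMap.smul_apply]
  rw [← zpow_add₀ (two_ne_zero (α := ℂ)), ← zpow_add₀ (two_ne_zero (α := ℂ))]
  congr 2
  ring

/-- pointwise projection -/
noncomputable def pjF (n q : ℕ) (δ : ℤ) (f : CF n q) : CF n q := fun j => pj n q δ (f j)

theorem pjF_XG {n q : ℕ} (δ : ℤ) (f : CF n q) : pjF n q δ f ∈ XG n q δ := fun j => phc_pj δ (f j)
theorem pjF_self {n q : ℕ} {δ : ℤ} {f : CF n q} (h : f ∈ XG n q δ) : pjF n q δ f = f :=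
  funext fun j => pj_self (h j)

theorem pj_Fst {n q : ℕ} (d s : ℤ) (a : PiT n) (h : phi n a = (2 : ℂ) ^ s • a) (x) :
    pj n q (d + s) (Fst n q a x) = Fst n q a (pj n q d x) := by
  apply pj_comm
  intro x
  rw [phc_Fst, h, map_smul, LinearMap.smul_apply]
theorem pj_Lst {n q : ℕ} (d s : ℤ) (a : PiT n) (h : phi n a = (2 : ℂ) ^ s • a) (x) :
    pj n q (d + s) (Lst n q a x) = Lst n q a (pj n q d x) := by
  apply pj_comm
  intro x
  rw [phc_Lst, h, map_smul, LinearMap.smul_apply]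

theorem phi_xi' (n : ℕ) (j : ℤ) : phi n (xi n j) = (2 : ℂ) ^ (1 : ℤ) • xi n j := by
  rw [phi_xi, zpow_one]
theorem phi_E' (n : ℕ) (j : ℤ) : phi n (E n j) = (2 : ℂ) ^ (0 : ℤ) • E n j := by
  rw [phi_E, zpow_zero, one_smul]

theorem pjF_D1 {n q : ℕ} (ε : ℂ) (δ : ℤ) (f : CF n q) :
    pjF n q (δ + 1) (D1 n q ε f) = D1 n q ε (pjF n q δ f) := by
  funext j
  simp only [pjF, D1_apply, map_add, map_sub, map_smul, pj_Fst δ 1 _ (phi_xi' n _),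
    pj_Lst δ 1 _ (phi_xi' n _)]

theorem pjF_D2 {n q : ℕ} (δ : ℤ) (f : CF n q) :
    pjF n q (δ + 1) (D2 n q f) = D2 n q (pjF n q δ f) := by
  funext j
  simp only [pjF, D2_apply, map_add, map_sub, map_smul, pj_Fst δ 1 _ (phi_xi' n _),
    pj_Lst δ 1 _ (phi_xi' n _)]

theorem pjF_D3 {n q : ℕ} (δ : ℤ) (f : CF n q) :
    pjF n q (δ + (2 * n - 1)) (D3 n q f) = D3 n q (pjF n q δ f) := by
  funext m
  simp only [pjF]
  rw [D3_apply, D3_apply, map_sum]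
  apply Finset.sum_congr rfl
  rintro ⟨k, p⟩ hx
  simp only [pjF]
  rw [← pj_Lst δ _ _ (phi_mm (n := n) _ _ _), ← pj_Fst _ _ _ (phi_mm (n := n) _ _ _)]
  congr 2
  ring

theorem pjF_XV {n q : ℕ} {ε : ℂ} (δ : ℤ) {f : CF n q} (h : f ∈ XV n q ε) : pjF n q δ f ∈ XV n q ε := by
  intro j
  have h1 := pj_Fst (q := q) δ 0 _ (phi_E' n j) (f j)
  have h2 := pj_Lst (q := q) δ 0 _ (phi_E' n j) (f j)
  rw [add_zero] at h1 h2
  simp only [pjF]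
  refine ⟨?_, ?_, ?_⟩
  · rw [← h1, (h j).1]
  · rw [← h2, (h j).2.1]
  · rw [(h j).2.2, map_smul]

theorem pjF_XE {n q : ℕ} (δ : ℤ) {f : CF n q} (h : f ∈ XE n q) : pjF n q δ f ∈ XE n q := by
  intro j
  have h1 := pj_Fst (q := q) δ 0 _ (phi_E' n j) (f j)
  have h2 := pj_Lst (q := q) δ 0 _ (phi_E' n (j + 1)) (f j)
  rw [add_zero] at h1 h2
  simp only [pjF]
  refine ⟨?_, ?_⟩
  · rw [← h1, (h j).1]
  · rw [← h2, (h j).2]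

theorem bpF_XV {n q : ℕ} {ε : ℂ} {f : CF n (q + 1)} (h : f ∈ XV n (q + 1) ε) : bpF n q f ∈ XV n q ε := by
  intro j
  simp only [bpF_apply]
  rw [← bp_Fst, ← bp_Lst, (h j).1, (h j).2.1, (h j).2.2, map_smul]
  simp
theorem bpF_XE {n q : ℕ} {f : CF n (q + 1)} (h : f ∈ XE n (q + 1)) : bpF n q f ∈ XE n q := by
  intro j
  simp only [bpF_apply]
  rw [← bp_Fst, ← bp_Lst, (h j).1, (h j).2]
  simp
theorem bpF_XG {n q : ℕ} {δ : ℤ} {f : CF n (q + 1)} (h : f ∈ XG n (q + 1) δ) : bpF n q f ∈ XG n q δ := by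
  intro j
  simp only [bpF_apply]
  rw [phc_bp, h j, map_smul]
theorem bpF_D1 {n q : ℕ} (ε : ℂ) (f : CF n (q + 1)) : bpF n q (D1 n (q + 1) ε f) = D1 n q ε (bpF n q f) := by
  funext j
  simp only [bpF_apply, D1_apply, map_add, map_sub, map_smul, bp_Fst, bp_Lst]
theorem bpF_D2 {n q : ℕ} (f : CF n (q + 1)) : bpF n q (D2 n (q + 1) f) = D2 n q (bpF n q f) := by
  funext j
  simp only [bpF_apply, D2_apply, map_sub, bp_Fst, bp_Lst]
theorem bpF_D3 {n q : ℕ} (f : CF n (q + 1)) : bpF n q (D3 n (q + 1) f) = D3 n q (bpF n q f) := by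
  funext j
  simp only [bpF_apply, D3_apply, map_sum, bp_Fst, bp_Lst]
theorem bpF_bpF {n q : ℕ} (f : CF n (q + 2)) : bpF n q (bpF n (q + 1) f) = 0 := by
  funext j
  simp only [bpF_apply, bp_bp, Pi.zero_apply]
theorem bmap_aug {n m : ℕ} (f : CF n (m + 2)) :
    bmap n m (aug n (m + 1) f) = aug n m (bpF n (m + 1) f) := by
  rw [aug_apply, aug_apply, map_sum]
  simp only [bmap_cc, bpF_apply]

theorem tele {M : Type*} [AddCommGroup M] (u : ℤ → M) (n N : ℕ) :
    ∑ k ∈ Finset.Icc (1 : ℤ) N, (u k - u (k - 1) + (u (2 * n + 1 - k) - u (2 * n - k)))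
      = u N - u 0 + (u (2 * n) - u (2 * n - N)) := by
  induction N with
  | zero => simp
  | succ N ih =>
    have : Finset.Icc (1 : ℤ) ((N + 1 : ℕ) : ℤ) = insert ((N : ℤ) + 1) (Finset.Icc (1 : ℤ) N) := by
      ext x; simp; omega
    rw [this, Finset.sum_insert (by simp), ih]
    rw [show (N : ℤ) + 1 - 1 = N by ring, show 2 * (n : ℤ) + 1 - (N + 1) = 2 * n - N by ring]
    push_cast
    abel

theorem aug_D1 {n m : ℕ} (f : CF n (m + 1)) : aug n m (D1 n (m + 1) 1 f) = 0 := by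
  rw [aug_apply]
  have : ∀ k ∈ Finset.Icc (1 : ℤ) n, cc n m (D1 n (m + 1) 1 f k) =
      (fun j => cc n m (Lst n (m + 1) (xi n j) (f j))) k -
      (fun j => cc n m (Lst n (m + 1) (xi n j) (f j))) (k - 1) +
      ((fun j => cc n m (Lst n (m + 1) (xi n j) (f j))) (2 * n + 1 - k) -
      (fun j => cc n m (Lst n (m + 1) (xi n j) (f j))) (2 * n - k)) := by
    intro k _
    rw [D1_apply]
    simp only [map_add, map_sub, one_smul, cc_Fst]
  rw [Finset.sum_congr rfl this, tele]
  rw [show 2 * (n : ℤ) - n = n by ring, xi_zero (n := n) (j := 0) (by omega), xi_zero (n := n) (j := 2 * n) (by omega)]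
  simp

theorem phc_aug {n m : ℕ} (f : CF n (m + 1)) {δ : ℤ} (hf : f ∈ XG n (m + 1) δ) :
    phc n m (aug n m f) = (2 : ℂ) ^ δ • aug n m f := by
  rw [aug_apply, map_sum, Finset.smul_sum]
  apply Finset.sum_congr rfl
  intro k _
  rw [phc_cc, hf k, map_smul]

theorem pj_aug {n m : ℕ} (f : CF n (m + 1)) (δ : ℤ) :
    pj n m δ (aug n m f) = aug n m (pjF n (m + 1) δ f) := by
  rw [aug_apply, aug_apply, map_sum]
  apply Finset.sum_congr rfl
  intro k _
  have := pj_comm (cc n m) 0 (by intro x; rw [phc_cc, zpow_zero, one_smul]) δ (f k)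
  rw [add_zero] at this
  exact this

end TPre

namespace TPre

/-! ### coordinates on `A ⊗ T` -/

theorem co_mm' {n : ℕ} {k p q k' p' q' : ℤ} (h : Sval n k p q) (h' : k' ≤ n) :
    co n k p q (mm n k' p' q') = if k = k' ∧ p = p' ∧ q = q' then 1 else 0 := by
  by_cases hs : Sval n k' p' q'
  · exact co_mm h hs
  · have h1 : 1 ≤ k ∧ k ≤ n ∧ 0 ≤ q ∧ q < k ∧ 0 ≤ p ∧ p ≤ 2 * n - k := h
    have h2 : ¬ (1 ≤ k' ∧ k' ≤ n ∧ 0 ≤ q' ∧ q' < k' ∧ 0 ≤ p' ∧ p' ≤ 2 * n - k') := hs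
    rw [mm_bad (by omega), map_zero, if_neg]
    omega

theorem A_lin_ext {n : ℕ} {M : Type*} [AddCommGroup M] [Module ℂ M] {f g : PiT n →ₗ[ℂ] M}
    (h : ∀ k p q, Sval n k p q → f (mm n k p q) = g (mm n k p q)) (a : PiT n) : f a = g a := by
  rw [← sum_co a, map_sum, map_sum]
  apply Finset.sum_congr rfl
  intro s _
  rw [map_smul, map_smul, h _ _ _ s.2]

theorem co_xi {n : ℕ} {k p q : ℤ} (h : Sval n k p q) (j : ℤ) (a : PiT n) :
    co n k p q (xi n j * a) = (if k + p - q = j + 1 then co n k (p - 1) q a else 0) +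
      (if k + p - q = 2 * n - j then co n k p (q - 1) a else 0) := by
  have h1 : 1 ≤ k ∧ k ≤ n ∧ 0 ≤ q ∧ q < k ∧ 0 ≤ p ∧ p ≤ 2 * n - k := h
  have := A_lin_ext (n := n) (f := co n k p q ∘ₗ LinearMap.mulLeft ℂ (xi n j))
    (g := (if k + p - q = j + 1 then co n k (p - 1) q else 0) +
      (if k + p - q = 2 * n - j then co n k p (q - 1) else 0)) ?_ a
  · rw [LinearMap.comp_apply, LinearMap.mulLeft_apply] at this
    rw [this, LinearMap.add_apply]
    congr 1
    · split_ifs <;> rfl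
    · split_ifs <;> rfl
  · intro k' p' q' hs
    have h2 : 1 ≤ k' ∧ k' ≤ n ∧ 0 ≤ q' ∧ q' < k' ∧ 0 ≤ p' ∧ p' ≤ 2 * n - k' := hs
    rw [LinearMap.comp_apply, LinearMap.mulLeft_apply, xi_mul_mm _ _ _ _ (by omega) (by omega),
      LinearMap.add_apply]
    have e1 : (if k + p - q = j + 1 then co n k (p - 1) q else 0) (mm n k' p' q') =
        if k + p - q = j + 1 ∧ k = k' ∧ p - 1 = p' ∧ q = q' then 1 else 0 := by
      by_cases c : k + p - q = j + 1
      · rw [if_pos c]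
        by_cases c2 : Sval n k (p - 1) q
        · rw [co_mm c2 hs]; simp [c]
        · rw [co_bad c2, if_neg]; · rfl
          intro c3
          apply c2
          show 1 ≤ k ∧ k ≤ n ∧ 0 ≤ q ∧ q < k ∧ 0 ≤ p - 1 ∧ p - 1 ≤ 2 * n - k
          omega
      · rw [if_neg c, if_neg (by tauto)]; rfl
    have e2 : (if k + p - q = 2 * n - j then co n k p (q - 1) else 0) (mm n k' p' q') =
        if k + p - q = 2 * n - j ∧ k = k' ∧ p = p' ∧ q - 1 = q' then 1 else 0 := by
      by_cases c : k + p - q = 2 * n - j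
      · rw [if_pos c]
        by_cases c2 : Sval n k p (q - 1)
        · rw [co_mm c2 hs]; simp [c]
        · rw [co_bad c2, if_neg]; · rfl
          intro c3
          apply c2
          show 1 ≤ k ∧ k ≤ n ∧ 0 ≤ q - 1 ∧ q - 1 < k ∧ 0 ≤ p ∧ p ≤ 2 * n - k
          omega
      · rw [if_neg c, if_neg (by tauto)]; rfl
    rw [e1, e2]
    split_ifs with c1 c2 c3 c4 c5 c6 c7 c8 <;>
      first
      | (rw [co_mm' h (by omega), if_pos (by omega)]; simp; done)
      | (rw [co_mm' h (by omega), if_neg (by omega)]; simp; done)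
      | (simp; done)
      | omega

noncomputable def cf (n q : ℕ) (k p r : ℤ) : Ch n (q + 1) →ₗ[ℂ] Ch n q :=
  lft n q (LinearMap.lsmul ℂ (Ch n q) ∘ₗ co n k p r)

theorem cf_tm {n q : ℕ} (k p r : ℤ) (a t) : cf n q k p r (tm n q a t) = co n k p r a • t := by
  rw [cf, lft_tm]; rfl

theorem cf_bad {n q : ℕ} {k p r : ℤ} (h : ¬ Sval n k p r) (x) : cf n q k p r x = 0 := by
  rw [cf, co_bad h]
  induction x using Ch_ind with
  | ha x y hx hy => rw [map_add, hx, hy, add_zero]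
  | ht a t => rw [lft_tm]; simp

theorem cf_Lst {n q : ℕ} (k p r : ℤ) (y x) :
    cf n q k p r (Lst n (q + 1) y x) = Lst n q y (cf n q k p r x) := by
  induction x using Ch_ind with
  | ha x y hx hy => simp only [map_add, hx, hy]
  | ht a t => rw [Lst_tm, cf_tm, cf_tm, map_smul]

theorem cf_xi {n q : ℕ} {k p r : ℤ} (h : Sval n k p r) (j : ℤ) (x) :
    cf n q k p r (Fst n (q + 1) (xi n j) x) =
      (if k + p - r = j + 1 then cf n q k (p - 1) r x else 0) +
      (if k + p - r = 2 * n - j then cf n q k p (r - 1) x else 0) := by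
  induction x using Ch_ind with
  | ha x y hx hy =>
    simp only [map_add, hx, hy]
    split_ifs <;> abel
  | ht a t =>
    rw [Fst_tm, cf_tm, cf_tm, cf_tm, co_xi h, add_smul, ite_smul, ite_smul, zero_smul]

theorem co_E {n : ℕ} {k p q : ℤ} (j : ℤ) (a : PiT n) :
    co n k p q (E n j * a) = if j = k + p - q ∨ j = 2 * n + 1 - (k + p - q) then co n k p q a else 0 := by
  by_cases h : Sval n k p q
  · have := A_lin_ext (n := n) (f := co n k p q ∘ₗ LinearMap.mulLeft ℂ (E n j))
      (g := if j = k + p - q ∨ j = 2 * n + 1 - (k + p - q) then co n k p q else 0) ?_ a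
    · rw [LinearMap.comp_apply, LinearMap.mulLeft_apply] at this
      rw [this]
      split_ifs <;> rfl
    · intro k' p' q' hs
      rw [LinearMap.comp_apply, LinearMap.mulLeft_apply, E_mm]
      split_ifs with c1 c2 c2
      · rfl
      · rw [co_mm h hs, if_neg]; · rfl
        rintro ⟨rfl, rfl, rfl⟩
        exact c2 c1
      · rw [co_mm h hs, if_neg]; · simp
        rintro ⟨rfl, rfl, rfl⟩
        exact c1 c2
      · simp
  · rw [co_bad h]; simp

theorem cf_E {n q : ℕ} (k p r : ℤ) (j : ℤ) (x) :
    cf n q k p r (Fst n (q + 1) (E n j) x) =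
      if j = k + p - r ∨ j = 2 * n + 1 - (k + p - r) then cf n q k p r x else 0 := by
  induction x using Ch_ind with
  | ha x y hx hy =>
    simp only [map_add, hx, hy]
    split_ifs <;> abel
  | ht a t =>
    rw [Fst_tm, cf_tm, cf_tm, co_E, ite_smul, zero_smul]

theorem sum_cf {n q : ℕ} (x : Ch n (q + 1)) :
    ∑ s : S n, tm n q (mm n s.1.1 s.1.2.1 s.1.2.2) (cf n q s.1.1 s.1.2.1 s.1.2.2 x) = x := by
  induction x using Ch_ind with
  | ha x y hx hy =>
    conv_rhs => rw [← hx, ← hy]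
    simp only [map_add, Finset.sum_add_distrib]
  | ht a t =>
    simp only [cf_tm]
    conv_rhs => rw [← sum_co a]
    rw [map_sum, LinearMap.sum_apply]
    simp only [map_smul, LinearMap.smul_apply]

theorem cf_ext {n q : ℕ} {x : Ch n (q + 1)} (h : ∀ k p r, Sval n k p r → cf n q k p r x = 0) : x = 0 := by
  rw [← sum_cf x]
  apply Finset.sum_eq_zero
  intro s _
  rw [h _ _ _ s.2, map_zero]

noncomputable def wt2 (n : ℕ) (ε : ℂ) (i j : ℤ) : ℂ :=
  if j = i then 1 else if j = 2 * n + 1 - i then ε else 0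

noncomputable def V (n q : ℕ) (ε : ℂ) (k p r : ℤ) : Ch n q →ₗ[ℂ] CF n (q + 1) :=
  LinearMap.pi fun j => wt2 n ε (k + p - r) j • (tm n q (mm n k p r) ∘ₗ Lst n q (E n (k + p - r)))

theorem V_apply {n q : ℕ} (ε : ℂ) (k p r : ℤ) (x) (j : ℤ) : V n q ε k p r x j =
    wt2 n ε (k + p - r) j • tm n q (mm n k p r) (Lst n q (E n (k + p - r)) x) := rfl

theorem Lst_E_E {n q : ℕ} {i j : ℤ} (h : i = j ∨ i = 2 * n + 1 - j) (x) :
    Lst n q (E n i) (Lst n q (E n j) x) = Lst n q (E n i) x := by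
  rw [← Lst_mul, E_mul]
  rw [if_pos (by omega)]

theorem wt2_sigma {n : ℕ} {ε : ℂ} (hε : ε * ε = 1) (i j : ℤ) :
    wt2 n ε i (2 * n + 1 - j) = ε * wt2 n ε i j := by
  unfold wt2
  split_ifs <;> first | omega | simp [hε]

theorem V_XV {n q : ℕ} {ε : ℂ} (hε : ε * ε = 1) (k p r : ℤ) (x) : V n q ε k p r x ∈ XV n (q + 1) ε := by
  intro j
  simp only [V_apply]
  by_cases h : j = k + p - r ∨ j = 2 * n + 1 - (k + p - r)
  · refine ⟨?_, ?_, ?_⟩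
    · rw [map_smul, Fst_tm, E_mm, if_pos h]
    · have : E n j = E n (k + p - r) := by
        rcases h with h | h
        · rw [h]
        · rw [h, E_sigma]
      rw [map_smul, Lst_tm, this, Lst_E_E (by omega)]
    · rw [wt2_sigma hε, mul_smul]
  · have : wt2 n ε (k + p - r) j = 0 := by
      unfold wt2; rw [if_neg (by tauto), if_neg (by tauto)]
    rw [wt2_sigma hε, this]; simp

/-- decomposition of an element of `XV` -/
theorem XV_sum {n q : ℕ} {ε : ℂ} {f : CF n (q + 1)} (hf : f ∈ XV n (q + 1) ε) :
    ∑ s : S n, V n q ε s.1.1 s.1.2.1 s.1.2.2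
      (cf n q s.1.1 s.1.2.1 s.1.2.2 (f (s.1.1 + s.1.2.1 - s.1.2.2))) = f := by
  funext j
  rw [Finset.sum_apply]
  conv_rhs => rw [← sum_cf (f j)]
  apply Finset.sum_congr rfl
  rintro ⟨⟨k, p, r⟩, hs⟩ _
  simp only [V_apply]
  rw [← map_smul, ← cf_Lst, (hf _).2.1]
  congr 1
  unfold wt2
  split_ifs with h1 h2
  · rw [h1, one_smul]
  · rw [h2, (hf _).2.2, map_smul]
  · rw [← (hf j).1, cf_E, if_neg (by tauto), zero_smul]

theorem cf_V {n q : ℕ} {ε : ℂ} {k p r k' p' r' : ℤ} (h : Sval n k p r) (h' : k' ≤ n) (x) (j : ℤ) :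
    cf n q k p r (V n q ε k' p' r' x j) = if k = k' ∧ p = p' ∧ r = r' then
      wt2 n ε (k + p - r) j • Lst n q (E n (k + p - r)) x else 0 := by
  rw [V_apply, map_smul, cf_tm, co_mm' h h']
  split_ifs with c
  · obtain ⟨rfl, rfl, rfl⟩ := c
    rw [one_smul]
  · simp

theorem wt2_self {n : ℕ} {ε : ℂ} (i : ℤ) : wt2 n ε i i = 1 := by simp [wt2]
theorem wt2_neg {n : ℕ} {ε : ℂ} (i : ℤ) : wt2 n ε i (2 * n + 1 - i) = ε := by
  unfold wt2
  rw [if_neg (by omega), if_pos rfl]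

theorem XV_ext {n q : ℕ} {ε : ℂ} {f : CF n (q + 1)} (hf : f ∈ XV n (q + 1) ε)
    (h : ∀ k p r, Sval n k p r → cf n q k p r (f (k + p - r)) = 0) : f = 0 := by
  rw [← XV_sum hf]
  apply Finset.sum_eq_zero
  intro s _
  rw [h _ _ _ s.2, map_zero]

theorem XE_ext {n q : ℕ} {f : CF n (q + 1)} (hf : f ∈ XE n (q + 1))
    (h : ∀ k p r, Sval n k p r → cf n q k p r (f (k + p - r)) = 0)
    (h' : ∀ k p r, Sval n k p r → cf n q k p r (f (2 * n + 1 - (k + p - r))) = 0) : f = 0 := by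
  funext j
  apply cf_ext
  intro k p r hs
  rw [← (hf j).1, cf_E]
  split_ifs with c
  · rcases c with c | c
    · rw [c]; exact h k p r hs
    · rw [c]; exact h' k p r hs
  · rfl

end TPre

namespace TPre

/-! ### exactness of the rows -/

noncomputable def sgl {n q : ℕ} (i : ℤ) (Y : Ch n q) : CF n q := fun i' => if i' = i then Y else 0

theorem D1_sgl {n q : ℕ} {ε : ℂ} (i : ℤ) (Y : Ch n q) (j : ℤ) : D1 n q ε (sgl i Y) j =
    wt2 n ε i j • Lst n q (xi n i) Y - wt2 n ε (i + 1) j • Fst n q (xi n i) Y := by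
  have hL : ∀ a : ℤ, Lst n q (xi n a) (sgl i Y a) = if a = i then Lst n q (xi n i) Y else 0 := by
    intro a; unfold sgl; split_ifs with h
    · rw [h]
    · simp
  have hF : ∀ a : ℤ, Fst n q (xi n a) (sgl i Y a) = if a = i then Fst n q (xi n i) Y else 0 := by
    intro a; unfold sgl; split_ifs with h
    · rw [h]
    · simp
  rw [D1_apply, hL, hL, hF, hF]
  unfold wt2
  split_ifs <;> first | omega | (simp; done) | (simp; abel)

theorem sgl_XE {n q : ℕ} {i : ℤ} {Y : Ch n q} (h1 : Fst n q (E n i) Y = Y)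
    (h2 : Lst n q (E n (i + 1)) Y = Y) : sgl i Y ∈ XE n q := by
  intro j
  unfold sgl
  split_ifs with h
  · rw [h]; exact ⟨h1, h2⟩
  · simp

theorem wt2_sigma' {n : ℕ} {ε : ℂ} (hε : ε * ε = 1) (i j : ℤ) :
    wt2 n ε (2 * n + 1 - i) j = ε * wt2 n ε i j := by
  unfold wt2
  split_ifs <;> first | omega | simp [hε]

theorem step_xi {n q : ℕ} {ε : ℂ} {k p r : ℤ} (hp : 0 ≤ p) (x : Ch n q) :
    ∃ F ∈ XE n (q + 1), D1 n (q + 1) ε F =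
      V n q ε k p r (Lst n q (xi n (k + p - r)) x) - V n q ε k (p + 1) r x := by
  refine ⟨sgl (k + p - r) (tm n q (mm n k p r) (Lst n q (E n (k + p - r + 1)) x)), sgl_XE ?_ ?_, ?_⟩
  · rw [Fst_tm, E_mm, if_pos (by left; rfl)]
  · rw [Lst_tm, Lst_E_E (by left; rfl)]
  · funext j
    rw [D1_sgl, Pi.sub_apply, V_apply, V_apply, Lst_tm, Fst_tm, xi_mm hp, ← Lst_mul, ← Lst_mul, E_xi, xi_E,
      show k + p - r + 1 = k + (p + 1) - r by ring]

theorem step_eta {n q : ℕ} {ε : ℂ} (hε : ε * ε = 1) {k p r : ℤ} (hr : 0 ≤ r) (x : Ch n q) :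
    ∃ F ∈ XE n (q + 1), D1 n (q + 1) ε F =
      V n q ε k p r (Lst n q (xi n (2 * n + 1 - (k + p - r))) x) - V n q ε k p (r + 1) x := by
  refine ⟨ε • sgl (2 * n + 1 - (k + p - r))
    (tm n q (mm n k p r) (Lst n q (E n (k + p - (r + 1))) x)), Submodule.smul_mem _ _ (sgl_XE ?_ ?_), ?_⟩
  · rw [Fst_tm, E_mm, if_pos (by right; rfl)]
  · rw [Lst_tm, Lst_E_E (by omega)]
    congr 3
    rw [← E_sigma]; congr 1; ring
  · funext j
    have e1 : E n (k + p - (r + 1)) = E n (2 * n + 1 - (k + p - r) + 1) := by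
      rw [← E_sigma]; congr 1; ring
    have e2 : E n (k + p - r) = E n (2 * n + 1 - (k + p - r)) := by
      rw [E_sigma]
    rw [map_smul, Pi.smul_apply, D1_sgl, Pi.sub_apply, V_apply, V_apply, Lst_tm, Fst_tm, eta_mm hr,
      ← Lst_mul, ← Lst_mul, show wt2 n ε (2 * n + 1 - (k + p - r) + 1) j =
        wt2 n ε (2 * n + 1 - (k + p - (r + 1))) j by congr 1; ring, wt2_sigma' hε, wt2_sigma' hε,
      smul_sub, smul_smul, smul_smul, ← mul_assoc, ← mul_assoc, hε, one_mul, one_mul]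
    rw [e2, xi_E, e1, E_xi]

theorem V_reduce {n q : ℕ} {ε : ℂ} (hε : ε * ε = 1) (k p r : ℤ) (hp : 0 ≤ p) (hr : 0 ≤ r) :
    ∀ x : Ch n q, ∃ F ∈ XE n (q + 1), D1 n (q + 1) ε F =
      V n q ε k 0 0 (Lst n q (mm n k p r) x) - V n q ε k p r x := by
  refine pq_ind (P := fun p r => ∀ x : Ch n q, ∃ F ∈ XE n (q + 1), D1 n (q + 1) ε F =
      V n q ε k 0 0 (Lst n q (mm n k p r) x) - V n q ε k p r x) ?_ ?_ ?_ p r hp hr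
  · intro x
    refine ⟨0, zero_mem _, ?_⟩
    funext j
    rw [map_zero, Pi.sub_apply, V_apply, V_apply, mm_zero_zero, Lst_E_E (by left; ring), sub_self]; rfl
  · intro p r hp hr ih x
    obtain ⟨F1, h1, e1⟩ := ih (Lst n q (xi n (k + p - r)) x)
    obtain ⟨F2, h2, e2⟩ := step_xi (ε := ε) (k := k) (r := r) hp x
    refine ⟨F1 + F2, add_mem h1 h2, ?_⟩
    rw [map_add, e1, e2, ← Lst_mul, xi_mm hp]
    abel
  · intro p r hp hr ih x
    obtain ⟨F1, h1, e1⟩ := ih (Lst n q (xi n (2 * n + 1 - (k + p - r))) x)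
    obtain ⟨F2, h2, e2⟩ := step_eta hε (k := k) (p := p) hr x
    refine ⟨F1 + F2, add_mem h1 h2, ?_⟩
    rw [map_add, e1, e2, ← Lst_mul, eta_mm hr]
    abel

noncomputable def augc (n q : ℕ) (k : ℤ) (f : CF n (q + 1)) : Ch n q :=
  ∑ s : S n with s.1.1 = k, Lst n q (mm n s.1.1 s.1.2.1 s.1.2.2)
    (cf n q s.1.1 s.1.2.1 s.1.2.2 (f (s.1.1 + s.1.2.1 - s.1.2.2)))

theorem exact_of_augc {n q : ℕ} {ε : ℂ} (hε : ε * ε = 1) {f : CF n (q + 1)} (hf : f ∈ XV n (q + 1) ε)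
    (h : ∀ k : ℤ, 1 ≤ k → k ≤ n → augc n q k f = 0) : ∃ F ∈ XE n (q + 1), D1 n (q + 1) ε F = f := by
  have hp : ∀ s : S n, 0 ≤ s.1.2.1 ∧ 0 ≤ s.1.2.2 ∧ 1 ≤ s.1.1 ∧ s.1.1 ≤ n := by
    intro s
    have : 1 ≤ s.1.1 ∧ s.1.1 ≤ n ∧ 0 ≤ s.1.2.2 ∧ s.1.2.2 < s.1.1 ∧ 0 ≤ s.1.2.1 ∧
      s.1.2.1 ≤ 2 * n - s.1.1 := s.2
    omega
  choose F hF eF using fun s : S n => V_reduce (q := q) hε s.1.1 s.1.2.1 s.1.2.2 (hp s).1 (hp s).2.1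
    (cf n q s.1.1 s.1.2.1 s.1.2.2 (f (s.1.1 + s.1.2.1 - s.1.2.2)))
  refine ⟨- ∑ s : S n, F s, neg_mem (Submodule.sum_mem _ fun s _ => hF s), ?_⟩
  rw [map_neg, map_sum]
  simp only [eF]
  rw [Finset.sum_sub_distrib, XV_sum hf]
  have : ∑ s : S n, V n q ε s.1.1 0 0 (Lst n q (mm n s.1.1 s.1.2.1 s.1.2.2)
      (cf n q s.1.1 s.1.2.1 s.1.2.2 (f (s.1.1 + s.1.2.1 - s.1.2.2)))) = 0 := by
    rw [← Finset.sum_fiberwise_of_maps_to (t := Finset.Icc (1 : ℤ) n) (g := fun s : S n => s.1.1)]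
    · apply Finset.sum_eq_zero
      intro k hk
      rw [Finset.mem_Icc] at hk
      rw [← (V n q ε k 0 0).map_zero, ← h k hk.1 hk.2, augc, map_sum]
      apply Finset.sum_congr rfl
      intro s hs
      rw [(Finset.mem_filter.mp hs).2]
    · intro s _
      rw [Finset.mem_Icc]
      exact (hp s).2.2
  rw [this]
  abel

theorem aug_V {n q : ℕ} (k p r : ℤ) (x) (h : 1 ≤ k + p - r ∧ k + p - r ≤ 2 * n) :
    aug n q (V n q 1 k p r x) = rot n q (Lst n q (mm n k p r) x) := by
  rw [aug_apply]
  have h0 : Lst n q (mm n k p r) (Lst n q (E n (k + p - r)) x) = Lst n q (mm n k p r) x := by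
    rw [← Lst_mul, E_mm, if_pos (by left; rfl)]
  simp only [V_apply, map_smul, cc_tm, h0]
  rw [← Finset.sum_smul]
  have : ∑ j ∈ Finset.Icc (1 : ℤ) n, wt2 n 1 (k + p - r) j = 1 := by
    by_cases c : k + p - r ≤ n
    · rw [Finset.sum_eq_single (k + p - r)]
      · exact wt2_self _
      · intro b hb hn
        rw [Finset.mem_Icc] at hb
        unfold wt2
        rw [if_neg hn, if_neg (by omega)]
      · intro hn
        rw [Finset.mem_Icc] at hn
        omega
    · rw [Finset.sum_eq_single (2 * n + 1 - (k + p - r))]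
      · exact wt2_neg _
      · intro b hb hn
        rw [Finset.mem_Icc] at hb
        unfold wt2
        rw [if_neg (by omega), if_neg hn]
      · intro hn
        rw [Finset.mem_Icc] at hn
        omega
  rw [this, one_smul]

theorem S_tgt {n : ℕ} (s : S n) : 1 ≤ s.1.1 + s.1.2.1 - s.1.2.2 ∧ s.1.1 + s.1.2.1 - s.1.2.2 ≤ 2 * n := by
  have : 1 ≤ s.1.1 ∧ s.1.1 ≤ n ∧ 0 ≤ s.1.2.2 ∧ s.1.2.2 < s.1.1 ∧ 0 ≤ s.1.2.1 ∧
      s.1.2.1 ≤ 2 * n - s.1.1 := s.2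
  omega

theorem exact_aug {n q : ℕ} {f : CF n (q + 1)} (hf : f ∈ XV n (q + 1) 1) (h : aug n q f = 0) :
    ∃ F ∈ XE n (q + 1), D1 n (q + 1) 1 F = f := by
  apply exact_of_augc (by simp) hf
  intro k hk hk'
  rw [← XV_sum hf, map_sum] at h
  have h2 := fun s : S n => aug_V (q := q) s.1.1 s.1.2.1 s.1.2.2
    (cf n q s.1.1 s.1.2.1 s.1.2.2 (f (s.1.1 + s.1.2.1 - s.1.2.2))) (S_tgt s)
  simp only [h2] at h
  rw [← map_sum] at h
  have h3 := rot_inj (h.trans (map_zero _).symm)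
  have h4 := congrArg (Lst n q (E n k)) h3
  rw [map_zero, map_sum] at h4
  rw [← h4, augc, Finset.sum_filter]
  apply Finset.sum_congr rfl
  intro s _
  rw [← Lst_mul, mm_E]
  have : 1 ≤ s.1.1 ∧ s.1.1 ≤ n ∧ 0 ≤ s.1.2.2 ∧ s.1.2.2 < s.1.1 ∧ 0 ≤ s.1.2.1 ∧
      s.1.2.1 ≤ 2 * n - s.1.1 := s.2
  split_ifs <;> first | omega | simp

theorem aug_surj {n q : ℕ} (z : Ch n q) : ∃ f ∈ XV n (q + 1) 1, aug n q f = z := by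
  obtain ⟨z', rfl⟩ := rot_surj z
  refine ⟨∑ k ∈ Finset.Icc (1 : ℤ) n, V n q 1 k 0 0 z',
    Submodule.sum_mem _ fun k _ => V_XV (by simp) _ _ _ _, ?_⟩
  rw [map_sum]
  have : ∀ k ∈ Finset.Icc (1 : ℤ) n, aug n q (V n q 1 k 0 0 z') = rot n q (Lst n q (E n k) z') := by
    intro k hk
    rw [Finset.mem_Icc] at hk
    rw [aug_V _ _ _ _ (by omega), mm_zero_zero]
  rw [Finset.sum_congr rfl this, ← map_sum, ← LinearMap.sum_apply, ← map_sum, sum_E, Lst_one]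

/-- the top coordinate of `D3` -/
theorem top_V {n q : ℕ} {ε : ℂ} {k k' p' r' : ℤ} (hk : 1 ≤ k) (hk' : k ≤ n) (hs : Sval n k' p' r') (x) :
    cf n q k (2 * n - k) (k - 1) (D3 n (q + 1) (V n q ε k' p' r' x) (2 * n + 1 - k)) =
      if k' = k then Lst n q (mm n k' p' r') x else 0 := by
  have h1 : 1 ≤ k' ∧ k' ≤ n ∧ 0 ≤ r' ∧ r' < k' ∧ 0 ≤ p' ∧ p' ≤ 2 * n - k' := hs
  have hT : Sval n k (2 * n - k) (k - 1) := by
    show 1 ≤ k ∧ k ≤ n ∧ 0 ≤ k - 1 ∧ k - 1 < k ∧ 0 ≤ 2 * (n : ℤ) - k ∧ 2 * (n : ℤ) - k ≤ 2 * n - k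
    omega
  rw [D3_apply, map_sum]
  have key : ∀ y ∈ box n, cf n q k (2 * n - k) (k - 1)
      (Fst n (q + 1) (mm n y.1 y.2 (y.1 + y.2 - (2 * n + 1 - k)))
        (Lst n (q + 1) (mm n (2 * n + 1 - k) (2 * n - y.1 - y.2) (2 * n + 1 - k - 1 - y.2))
          (V n q ε k' p' r' x y.1))) =
      if y = (k' + p' - r', 2 * n - k - p') ∧ k' = k then Lst n q (mm n k' p' r') x else 0 := by
    rintro ⟨κ, p⟩ hy
    rw [mem_box] at hy
    simp only [Prod.mk.injEq] at hy ⊢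
    rw [V_apply, map_smul, map_smul, map_smul, Lst_tm, Fst_tm, cf_tm]
    by_cases c1 : κ = k' + p' - r'
    · subst c1
      rw [wt2_self, one_smul]
      by_cases c2 : 0 ≤ k' + p' - r' + p - (2 * n + 1 - k)
      · rw [mm_mul (by omega) (by omega) (by omega) c2, co_mm' hT (by omega)]
        by_cases c3 : p = 2 * n - k - p' ∧ k' = k
        · rw [if_pos (by omega), if_pos (by tauto), one_smul, ← Lst_mul]
          obtain ⟨rfl, rfl⟩ := c3
          rw [show 2 * (n : ℤ) - (k' + p' - r') - (2 * n - k' - p') = r' by ring,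
            show 2 * (n : ℤ) + 1 - k' - 1 - (2 * n - k' - p') = p' by ring, mm_sigma, E_mm,
            if_pos (by left; rfl)]
        · rw [if_neg (by omega), if_neg (by tauto), zero_smul]
      · rw [mm_bad (k := k' + p' - r') (by omega), zero_mul, map_zero, zero_smul, if_neg (by omega)]
    · rw [if_neg (by tauto)]
      by_cases c4 : κ = 2 * n + 1 - (k' + p' - r')
      · rw [c4, wt2_neg, mm_sigma]
        by_cases c2 : 0 ≤ (2 * (n : ℤ) + 1 - (k' + p' - r') + p - (2 * n + 1 - k))
        · rw [mm_mul (by omega) (by omega) c2 (by omega), co_mm' hT (by omega), if_neg (by omega),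
            zero_smul, smul_zero]
        · rw [mm_bad (k := k' + p' - r') (by omega), zero_mul, map_zero, zero_smul, smul_zero]
      · unfold wt2
        rw [if_neg c1, if_neg c4, zero_smul]
  rw [Finset.sum_congr rfl key]
  by_cases hkk : k' = k
  · subst hkk
    simp only [and_true, if_true]
    rw [Finset.sum_ite_eq', if_pos]
    rw [mem_box]
    simp only
    omega
  · simp [hkk]

theorem top_D3 {n q : ℕ} {ε : ℂ} {f : CF n (q + 1)} (hf : f ∈ XV n (q + 1) ε) {k : ℤ} (hk : 1 ≤ k)
    (hk' : k ≤ n) :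
    cf n q k (2 * n - k) (k - 1) (D3 n (q + 1) f (2 * n + 1 - k)) = augc n q k f := by
  conv_lhs => rw [← XV_sum hf]
  rw [map_sum, Finset.sum_apply, map_sum, augc, Finset.sum_filter]
  apply Finset.sum_congr rfl
  intro s _
  rw [top_V hk hk' s.2]

theorem exact_D3 {n q : ℕ} {ε : ℂ} (hε : ε * ε = 1) {f : CF n (q + 1)} (hf : f ∈ XV n (q + 1) ε)
    (h : D3 n (q + 1) f = 0) : ∃ F ∈ XE n (q + 1), D1 n (q + 1) ε F = f := by
  apply exact_of_augc hε hf
  intro k hk hk'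
  rw [← top_D3 hf hk hk', h, Pi.zero_apply, map_zero]

/-- coordinates of `D2` -/
theorem cf_D2_a {n q : ℕ} {k p r : ℤ} (h : Sval n k p r) (f : CF n (q + 1)) :
    cf n q k p r (D2 n (q + 1) f (k + p - r)) =
      Lst n q (xi n (2 * n - (k + p - r))) (cf n q k p r (f (k + p - r)))
      - cf n q k p (r - 1) (f (k + p - (r - 1))) := by
  rw [D2_apply, map_sub, cf_Lst, cf_xi h, if_neg (by omega), if_pos (by omega), zero_add,
    show k + p - r + 1 = k + p - (r - 1) by ring]

theorem cf_D2_b {n q : ℕ} {ε : ℂ} {k p r : ℤ} (h : Sval n k p r) {f : CF n (q + 1)}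
    (hf : f ∈ XV n (q + 1) ε) :
    cf n q k p r (D2 n (q + 1) f (2 * n + 1 - (k + p - r))) =
      ε • (Lst n q (xi n (k + p - r - 1)) (cf n q k p r (f (k + p - r)))
      - cf n q k (p - 1) r (f (k + (p - 1) - r))) := by
  rw [D2_apply, map_sub, cf_Lst, cf_xi h, if_pos (by omega), if_neg (by omega), add_zero,
    (hf _).2.2, show 2 * (n : ℤ) + 1 - (k + p - r) + 1 = 2 * n + 1 - (k + (p - 1) - r) by ring,
    (hf _).2.2, show 2 * (n : ℤ) - (2 * n + 1 - (k + p - r)) = k + p - r - 1 by ring]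
  simp only [map_smul, smul_sub]

theorem D2_inj {n q : ℕ} {ε : ℂ} (hε : ε * ε = 1) {f : CF n (q + 1)} (hf : f ∈ XV n (q + 1) ε)
    (h : D2 n (q + 1) f = 0)
    (ht : ∀ k : ℤ, 1 ≤ k → k ≤ n → cf n q k (2 * n - k) (k - 1) (f (2 * n + 1 - k)) = 0) : f = 0 := by
  apply XV_ext hf
  intro k p r hs
  have h1 : 1 ≤ k ∧ k ≤ n ∧ 0 ≤ r ∧ r < k ∧ 0 ≤ p ∧ p ≤ 2 * n - k := hs
  have ea : ∀ i : ℕ, cf n q k (2 * n - k) (k - 1 - i) (f (k + (2 * n - k) - (k - 1 - i))) = 0 := by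
    intro i
    induction i with
    | zero =>
      have := ht k (by omega) (by omega)
      rw [← this]; congr 2 <;> push_cast <;> ring
    | succ i ih =>
      by_cases hv : Sval n k (2 * n - k) (k - 1 - i)
      · have := cf_D2_a (q := q) hv f
        rw [h, Pi.zero_apply, map_zero, ih, map_zero, zero_sub, eq_comm, neg_eq_zero] at this
        rw [show k - 1 - ((i + 1 : ℕ) : ℤ) = k - 1 - i - 1 by push_cast; ring, this]
      · apply cf_bad
        intro c
        apply hv
        have c1 : 1 ≤ k ∧ k ≤ n ∧ 0 ≤ k - 1 - ((i + 1 : ℕ) : ℤ) ∧ k - 1 - ((i + 1 : ℕ) : ℤ) < k ∧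
          0 ≤ 2 * n - k ∧ 2 * (n : ℤ) - k ≤ 2 * n - k := c
        show 1 ≤ k ∧ k ≤ n ∧ 0 ≤ k - 1 - (i : ℤ) ∧ k - 1 - (i : ℤ) < k ∧
          0 ≤ 2 * n - k ∧ 2 * (n : ℤ) - k ≤ 2 * n - k
        omega
  have eb : ∀ i : ℕ, cf n q k (2 * n - k - i) r (f (k + (2 * n - k - i) - r)) = 0 := by
    intro i
    induction i with
    | zero =>
      have := ea (k - 1 - r).toNat
      rw [show k - 1 - ((k - 1 - r).toNat : ℤ) = r by omega] at this
      rw [← this]; congr 2 <;> push_cast <;> ring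
    | succ i ih =>
      by_cases hv : Sval n k (2 * n - k - i) r
      · have := cf_D2_b hv hf
        rw [h, Pi.zero_apply, map_zero, ih, map_zero, zero_sub, eq_comm] at this
        have h3 := congrArg (fun z => ε • z) this
        simp only [smul_smul, hε, one_smul, smul_zero, neg_eq_zero] at h3
        rw [show 2 * (n : ℤ) - k - ((i + 1 : ℕ) : ℤ) = 2 * n - k - i - 1 by push_cast; ring, h3]
      · apply cf_bad
        intro c
        apply hv
        have c1 : 1 ≤ k ∧ k ≤ n ∧ 0 ≤ r ∧ r < k ∧
          0 ≤ 2 * (n : ℤ) - k - ((i + 1 : ℕ) : ℤ) ∧ 2 * (n : ℤ) - k - ((i + 1 : ℕ) : ℤ) ≤ 2 * n - k := c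
        show 1 ≤ k ∧ k ≤ n ∧ 0 ≤ r ∧ r < k ∧
          0 ≤ 2 * (n : ℤ) - k - (i : ℤ) ∧ 2 * (n : ℤ) - k - (i : ℤ) ≤ 2 * n - k
        omega
  have := eb (2 * n - k - p).toNat
  rw [show 2 * (n : ℤ) - k - ((2 * n - k - p).toNat : ℤ) = p by omega] at this
  exact this

theorem exact_D2 {n q : ℕ} {ε : ℂ} (hε : ε * ε = 1) {f : CF n (q + 1)} (hf : f ∈ XV n (q + 1) ε)
    (h : D2 n (q + 1) f = 0) : ∃ g ∈ XV n (q + 1) ε, D3 n (q + 1) g = f := by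
  set g : CF n (q + 1) := ∑ k ∈ Finset.Icc (1 : ℤ) n, V n q ε k 0 0
    (cf n q k (2 * n - k) (k - 1) (f (2 * n + 1 - k))) with hg
  have hgX : g ∈ XV n (q + 1) ε := Submodule.sum_mem _ fun k _ => V_XV hε _ _ _ _
  refine ⟨g, hgX, ?_⟩
  rw [← sub_eq_zero]
  apply D2_inj hε (sub_mem (D3_XV hε hgX) hf)
  · rw [map_sub, h, D2_D3, sub_zero]
  · intro k hk hk'
    rw [Pi.sub_apply, map_sub, hg, map_sum, Finset.sum_apply, map_sum, sub_eq_zero]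
    have : ∀ k' ∈ Finset.Icc (1 : ℤ) n, cf n q k (2 * n - k) (k - 1)
        (D3 n (q + 1) (V n q ε k' 0 0 (cf n q k' (2 * n - k') (k' - 1) (f (2 * n + 1 - k'))))
          (2 * n + 1 - k)) =
        if k' = k then cf n q k (2 * n - k) (k - 1) (f (2 * n + 1 - k)) else 0 := by
      intro k' hk1
      rw [Finset.mem_Icc] at hk1
      have hS : Sval n k' 0 0 := by
        show 1 ≤ k' ∧ k' ≤ n ∧ 0 ≤ (0 : ℤ) ∧ 0 < k' ∧ 0 ≤ (0 : ℤ) ∧ 0 ≤ 2 * n - k'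
        omega
      rw [top_V hk hk' hS]
      split_ifs with c
      · subst c
        rw [mm_zero_zero, ← cf_Lst, ← E_sigma, (hf _).2.1]
      · rfl
    rw [Finset.sum_congr rfl this, Finset.sum_ite_eq', if_pos]
    rw [Finset.mem_Icc]; omega

end TPre

namespace TPre

theorem cf_D1 {n q : ℕ} {ε : ℂ} {k p r : ℤ} (h : Sval n k p r) (F : CF n (q + 1)) :
    cf n q k p r (D1 n (q + 1) ε F (k + p - r)) =
      (Lst n q (xi n (k + p - r)) (cf n q k p r (F (k + p - r)))
        - cf n q k (p - 1) r (F (k + (p - 1) - r)))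
      + ε • (Lst n q (xi n (2 * n + 1 - (k + p - r))) (cf n q k p r (F (2 * n + 1 - (k + p - r))))
        - cf n q k p (r - 1) (F (2 * n + 1 - (k + p - (r - 1))))) := by
  rw [D1_apply, map_add, map_sub, map_smul, map_sub, cf_Lst, cf_Lst, cf_xi h, cf_xi h,
    if_pos (by omega), if_neg (by omega), if_neg (by omega), if_pos (by omega), add_zero, zero_add,
    show k + p - r - 1 = k + (p - 1) - r by ring,
    show 2 * (n : ℤ) - (k + p - r) = 2 * n + 1 - (k + p - (r - 1)) by ring]

theorem XE_top {n q : ℕ} {F : CF n q} (hF : F ∈ XE n q) {j : ℤ} (h : j = 2 * n) : F j = 0 := by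
  rw [← (hF j).2, E_zero (by omega)]; simp

theorem D1_inj {n q : ℕ} {ε : ℂ} (hε : ε * ε = 1) {G : CF n (q + 1)} (hG : G ∈ XE n (q + 1))
    (h : D1 n (q + 1) ε G = 0)
    (ha : ∀ k r, 1 ≤ r → Sval n k (2 * n - k) r →
      cf n q k (2 * n - k) r (G (k + (2 * n - k) - r)) = 0)
    (hb : ∀ k p r, 1 ≤ p → Sval n k p r →
      cf n q k p r (G (2 * n + 1 - (k + p - r))) = 0) : G = 0 := by
  have hb' : ∀ k p r, 1 ≤ p → cf n q k p r (G (2 * n + 1 - (k + p - r))) = 0 := by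
    intro k p r hp
    by_cases hs : Sval n k p r
    · exact hb k p r hp hs
    · exact cf_bad hs _
  have h1 : ∀ k r : ℤ, ∀ i : ℕ, cf n q k (2 * n - k - i) r (G (k + (2 * n - k - i) - r)) = 0 := by
    intro k r i
    by_cases hs : Sval n k (2 * n - k - i) r
    swap
    · exact cf_bad hs _
    have hs1 : 1 ≤ k ∧ k ≤ n ∧ 0 ≤ r ∧ r < k ∧ 0 ≤ 2 * n - k - (i : ℤ) ∧
      2 * n - k - (i : ℤ) ≤ 2 * n - k := hs
    induction i with
    | zero =>
      simp only [Nat.cast_zero, sub_zero] at hs ⊢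
      rcases eq_or_lt_of_le hs1.2.2.1 with c | c
      · rw [XE_top hG (by omega), map_zero]
      · exact ha k r (by omega) hs
    | succ i ih =>
      have hv : Sval n k (2 * n - k - i) r := by
        show 1 ≤ k ∧ k ≤ n ∧ 0 ≤ r ∧ r < k ∧ 0 ≤ 2 * n - k - (i : ℤ) ∧
          2 * n - k - (i : ℤ) ≤ 2 * n - k
        push_cast at hs1
        omega
      have e := cf_D1 (q := q) (ε := ε) hv G
      rw [h, Pi.zero_apply, map_zero, ih hv hv, hb' _ _ _ (by push_cast at hs1; omega), hb' _ _ _ (by push_cast at hs1; omega)] at e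
      simp only [map_zero, sub_zero, smul_zero, add_zero, zero_sub] at e
      rw [show 2 * (n : ℤ) - k - ((i + 1 : ℕ) : ℤ) = 2 * n - k - i - 1 by push_cast; ring]
      exact neg_eq_zero.mp e.symm
  have h1' : ∀ k p r : ℤ, cf n q k p r (G (k + p - r)) = 0 := by
    intro k p r
    by_cases hs : Sval n k p r
    swap
    · exact cf_bad hs _
    have hs1 : 1 ≤ k ∧ k ≤ n ∧ 0 ≤ r ∧ r < k ∧ 0 ≤ p ∧ p ≤ 2 * n - k := hs
    have := h1 k r (2 * n - k - p).toNat
    rw [show 2 * (n : ℤ) - k - ((2 * n - k - p).toNat : ℤ) = p by omega] at this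
    exact this
  have h2 : ∀ k : ℤ, ∀ i : ℕ, cf n q k 0 (k - 1 - i) (G (2 * n + 1 - (k + 0 - (k - 1 - i)))) = 0 := by
    intro k i
    by_cases hs : Sval n k 0 (k - 1 - i)
    swap
    · exact cf_bad hs _
    have hs1 : 1 ≤ k ∧ k ≤ n ∧ 0 ≤ k - 1 - (i : ℤ) ∧ k - 1 - (i : ℤ) < k ∧ 0 ≤ (0 : ℤ) ∧
      0 ≤ 2 * n - k := hs
    induction i with
    | zero =>
      rw [XE_top hG (by omega), map_zero]
    | succ i ih =>
      have hv : Sval n k 0 (k - 1 - i) := by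
        show 1 ≤ k ∧ k ≤ n ∧ 0 ≤ k - 1 - (i : ℤ) ∧ k - 1 - (i : ℤ) < k ∧ 0 ≤ (0 : ℤ) ∧
          0 ≤ 2 * n - k
        push_cast at hs1
        omega
      have e := cf_D1 (q := q) (ε := ε) hv G
      rw [h, Pi.zero_apply, map_zero, ih hv hv, h1', h1'] at e
      simp only [map_zero, sub_zero, zero_add, zero_sub] at e
      have e3 := congrArg (fun z => ε • z) e.symm
      simp only [smul_smul, hε, one_smul, smul_zero, neg_eq_zero, smul_neg] at e3
      rw [← e3, show k - 1 - ((i + 1 : ℕ) : ℤ) = k - 1 - i - 1 by push_cast; ring, add_zero]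
  apply XE_ext hG
  · intro k p r _; exact h1' k p r
  · intro k p r hs
    have hs1 : 1 ≤ k ∧ k ≤ n ∧ 0 ≤ r ∧ r < k ∧ 0 ≤ p ∧ p ≤ 2 * n - k := hs
    rcases eq_or_lt_of_le hs1.2.2.2.2.1 with c | c
    · subst c
      have := h2 k (k - 1 - r).toNat
      rw [show k - 1 - ((k - 1 - r).toNat : ℤ) = r by omega] at this
      exact this
    · exact hb' k p r (by omega)

noncomputable def uA {n q : ℕ} (F : CF n (q + 1)) (k : ℤ) : ℕ → Ch n q
  | 0 => 0
  | (i + 1) => Lst n q (xi n (2 * n - (k + (2 * n - k) - (k - 1 - i)))) (uA F k i)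
      - cf n q k (2 * n - k) (k - 1 - i) (F (k + (2 * n - k) - (k - 1 - i)))

noncomputable def uB {n q : ℕ} (ε : ℂ) (F : CF n (q + 1)) (k r : ℤ) : ℕ → Ch n q
  | 0 => uA F k (k - 1 - r).toNat
  | (i + 1) => Lst n q (xi n (k + (2 * n - k - i) - r - 1)) (uB ε F k r i)
      + ε • cf n q k (2 * n - k - i) r (F (2 * n + 1 - (k + (2 * n - k - i) - r)))

noncomputable def uu {n q : ℕ} (ε : ℂ) (F : CF n (q + 1)) (k p r : ℤ) : Ch n q :=
  uB ε F k r (2 * n - k - p).toNat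

theorem uu_a {n q : ℕ} (ε : ℂ) (F : CF n (q + 1)) {k r : ℤ} (hr : r < k) :
    uu ε F k (2 * n - k) (r - 1) =
      Lst n q (xi n (2 * n - (k + (2 * n - k) - r))) (uu ε F k (2 * n - k) r)
      - cf n q k (2 * n - k) r (F (k + (2 * n - k) - r)) := by
  unfold uu
  rw [show (2 * (n : ℤ) - k - (2 * n - k)).toNat = 0 by omega]
  show uA F k (k - 1 - (r - 1)).toNat = Lst n q _ (uA F k (k - 1 - r).toNat) - _
  rw [show (k - 1 - (r - 1)).toNat = (k - 1 - r).toNat + 1 by omega, uA,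
    show k - 1 - ((k - 1 - r).toNat : ℤ) = r by omega]

theorem uu_b {n q : ℕ} (ε : ℂ) (F : CF n (q + 1)) {k p r : ℤ} (hp : p ≤ 2 * n - k) :
    uu ε F k (p - 1) r =
      Lst n q (xi n (k + p - r - 1)) (uu ε F k p r)
      + ε • cf n q k p r (F (2 * n + 1 - (k + p - r))) := by
  unfold uu
  rw [show (2 * (n : ℤ) - k - (p - 1)).toNat = (2 * (n : ℤ) - k - p).toNat + 1 by omega, uB,
    show 2 * (n : ℤ) - k - ((2 * (n : ℤ) - k - p).toNat : ℤ) = p by omega]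

theorem exact_D1 {n q : ℕ} {ε : ℂ} (hε : ε * ε = 1) {F : CF n (q + 1)} (hF : F ∈ XE n (q + 1))
    (h : D1 n (q + 1) ε F = 0) : ∃ f ∈ XV n (q + 1) (-ε), D2 n (q + 1) f = F := by
  have hε' : (-ε) * (-ε) = 1 := by rw [neg_mul_neg, hε]
  set f : CF n (q + 1) := ∑ s : S n, V n q (-ε) s.1.1 s.1.2.1 s.1.2.2
    (uu ε F s.1.1 s.1.2.1 s.1.2.2) with hf
  have hfX : f ∈ XV n (q + 1) (-ε) := Submodule.sum_mem _ fun s _ => V_XV hε' _ _ _ _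
  have hcf : ∀ k p r, Sval n k p r → cf n q k p r (f (k + p - r)) =
      Lst n q (E n (k + p - r)) (uu ε F k p r) := by
    intro k p r hs
    rw [hf, Finset.sum_apply, map_sum, Finset.sum_eq_single ⟨(k, p, r), hs⟩]
    · rw [cf_V hs hs.2.1, if_pos ⟨rfl, rfl, rfl⟩, wt2_self, one_smul]
    · rintro ⟨⟨k', p', r'⟩, hs'⟩ _ hne
      rw [cf_V hs hs'.2.1, if_neg]
      rintro ⟨h1, h2, h3⟩
      apply hne
      simp only at h1 h2 h3
      subst h1; subst h2; subst h3; rfl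
    · intro hc; exact absurd (Finset.mem_univ _) hc
  refine ⟨f, hfX, ?_⟩
  rw [eq_comm, ← sub_eq_zero]
  apply D1_inj hε (sub_mem hF (D2_XE hfX))
  · rw [map_sub, h, D1_D2 hε hfX, sub_zero]
  · intro k r hr hs
    have hs1 : 1 ≤ k ∧ k ≤ n ∧ 0 ≤ r ∧ r < k ∧ 0 ≤ 2 * (n : ℤ) - k ∧ 2 * (n : ℤ) - k ≤ 2 * n - k := hs
    have hs' : Sval n k (2 * n - k) (r - 1) := by
      show 1 ≤ k ∧ k ≤ n ∧ 0 ≤ r - 1 ∧ r - 1 < k ∧ 0 ≤ 2 * (n : ℤ) - k ∧ 2 * (n : ℤ) - k ≤ 2 * n - k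
      omega
    rw [Pi.sub_apply, map_sub, cf_D2_a hs, hcf _ _ _ hs, hcf _ _ _ hs', uu_a ε F hs1.2.2.2.1,
      map_sub, ← Lst_mul, ← Lst_mul]
    have e1 : E n (k + (2 * n - k) - r) * xi n (2 * n - (k + (2 * n - k) - r)) =
        xi n (2 * n - (k + (2 * n - k) - r)) := by
      rw [← E_sigma, show 2 * (n : ℤ) + 1 - (k + (2 * n - k) - r) =
        2 * n - (k + (2 * n - k) - r) + 1 by ring, E_xi]
    have e2 : xi n (2 * n - (k + (2 * n - k) - r)) * E n (k + (2 * n - k) - (r - 1)) =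
        xi n (2 * n - (k + (2 * n - k) - r)) := by
      rw [← E_sigma, show 2 * (n : ℤ) + 1 - (k + (2 * n - k) - (r - 1)) =
        2 * n - (k + (2 * n - k) - r) by ring, xi_E]
    rw [e1, e2, ← cf_Lst, show k + (2 * (n : ℤ) - k) - (r - 1) = k + (2 * n - k) - r + 1 by ring,
      (hF _).2]
    abel
  · intro k p r hp hs
    have hs1 : 1 ≤ k ∧ k ≤ n ∧ 0 ≤ r ∧ r < k ∧ 0 ≤ p ∧ p ≤ 2 * n - k := hs
    have hs' : Sval n k (p - 1) r := by
      show 1 ≤ k ∧ k ≤ n ∧ 0 ≤ r ∧ r < k ∧ 0 ≤ p - 1 ∧ p - 1 ≤ 2 * n - k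
      omega
    rw [Pi.sub_apply, map_sub, cf_D2_b hs hfX, hcf _ _ _ hs, hcf _ _ _ hs', uu_b ε F hs1.2.2.2.2.2,
      map_add, ← Lst_mul, ← Lst_mul]
    have e1 : E n (k + p - r) * xi n (k + p - r - 1) = xi n (k + p - r - 1) := by
      have := E_xi (n := n) (j := k + p - r - 1)
      rwa [show k + p - r - 1 + 1 = k + p - r by ring] at this
    have e2 : xi n (k + p - r - 1) * E n (k + (p - 1) - r) = xi n (k + p - r - 1) := by
      rw [show k + (p - 1) - r = k + p - r - 1 by ring, xi_E]
    have e3 : E n (k + (p - 1) - r) = E n (2 * n + 1 - (k + p - r) + 1) := by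
      rw [← E_sigma]; congr 1; ring
    rw [e1, e2, map_smul, ← cf_Lst, e3, (hF _).2, sub_add_cancel_left, smul_neg, smul_smul, neg_mul, hε]
    simp

end TPre

namespace TPre

/-! ### column exactness -/

noncomputable def sv (n q : ℕ) (f : CF n q) : CF n (q + 1) := fun j => tm n q (E n j) (f j)

theorem sv_XV {n q : ℕ} {ε : ℂ} {f : CF n q} (h : f ∈ XV n q ε) : sv n q f ∈ XV n (q + 1) ε := by
  intro j
  unfold sv
  refine ⟨?_, ?_, ?_⟩
  · rw [Fst_tm, E_self]
  · rw [Lst_tm, (h j).2.1]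
  · rw [E_sigma, (h j).2.2, map_smul]

theorem sv_XE {n q : ℕ} {f : CF n q} (h : f ∈ XE n q) : sv n q f ∈ XE n (q + 1) := by
  intro j
  unfold sv
  refine ⟨?_, ?_⟩
  · rw [Fst_tm, E_self]
  · rw [Lst_tm, (h j).2]

theorem sv_XG {n q : ℕ} {δ : ℤ} {f : CF n q} (h : f ∈ XG n q δ) : sv n q f ∈ XG n (q + 1) δ := by
  intro j
  unfold sv
  rw [phc_tm, phi_E, h j, map_smul]

noncomputable def Zv (n : ℕ) : (q : ℕ) → Submodule ℂ (CF n q)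
  | 0 => ⊤
  | (q + 1) => LinearMap.ker (bpF n q)

theorem bpF_sv {n q : ℕ} {f : CF n q} (h : f ∈ Zv n q) (h1 : ∀ j, Fst n q (E n j) (f j) = f j) :
    bpF n q (sv n q f) = f := by
  funext j
  rw [bpF_apply, sv]
  cases q with
  | zero => rw [bp_tm0, h1]
  | succ q =>
    have h2 : bpF n q f = 0 := h
    have h3 : bp n q (f j) = 0 := by rw [← bpF_apply, h2, Pi.zero_apply]
    rw [bp_tm, h3, map_zero, sub_zero, h1]

/-! ### the double complex indexed by `p` -/

noncomputable def eps (p : ℕ) : ℂ := (-1) ^ ((p + 1) / 3)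

theorem eps_sq (p : ℕ) : eps p * eps p = 1 := by
  unfold eps
  rw [← mul_pow]; simp

theorem eps_zero : eps 0 = 1 := by simp [eps]

theorem eps_a {p : ℕ} (h : p % 3 = 0) : eps (p + 2) = - eps p := by
  unfold eps
  rw [show (p + 2 + 1) / 3 = (p + 1) / 3 + 1 by omega, pow_succ]; ring
theorem eps_b {p : ℕ} (h : p % 3 = 2) : eps (p + 1) = eps p := by
  unfold eps
  rw [show (p + 1 + 1) / 3 = (p + 1) / 3 by omega]

noncomputable def sh (n p : ℕ) : ℤ := ((p / 3 : ℕ) : ℤ) * (2 * n + 1) + ((p % 3 : ℕ) : ℤ)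

theorem sh_1 {n p : ℕ} (h : p % 3 ≠ 2) : sh n (p + 1) = sh n p + 1 := by
  unfold sh
  rw [show (p + 1) / 3 = p / 3 by omega, show (p + 1) % 3 = p % 3 + 1 by omega]; push_cast; ring
theorem sh_2 {n p : ℕ} (h : p % 3 = 2) : sh n (p + 1) = sh n p + (2 * n - 1) := by
  unfold sh
  rw [show (p + 1) / 3 = p / 3 + 1 by omega, show (p + 1) % 3 = 0 by omega, h]; push_cast; ring

noncomputable def XR (n p q : ℕ) : Submodule ℂ (CF n q) :=
  if p % 3 = 1 then XE n q else XV n q (eps p)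
noncomputable def XX (n p q : ℕ) (d : ℤ) : Submodule ℂ (CF n q) := XR n p q ⊓ XG n q (d - sh n p)

noncomputable def dh (n q p : ℕ) : CF n q →ₗ[ℂ] CF n q :=
  if p % 3 = 0 then D1 n q (eps p) else if p % 3 = 1 then D2 n q else D3 n q

theorem XR_E {n p q : ℕ} (h : p % 3 = 1) : XR n p q = XE n q := by rw [XR, if_pos h]
theorem XR_V {n p q : ℕ} (h : p % 3 ≠ 1) : XR n p q = XV n q (eps p) := by rw [XR, if_neg h]
theorem dh_0 {n p q : ℕ} (h : p % 3 = 0) : dh n q p = D1 n q (eps p) := by rw [dh, if_pos h]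
theorem dh_1 {n p q : ℕ} (h : p % 3 = 1) : dh n q p = D2 n q := by
  rw [dh, if_neg (by omega), if_pos h]
theorem dh_2 {n p q : ℕ} (h : p % 3 = 2) : dh n q p = D3 n q := by
  rw [dh, if_neg (by omega), if_neg (by omega)]

theorem mod3 (p : ℕ) : p % 3 = 0 ∨ p % 3 = 1 ∨ p % 3 = 2 := by omega

theorem dh_XX {n p q : ℕ} {d : ℤ} {f : CF n q} (h : f ∈ XX n (p + 1) q d) :
    dh n q p f ∈ XX n p q d := by
  obtain ⟨h1, h2⟩ := h
  rcases mod3 p with c | c | c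
  · rw [XR_E (by omega)] at h1
    rw [sh_1 (by omega)] at h2
    refine ⟨?_, ?_⟩
    · rw [XR_V (by omega), dh_0 c]; exact D1_XV (eps_sq p) h1
    · rw [dh_0 c]
      have := D1_XG (ε := eps p) h2
      rwa [show d - (sh n p + 1) + 1 = d - sh n p by ring] at this
  · rw [XR_V (by omega)] at h1
    rw [sh_1 (by omega)] at h2
    refine ⟨?_, ?_⟩
    · rw [XR_E (by omega), dh_1 c]; exact D2_XE h1
    · rw [dh_1 c]
      have := D2_XG h2
      rwa [show d - (sh n p + 1) + 1 = d - sh n p by ring] at this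
  · rw [XR_V (by omega)] at h1
    rw [sh_2 (by omega)] at h2
    refine ⟨?_, ?_⟩
    · rw [XR_V (by omega), dh_2 c]
      rw [eps_b c] at h1
      exact D3_XV (eps_sq p) h1
    · rw [dh_2 c]
      have := D3_XG h2
      rwa [show d - (sh n p + (2 * n - 1)) + (2 * n - 1) = d - sh n p by ring] at this

theorem dh_dh {n p q : ℕ} {d : ℤ} {f : CF n q} (h : f ∈ XX n (p + 2) q d) :
    dh n q p (dh n q (p + 1) f) = 0 := by
  obtain ⟨h1, h2⟩ := h
  rcases mod3 p with c | c | c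
  · rw [XR_V (by omega), eps_a c] at h1
    rw [dh_0 c, dh_1 (by omega), D1_D2 (eps_sq p) h1]
  · rw [dh_1 c, dh_2 (by omega), D2_D3]
  · rw [dh_2 c, dh_0 (by omega), D3_D1]

theorem pjF_XX {n p q : ℕ} (d : ℤ) {f : CF n q} (h : f ∈ XR n p q) :
    pjF n q (d - sh n p) f ∈ XX n p q d := by
  refine ⟨?_, pjF_XG _ _⟩
  unfold XR at h ⊢
  split_ifs at h ⊢
  · exact pjF_XE _ h
  · exact pjF_XV _ h

theorem pjF_dh {n p q : ℕ} (d : ℤ) (f : CF n q) :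
    pjF n q (d - sh n p) (dh n q p f) = dh n q p (pjF n q (d - sh n (p + 1)) f) := by
  rcases mod3 p with c | c | c
  · rw [dh_0 c, sh_1 (by omega), ← pjF_D1]; congr 1; ring
  · rw [dh_1 c, sh_1 (by omega), ← pjF_D2]; congr 1; ring
  · rw [dh_2 c, sh_2 (by omega), ← pjF_D3]; congr 1; ring

theorem dh_lift {n p q : ℕ} {d : ℤ} {f : CF n q} (h : f ∈ XX n p q d)
    (h' : ∃ g ∈ XR n (p + 1) q, dh n q p g = f) : ∃ g ∈ XX n (p + 1) q d, dh n q p g = f := by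
  obtain ⟨g, hg, e⟩ := h'
  refine ⟨_, pjF_XX d hg, ?_⟩
  rw [← pjF_dh, e, pjF_self h.2]

theorem dh_exact {n p q : ℕ} {d : ℤ} {f : CF n (q + 1)} (h : f ∈ XX n (p + 1) (q + 1) d)
    (h' : dh n (q + 1) p f = 0) : ∃ g ∈ XX n (p + 2) (q + 1) d, dh n (q + 1) (p + 1) g = f := by
  apply dh_lift h
  obtain ⟨h1, h2⟩ := h
  rcases mod3 p with c | c | c
  · rw [XR_E (by omega)] at h1
    rw [dh_0 c] at h'
    rw [dh_1 (by omega), XR_V (by omega), show p + 1 + 1 = p + 2 by ring, eps_a c]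
    exact exact_D1 (eps_sq p) h1 h'
  · rw [XR_V (by omega)] at h1
    rw [dh_1 c] at h'
    rw [dh_2 (by omega), XR_V (by omega), eps_b (p := p + 1) (by omega)]
    exact exact_D2 (eps_sq (p + 1)) h1 h'
  · rw [XR_V (by omega)] at h1
    rw [dh_2 c] at h'
    rw [dh_0 (by omega), XR_E (by omega)]
    exact exact_D3 (eps_sq _) h1 h'

theorem aug_exact {n q : ℕ} {d : ℤ} {f : CF n (q + 1)} (h : f ∈ XX n 0 (q + 1) d)
    (h' : aug n q f = 0) : ∃ g ∈ XX n 1 (q + 1) d, dh n (q + 1) 0 g = f := by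
  apply dh_lift h
  obtain ⟨h1, h2⟩ := h
  rw [XR_V (by omega), eps_zero] at h1
  rw [dh_0 (by omega), XR_E (by omega), eps_zero]
  exact exact_aug h1 h'

theorem sh_zero (n : ℕ) : sh n 0 = 0 := by simp [sh]

theorem aug_onto {n q d : ℕ} {z : Ch n q} (h : z ∈ chDeg n q d) :
    ∃ f ∈ XX n 0 (q + 1) d, aug n q f = z := by
  obtain ⟨f, hf, e⟩ := aug_surj z
  refine ⟨pjF n (q + 1) ((d : ℤ) - sh n 0) f, pjF_XX _ ?_, ?_⟩
  · rw [XR_V (by omega), eps_zero]; exact hf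
  · rw [sh_zero, sub_zero, ← pj_aug, e, pj_self (mem_chDeg.mp h)]

theorem aug_chDeg {n q d : ℕ} {f : CF n (q + 1)} (h : f ∈ XX n 0 (q + 1) d) :
    aug n q f ∈ chDeg n q d := by
  rw [mem_chDeg]
  apply phc_aug
  have := h.2
  rwa [sh_zero, sub_zero] at this

theorem aug_dh {n q : ℕ} (f : CF n (q + 1)) : aug n q (dh n (q + 1) 0 f) = 0 := by
  rw [dh_0 (by omega), eps_zero, aug_D1]

theorem bpF_XX {n p q : ℕ} {d : ℤ} {f : CF n (q + 1)} (h : f ∈ XX n p (q + 1) d) :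
    bpF n q f ∈ XX n p q d := by
  refine ⟨?_, bpF_XG h.2⟩
  have h1 := h.1
  unfold XR at h1 ⊢
  split_ifs at h1 ⊢
  · exact bpF_XE h1
  · exact bpF_XV h1

theorem bpF_dh {n p q : ℕ} (f : CF n (q + 1)) : bpF n q (dh n (q + 1) p f) = dh n q p (bpF n q f) := by
  unfold dh
  split_ifs
  · exact bpF_D1 _ _
  · exact bpF_D2 _
  · exact bpF_D3 _

theorem XX_Fst {n p q : ℕ} {d : ℤ} {f : CF n q} (h : f ∈ XX n p q d) (j : ℤ) :
    Fst n q (E n j) (f j) = f j := by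
  have h1 := h.1
  unfold XR at h1
  split_ifs at h1
  · exact (h1 j).1
  · exact (h1 j).1

theorem col_exact {n p q : ℕ} {d : ℤ} {f : CF n q} (h : f ∈ XX n p q d) (h' : f ∈ Zv n q) :
    ∃ g ∈ XX n p (q + 1) d, bpF n q g = f := by
  refine ⟨sv n q f, ⟨?_, sv_XG h.2⟩, bpF_sv h' (XX_Fst h)⟩
  have h1 := h.1
  unfold XR at h1 ⊢
  split_ifs at h1 ⊢
  · exact sv_XE h1
  · exact sv_XV h1

/-! ### subquotient dimensions -/

noncomputable def fr {V : Type*} [AddCommGroup V] [Module ℂ V] (Z B : Submodule ℂ V) : ℕ :=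
  Module.finrank ℂ (Z ⧸ Submodule.comap Z.subtype B)

theorem fr_map {V W : Type*} [AddCommGroup V] [Module ℂ V] [AddCommGroup W] [Module ℂ W]
    (φ : V →ₗ[ℂ] W) (Y : Submodule ℂ V) (B : Submodule ℂ W) :
    fr (Submodule.map φ Y) B = fr Y (Submodule.comap φ B) := by
  unfold fr
  let ψ : Y →ₗ[ℂ] Submodule.map φ Y := φ.submoduleMap Y
  have hψ : Function.Surjective ψ := φ.submoduleMap_surjective Y
  let χ := (Submodule.mkQ (Submodule.comap (Submodule.map φ Y).subtype B)) ∘ₗ ψ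
  have hχ : Function.Surjective χ := (Submodule.mkQ_surjective _).comp hψ
  have hk : LinearMap.ker χ = Submodule.comap Y.subtype (Submodule.comap φ B) := by
    ext x
    simp only [χ, ψ, LinearMap.mem_ker, LinearMap.comp_apply, Submodule.mkQ_apply,
      Submodule.Quotient.mk_eq_zero, Submodule.mem_comap]
    rfl
  rw [← hk]
  exact (LinearEquiv.finrank_eq (χ.quotKerEquivOfSurjective hχ)).symm

theorem fr_congr {V : Type*} [AddCommGroup V] [Module ℂ V] {Z B B' : Submodule ℂ V}
    (h : ∀ x ∈ Z, x ∈ B ↔ x ∈ B') : fr Z B = fr Z B' := by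
  unfold fr
  have : Submodule.comap Z.subtype B = Submodule.comap Z.subtype B' := by
    ext x
    exact h x.1 x.2
  rw [this]

theorem sal {V W U : Type*} [AddCommGroup V] [Module ℂ V] [AddCommGroup W] [Module ℂ W]
    [AddCommGroup U] [Module ℂ U] {X : Submodule ℂ V} {α : V →ₗ[ℂ] W} {β : V →ₗ[ℂ] U}
    {Z1 B1 : Submodule ℂ W} {Z2 B2 : Submodule ℂ U}
    (hZ : ∀ x ∈ X, α x ∈ Z1 ↔ β x ∈ Z2) (hB : ∀ x ∈ X, α x ∈ B1 ↔ β x ∈ B2)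
    (h1 : ∀ z ∈ Z1, ∃ x ∈ X, α x = z) (h2 : ∀ z ∈ Z2, ∃ x ∈ X, β x = z) : fr Z1 B1 = fr Z2 B2 := by
  set Y : Submodule ℂ V := X ⊓ Submodule.comap α Z1 with hY
  have e1 : Z1 = Submodule.map α Y := by
    apply le_antisymm
    · intro z hz
      obtain ⟨x, hx, rfl⟩ := h1 z hz
      exact ⟨x, ⟨hx, hz⟩, rfl⟩
    · rintro _ ⟨x, hx, rfl⟩
      exact hx.2
  have e2 : Z2 = Submodule.map β Y := by
    apply le_antisymm
    · intro z hz
      obtain ⟨x, hx, rfl⟩ := h2 z hz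
      exact ⟨x, ⟨hx, (hZ x hx).2 hz⟩, rfl⟩
    · rintro _ ⟨x, hx, rfl⟩
      exact (hZ x hx.1).1 hx.2
  rw [e1, e2, fr_map, fr_map]
  apply fr_congr
  intro x hx
  exact hB x hx.1

theorem finrank_map_fr {V W : Type*} [AddCommGroup V] [Module ℂ V] [AddCommGroup W] [Module ℂ W]
    (φ : V →ₗ[ℂ] W) (Y : Submodule ℂ V) :
    Module.finrank ℂ (Submodule.map φ Y) = fr Y (LinearMap.ker φ) := by
  have := fr_map φ Y ⊥
  rw [← Submodule.comap_bot] 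
  rw [← this]
  unfold fr
  have hb : Submodule.comap (Submodule.map φ Y).subtype ⊥ = ⊥ := by
    rw [Submodule.comap_bot, Submodule.ker_subtype]
  rw [hb]
  exact (LinearEquiv.finrank_eq (Submodule.quotEquivOfEqBot _ rfl)).symm

theorem HH_fr (n m d : ℕ) : Module.finrank ℂ (HHhoDeg n m d) =
    fr (hcyc n m ⊓ chDeg n m d) (hbnd n m) := by
  unfold HHhoDeg
  rw [finrank_map_fr, Submodule.ker_mkQ, ← fr_map, Submodule.map_comap_subtype]

/-! ### the staircase -/

noncomputable def Zh (n : ℕ) : (p q : ℕ) → Submodule ℂ (CF n q)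
  | 0, 0 => ⊤
  | 0, (q + 1) => LinearMap.ker (aug n q)
  | (p + 1), q => LinearMap.ker (dh n q p)

noncomputable def ZZ (n p q : ℕ) (d : ℤ) : Submodule ℂ (CF n q) := XX n p q d ⊓ (Zh n p q ⊓ Zv n q)
noncomputable def BB (n p q : ℕ) (d : ℤ) : Submodule ℂ (CF n q) :=
  Submodule.map (bpF n q) (Submodule.map (dh n (q + 1) p) (XX n (p + 1) (q + 1) d))

theorem bpF_Zv {n q : ℕ} (f : CF n (q + 1)) : bpF n q f ∈ Zv n q := by
  cases q with
  | zero => trivial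
  | succ q => exact bpF_bpF f

theorem dh_Zh {n p q : ℕ} {d : ℤ} {f : CF n (q + 1)} (h : f ∈ XX n (p + 1) (q + 1) d) :
    dh n (q + 1) p f ∈ Zh n p (q + 1) := by
  cases p with
  | zero => exact aug_dh f
  | succ p => exact dh_dh h

theorem Zh_lift {n p q : ℕ} {d : ℤ} {f : CF n (q + 1)} (h : f ∈ XX n p (q + 1) d)
    (h' : f ∈ Zh n p (q + 1)) : ∃ g ∈ XX n (p + 1) (q + 1) d, dh n (q + 1) p g = f := by
  cases p with
  | zero => exact aug_exact h h'
  | succ p => exact dh_exact h h'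

theorem stair (n p q : ℕ) (d : ℤ) : fr (ZZ n p (q + 1) d) (BB n p (q + 1) d) =
    fr (ZZ n (p + 1) q d) (BB n (p + 1) q d) := by
  apply sal (X := XX n (p + 1) (q + 1) d) (α := dh n (q + 1) p) (β := bpF n q)
  · intro x hx
    constructor
    · rintro ⟨h1, h2, h3⟩
      refine ⟨bpF_XX hx, ?_, bpF_Zv x⟩
      have h4 : bpF n q (dh n (q + 1) p x) = 0 := h3
      show dh n q p (bpF n q x) = 0
      rw [← bpF_dh, h4]
    · rintro ⟨h1, h2, h3⟩
      refine ⟨dh_XX hx, dh_Zh hx, ?_⟩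
      have h4 : dh n q p (bpF n q x) = 0 := h2
      show bpF n q (dh n (q + 1) p x) = 0
      rw [bpF_dh, h4]
  · intro x hx
    constructor
    · rintro ⟨_, ⟨w, hw, rfl⟩, e⟩
      rw [bpF_dh, eq_comm, ← sub_eq_zero, ← map_sub] at e
      obtain ⟨v, hv, e'⟩ := dh_exact (sub_mem hx (bpF_XX hw)) e
      refine ⟨_, ⟨v, hv, rfl⟩, ?_⟩
      rw [e', map_sub, bpF_bpF, sub_zero]
    · rintro ⟨_, ⟨w, hw, rfl⟩, e⟩
      rw [eq_comm, ← sub_eq_zero, ← map_sub] at e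
      obtain ⟨v, hv, e'⟩ := col_exact (q := q + 1) (sub_mem hx (dh_XX hw)) e
      refine ⟨_, ⟨v, hv, rfl⟩, ?_⟩
      rw [bpF_dh, e', map_sub, dh_dh hw, sub_zero]
  · rintro z ⟨h1, h2, h3⟩
    exact Zh_lift h1 h2
  · rintro z ⟨h1, h2, h3⟩
    exact col_exact h1 h3

theorem stair0 (n m d : ℕ) : fr (hcyc n m ⊓ chDeg n m d) (hbnd n m) =
    fr (ZZ n 0 m d) (BB n 0 m d) := by
  apply sal (X := XX n 0 (m + 1) d) (α := aug n m) (β := bpF n m)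
  · intro x hx
    cases m with
    | zero =>
      constructor
      · intro _; exact ⟨bpF_XX hx, trivial, trivial⟩
      · intro _; exact ⟨trivial, aug_chDeg hx⟩
    | succ m =>
      constructor
      · rintro ⟨h1, h2⟩
        have h3 : bmap n m (aug n (m + 1) x) = 0 := h1
        rw [bmap_aug] at h3
        exact ⟨bpF_XX hx, h3, bpF_Zv x⟩
      · rintro ⟨h1, h2, h3⟩
        refine ⟨?_, aug_chDeg hx⟩
        have h3 : aug n m (bpF n (m + 1) x) = 0 := h2
        show bmap n m (aug n (m + 1) x) = 0
        rw [bmap_aug, h3]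
  · intro x hx
    constructor
    · rintro ⟨y, e⟩
      have hy : bmap n m (pj n (m + 1) d y) = aug n m x := by
        have := pj_comm (bmap n m) 0 (by intro x; rw [phc_bmap, zpow_zero, one_smul]) d y
        rw [← this, add_zero, e, pj_self (mem_chDeg.mp (aug_chDeg hx))]
      obtain ⟨g, hg, e'⟩ := aug_onto (mem_chDeg.mpr (phc_pj (d : ℤ) y))
      rw [← e', bmap_aug, eq_comm, ← sub_eq_zero, ← map_sub] at hy
      obtain ⟨v, hv, e'⟩ := aug_exact (sub_mem hx (bpF_XX hg)) hy
      refine ⟨_, ⟨v, hv, rfl⟩, ?_⟩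
      rw [e', map_sub, bpF_bpF, sub_zero]
    · rintro ⟨_, ⟨w, hw, rfl⟩, e⟩
      rw [eq_comm, ← sub_eq_zero, ← map_sub] at e
      obtain ⟨v, hv, e'⟩ := col_exact (q := m + 1) (sub_mem hx (dh_XX hw)) e
      refine ⟨aug n (m + 1) v, ?_⟩
      rw [bmap_aug, e', map_sub, aug_dh, sub_zero]
  · rintro z ⟨h1, h2⟩
    exact aug_onto h2
  · rintro z ⟨h1, h2, h3⟩
    exact col_exact h1 h3

theorem stair_all (n p q : ℕ) (d : ℤ) : fr (ZZ n 0 (q + p) d) (BB n 0 (q + p) d) =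
    fr (ZZ n p q d) (BB n p q d) := by
  induction p generalizing q with
  | zero => rfl
  | succ p ih =>
    rw [← stair, ← ih, show q + (p + 1) = q + 1 + p by ring]

noncomputable def BR (n p : ℕ) (d : ℤ) : Submodule ℂ (CF n 0) :=
  Submodule.map (dh n 0 p) (XX n (p + 1) 0 d)
noncomputable def ZR (n p : ℕ) (d : ℤ) : Submodule ℂ (CF n 0) := XX n p 0 d ⊓ Zh n p 0

/-- The main reduction. -/
theorem HH_red (n m d : ℕ) : Module.finrank ℂ (HHhoDeg n m d) = fr (ZR n m d) (BR n m d) := by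
  rw [HH_fr, stair0]
  have := stair_all n m 0 d
  rw [zero_add] at this
  rw [this]
  have e1 : ZZ n m 0 d = ZR n m d := by
    unfold ZZ ZR
    show _ ⊓ (_ ⊓ ⊤) = _
    rw [inf_top_eq]
  have e2 : BB n m 0 d = BR n m d := by
    apply le_antisymm
    · rintro _ ⟨_, ⟨w, hw, rfl⟩, rfl⟩
      exact ⟨bpF n 0 w, bpF_XX hw, (bpF_dh w).symm⟩
    · rintro _ ⟨w, hw, rfl⟩
      obtain ⟨v, hv, e⟩ := col_exact (q := 0) hw trivial
      refine ⟨_, ⟨v, hv, rfl⟩, ?_⟩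
      rw [bpF_dh, e]
  rw [e1, e2]

end TPre

namespace TPre

/-! ### the bottom row: coordinates -/

theorem co_phi {n : ℕ} (k p q : ℤ) (a : PiT n) : co n k p q (phi n a) = (2 : ℂ) ^ (p + q) * co n k p q a := by
  by_cases h : Sval n k p q
  · refine A_lin_ext (n := n) (f := co n k p q ∘ₗ (phi n).toLinearMap)
      (g := (2 : ℂ) ^ (p + q) • co n k p q) ?_ a
    intro k' p' q' h'
    rw [LinearMap.comp_apply, AlgHom.toLinearMap_apply, phi_mm, map_smul, LinearMap.smul_apply, co_mm h h']
    split_ifs with c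
    · obtain ⟨rfl, rfl, rfl⟩ := c; rfl
    · simp
  · rw [co_bad h]; simp

theorem two_zpow_inj {a b : ℤ} (h : (2 : ℂ) ^ a = (2 : ℂ) ^ b) : a = b := by
  have h1 : ((2 : ℝ) ^ a) = (2 : ℝ) ^ b := by
    have := congrArg norm h
    simpa [norm_zpow] using this
  exact zpow_right_injective₀ (by norm_num) (by norm_num) h1

theorem uniq_aux {n : ℕ} {i k p q : ℤ} (hk : k ≤ n) (ht : k + p - q = i ∨ k + p - q = 2 * n + 1 - i)
    {a : PiT n} (h1 : E n i * a = a) (h2 : a * E n k = a)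
    (h3 : phi n a = (2 : ℂ) ^ (p + q) • a) : ∃ c : ℂ, a = c • mm n k p q := by
  have e : a = ∑ s : S n, co n s.1.1 s.1.2.1 s.1.2.2 a •
      (E n i * (mm n s.1.1 s.1.2.1 s.1.2.2 * E n k)) := by
    conv_lhs => rw [← h1, ← h2, ← sum_co a]
    rw [Finset.sum_mul, Finset.mul_sum]
    simp only [smul_mul_assoc, mul_smul_comm]
  have hm : a ∈ Submodule.span ℂ {mm n k p q} := by
    rw [e]
    apply Submodule.sum_mem
    rintro ⟨⟨k', p', q'⟩, hs⟩ _
    have hs1 : 1 ≤ k' ∧ k' ≤ n ∧ 0 ≤ q' ∧ q' < k' ∧ 0 ≤ p' ∧ p' ≤ 2 * n - k' := hs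
    simp only
    rw [mm_E]
    split_ifs with c1
    · rw [E_mm]
      split_ifs with c2
      · by_cases c3 : p' + q' = p + q
        · have e1 : k' = k := by omega
          have e2 : p' = p := by omega
          have e3 : q' = q := by omega
          rw [e1, e2, e3]
          exact Submodule.smul_mem _ _ (Submodule.mem_span_singleton_self _)
        · have : co n k' p' q' a = 0 := by
            have h4 := co_phi k' p' q' a
            rw [h3, map_smul, smul_eq_mul] at h4
            by_contra hne
            exact c3 (two_zpow_inj (mul_right_cancel₀ hne h4)).symm
          rw [this, zero_smul]; exact Submodule.zero_mem _
      · rw [smul_zero]; exact Submodule.zero_mem _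
    · rw [mul_zero, smul_zero]; exact Submodule.zero_mem _
  obtain ⟨c, hc⟩ := Submodule.mem_span_singleton.mp hm
  exact ⟨c, hc.symm⟩

theorem uniq {n : ℕ} {i k p q : ℤ} (ht : k + p - q = i ∨ k + p - q = 2 * n + 1 - i)
    {a : PiT n} (h1 : E n i * a = a) (h2 : a * E n k = a)
    (h3 : phi n a = (2 : ℂ) ^ (p + q) • a) : ∃ c : ℂ, a = c • mm n k p q := by
  by_cases hk : k ≤ n
  · exact uniq_aux hk ht h1 h2 h3
  · rw [← mm_sigma]
    refine uniq_aux (by omega) (by omega) h1 ?_ ?_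
    · rw [E_sigma, h2]
    · rw [h3, add_comm]

theorem mm_ne {n : ℕ} {k p q : ℤ} (h : 1 ≤ k ∧ k ≤ 2 * n ∧ 0 ≤ q ∧ q < k ∧ 0 ≤ p ∧ p ≤ 2 * n - k) :
    mm n k p q ≠ 0 := by
  have key : ∀ {k p q : ℤ}, Sval n k p q → mm n k p q ≠ 0 := by
    intro k p q hs h0
    have := co_mm hs hs
    rw [h0, map_zero, if_pos ⟨rfl, rfl, rfl⟩] at this
    exact zero_ne_one this
  by_cases hk : k ≤ n
  · exact key ⟨h.1, hk, h.2.2.1, h.2.2.2.1, h.2.2.2.2.1, h.2.2.2.2.2⟩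
  · rw [← mm_sigma]
    apply key
    show 1 ≤ 2 * (n : ℤ) + 1 - k ∧ 2 * (n : ℤ) + 1 - k ≤ n ∧ 0 ≤ p ∧ p < 2 * (n : ℤ) + 1 - k ∧
      0 ≤ q ∧ q ≤ 2 * n - (2 * (n : ℤ) + 1 - k)
    omega

noncomputable def mkc {n : ℕ} (z : ℤ → PiT n) (c : ℤ → ℂ) : CF n 0 := fun j => c j • c0 n (z j)

theorem mkc_apply {n : ℕ} (z : ℤ → PiT n) (c : ℤ → ℂ) (j : ℤ) : mkc z c j = c j • c0 n (z j) := rfl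

theorem mkc_sub {n : ℕ} (z : ℤ → PiT n) (c c' : ℤ → ℂ) : mkc z (c - c') = mkc z c - mkc z c' := by
  funext j; simp only [mkc, Pi.sub_apply, sub_smul]
theorem mkc_smul {n : ℕ} (z : ℤ → PiT n) (a : ℂ) (c : ℤ → ℂ) : mkc z (a • c) = a • mkc z c := by
  funext j; simp only [mkc, Pi.smul_apply, smul_eq_mul, mul_smul]

/-- A family of spanning elements: `z j` spans the part of degree `δ` in `E_j A E_{j+s}`. -/
structure GM (n : ℕ) (s : ℤ) (z : ℤ → PiT n) (δ : ℤ) (I : ℤ → Prop) : Prop where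
  hz : ∀ j, ¬ I j → z j = 0
  hn : ∀ j, I j → z j ≠ 0
  h1 : ∀ j, E n j * z j = z j
  h2 : ∀ j, z j * E n (j + s) = z j
  h3 : ∀ j, phi n (z j) = (2 : ℂ) ^ δ • z j
  hu : ∀ j a, E n j * a = a → a * E n (j + s) = a → phi n a = (2 : ℂ) ^ δ • a → ∃ c : ℂ, a = c • z j

theorem GM.ext {n : ℕ} {s : ℤ} {z : ℤ → PiT n} {δ : ℤ} {I : ℤ → Prop} (H : GM n s z δ I)
    {c c' : ℤ → ℂ} (h : ∀ j, I j → c j = c' j) : mkc z c = mkc z c' := by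
  funext j
  rw [mkc_apply, mkc_apply]
  by_cases hj : I j
  · rw [h j hj]
  · rw [H.hz j hj, map_zero, smul_zero, smul_zero]

theorem GM.inj {n : ℕ} {s : ℤ} {z : ℤ → PiT n} {δ : ℤ} {I : ℤ → Prop} (H : GM n s z δ I)
    {c c' : ℤ → ℂ} (h : mkc z c = mkc z c') {j : ℤ} (hj : I j) : c j = c' j := by
  have := congrFun h j
  rw [mkc_apply, mkc_apply] at this
  have h' : c j • z j = c' j • z j := c0_inj (by rw [map_smul, map_smul]; exact this)
  exact smul_left_injective ℂ (H.hn j hj) h'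

theorem GM.rep {n : ℕ} {s : ℤ} {z : ℤ → PiT n} {δ : ℤ} {I : ℤ → Prop} (H : GM n s z δ I)
    {f : CF n 0} (h1 : ∀ j, Fst n 0 (E n j) (f j) = f j) (h2 : ∀ j, Lst n 0 (E n (j + s)) (f j) = f j)
    (h3 : f ∈ XG n 0 δ) : ∃ c : ℤ → ℂ, (∀ j, ¬ I j → c j = 0) ∧ mkc z c = f := by
  have : ∀ j, ∃ c : ℂ, (¬ I j → c = 0) ∧ c • c0 n (z j) = f j := by
    intro j
    obtain ⟨a, ha⟩ := c0_surj (f j)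
    have e1 := h1 j
    have e2 := h2 j
    have e3 := h3 j
    rw [← ha, Fst_c0] at e1
    rw [← ha, Lst_c0] at e2
    rw [← ha, phc_c0, ← map_smul] at e3
    obtain ⟨c, hc⟩ := H.hu j a (c0_inj e1) (c0_inj e2) (c0_inj e3)
    by_cases hj : I j
    · exact ⟨c, fun h => absurd hj h, by rw [← ha, hc, map_smul]⟩
    · refine ⟨0, fun _ => rfl, ?_⟩
      rw [← ha, hc, H.hz j hj, map_smul, map_zero]; simp
  choose c hc using this
  exact ⟨c, fun j => (hc j).1, funext fun j => (hc j).2⟩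

theorem GM.mkG {n : ℕ} {s : ℤ} {z : ℤ → PiT n} {δ : ℤ} {I : ℤ → Prop} (H : GM n s z δ I)
    (c : ℤ → ℂ) : mkc z c ∈ XG n 0 δ := by
  intro j
  rw [mkc_apply, map_smul, phc_c0, H.h3, map_smul, smul_comm]

theorem GM.mk1 {n : ℕ} {s : ℤ} {z : ℤ → PiT n} {δ : ℤ} {I : ℤ → Prop} (H : GM n s z δ I)
    (c : ℤ → ℂ) (j : ℤ) : Fst n 0 (E n j) (mkc z c j) = mkc z c j := by
  rw [mkc_apply, map_smul, Fst_c0, H.h1]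
theorem GM.mk2 {n : ℕ} {s : ℤ} {z : ℤ → PiT n} {δ : ℤ} {I : ℤ → Prop} (H : GM n s z δ I)
    (c : ℤ → ℂ) (j : ℤ) : Lst n 0 (E n (j + s)) (mkc z c j) = mkc z c j := by
  rw [mkc_apply, map_smul, Lst_c0, H.h2]

/-- symmetric version for vertices -/
structure GV (n : ℕ) (z : ℤ → PiT n) (δ : ℤ) (I : ℤ → Prop) : Prop extends GM n 0 z δ I where
  hs : ∀ j, z (2 * n + 1 - j) = z j
  hI : ∀ j, I j → I (2 * n + 1 - j)
  hb : ∀ j, I j → 1 ≤ j ∧ j ≤ 2 * n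

theorem GV.repV {n : ℕ} {z : ℤ → PiT n} {δ : ℤ} {I : ℤ → Prop} (H : GV n z δ I) {ε : ℂ}
    {f : CF n 0} (h : f ∈ XV n 0 ε ⊓ XG n 0 δ) :
    ∃ c : ℤ → ℂ, (∀ j, ¬ I j → c j = 0) ∧ (∀ j, c (2 * n + 1 - j) = ε * c j) ∧ mkc z c = f := by
  obtain ⟨c, h1, h2⟩ := H.toGM.rep (fun j => (h.1 j).1)
    (fun j => by rw [add_zero]; exact (h.1 j).2.1) h.2
  refine ⟨c, h1, ?_, h2⟩
  intro j
  by_cases hj : I j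
  · have h3 := (h.1 j).2.2
    rw [← h2, mkc_apply, mkc_apply, H.hs, smul_smul] at h3
    have h' : c (2 * n + 1 - j) • z j = (ε * c j) • z j :=
      c0_inj (by rw [map_smul, map_smul]; exact h3)
    exact smul_left_injective ℂ (H.hn j hj) h'
  · rw [h1 j hj, h1, mul_zero]
    intro hc
    have := H.hI _ hc
    rw [show 2 * (n : ℤ) + 1 - (2 * n + 1 - j) = j by ring] at this
    exact hj this

theorem GV.mkV {n : ℕ} {z : ℤ → PiT n} {δ : ℤ} {I : ℤ → Prop} (H : GV n z δ I) {ε : ℂ}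
    {c : ℤ → ℂ} (h : ∀ j, I j → c (2 * n + 1 - j) = ε * c j) : mkc z c ∈ XV n 0 ε ⊓ XG n 0 δ := by
  refine ⟨fun j => ⟨H.toGM.mk1 c j, ?_, ?_⟩, H.toGM.mkG c⟩
  · have := H.toGM.mk2 c j
    rwa [add_zero] at this
  · rw [mkc_apply, mkc_apply, H.hs, smul_smul]
    by_cases hj : I j
    · rw [h j hj]
    · rw [H.hz j hj, map_zero, smul_zero, smul_zero]

theorem GM.repE {n : ℕ} {z : ℤ → PiT n} {δ : ℤ} {I : ℤ → Prop} (H : GM n 1 z δ I)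
    {f : CF n 0} (h : f ∈ XE n 0 ⊓ XG n 0 δ) :
    ∃ c : ℤ → ℂ, (∀ j, ¬ I j → c j = 0) ∧ mkc z c = f :=
  H.rep (fun j => (h.1 j).1) (fun j => (h.1 j).2) h.2

theorem GM.mkE {n : ℕ} {z : ℤ → PiT n} {δ : ℤ} {I : ℤ → Prop} (H : GM n 1 z δ I)
    (c : ℤ → ℂ) : mkc z c ∈ XE n 0 ⊓ XG n 0 δ :=
  ⟨fun j => ⟨H.mk1 c j, H.mk2 c j⟩, H.mkG c⟩

/-! the models -/

noncomputable def zVe (n : ℕ) (b : ℤ) (j : ℤ) : PiT n := mm n j b b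
noncomputable def zVo (n : ℕ) (b : ℤ) (j : ℤ) : PiT n := mm n j (2 * n + 1 - b - j) (j - b)
noncomputable def zEe (n : ℕ) (b : ℤ) (j : ℤ) : PiT n := mm n (j + 1) (b - 1) b
noncomputable def zEo (n : ℕ) (b : ℤ) (j : ℤ) : PiT n := mm n (j + 1) (2 * n - b - j) (j - b)
def IVe (n : ℕ) (b : ℤ) (j : ℤ) : Prop := 0 ≤ b ∧ b + 1 ≤ j ∧ j ≤ 2 * n - b
def IVo (n : ℕ) (b : ℤ) (j : ℤ) : Prop := 1 ≤ b ∧ b ≤ j ∧ j ≤ 2 * n + 1 - b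
def IE (n : ℕ) (b : ℤ) (j : ℤ) : Prop := 1 ≤ b ∧ b ≤ j ∧ j ≤ 2 * n - b

theorem gVe (n : ℕ) (b : ℤ) : GV n (zVe n b) (2 * b) (IVe n b) := by
  refine ⟨⟨?_, ?_, ?_, ?_, ?_, ?_⟩, ?_, ?_, ?_⟩ <;> intro j <;> (try unfold zVe) <;> (try unfold IVe)
  · intro h; apply mm_bad; omega
  · intro h; apply mm_ne; omega
  · rw [E_mm, if_pos (by omega)]
  · rw [mm_E, if_pos (by omega)]
  · rw [phi_mm]; congr 2; ring
  · intro a h1 h2 h3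
    apply uniq (i := j) (by omega) h1 (by rwa [add_zero] at h2)
    rw [h3]; congr 2; ring
  · rw [mm_sigma]
  · omega
  · omega

theorem gVo (n : ℕ) (b : ℤ) : GV n (zVo n b) (2 * n + 1 - 2 * b) (IVo n b) := by
  refine ⟨⟨?_, ?_, ?_, ?_, ?_, ?_⟩, ?_, ?_, ?_⟩ <;> intro j <;> (try unfold zVo) <;> (try unfold IVo)
  · intro h; apply mm_bad; omega
  · intro h; apply mm_ne; omega
  · rw [E_mm, if_pos (by omega)]
  · rw [mm_E, if_pos (by omega)]
  · rw [phi_mm]; congr 2; ring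
  · intro a h1 h2 h3
    apply uniq (i := j) (by omega) h1 (by rwa [add_zero] at h2)
    rw [h3]; congr 2; ring
  · rw [← mm_sigma j]; congr 1 <;> ring
  · omega
  · omega

theorem gEe (n : ℕ) (b : ℤ) : GM n 1 (zEe n b) (2 * b - 1) (IE n b) := by
  refine ⟨?_, ?_, ?_, ?_, ?_, ?_⟩ <;> intro j <;> unfold zEe <;> try unfold IE
  · intro h; apply mm_bad; omega
  · intro h; apply mm_ne; omega
  · rw [E_mm, if_pos (by omega)]
  · rw [mm_E, if_pos (by omega)]
  · rw [phi_mm]; congr 2; ring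
  · intro a h1 h2 h3
    apply uniq (i := j) (by omega) h1 h2
    rw [h3]; congr 2; ring

theorem gEo (n : ℕ) (b : ℤ) : GM n 1 (zEo n b) (2 * n - 2 * b) (IE n b) := by
  refine ⟨?_, ?_, ?_, ?_, ?_, ?_⟩ <;> intro j <;> unfold zEo <;> try unfold IE
  · intro h; apply mm_bad; omega
  · intro h; apply mm_ne; omega
  · rw [E_mm, if_pos (by omega)]
  · rw [mm_E, if_pos (by omega)]
  · rw [phi_mm]; congr 2; ring
  · intro a h1 h2 h3
    apply uniq (i := j) (by omega) h1 h2
    rw [h3]; congr 2; ring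

/-- compatibility of an edge model with a target vertex model -/
structure LK (n : ℕ) (ze zv : ℤ → PiT n) (I : ℤ → Prop) : Prop where
  a : ∀ j, I j → ze j * xi n j = zv j
  b : ∀ j, I j → xi n j * ze j = zv (j + 1)

structure LK2 (n : ℕ) (zy ze : ℤ → PiT n) : Prop where
  a : ∀ j, zy j * xi n (2 * n - j) = ze j
  b : ∀ j, xi n (2 * n - j) * zy (j + 1) = ze j

theorem lke (n : ℕ) (b : ℤ) : LK n (zEe n b) (zVe n b) (IE n b) := by
  refine ⟨?_, ?_⟩ <;> intro j h <;> unfold IE at h <;> unfold zEe zVe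
  · have := mm_xi (n := n) (k := j + 1) (p := b - 1) (q := b) (by omega)
    rw [show j + 1 - 1 = j by ring, show b - 1 + 1 = b by ring] at this
    exact this
  · have := xi_mm (n := n) (k := j + 1) (p := b - 1) (q := b) (by omega)
    rw [show j + 1 + (b - 1) - b = j by ring, show b - 1 + 1 = b by ring] at this
    exact this

theorem lko (n : ℕ) (b : ℤ) : LK n (zEo n b) (zVo n b) (IE n b) := by
  refine ⟨?_, ?_⟩ <;> intro j h <;> unfold IE at h <;> unfold zEo zVo
  · have := mm_xi (n := n) (k := j + 1) (p := 2 * n - b - j) (q := j - b) (by omega)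
    rw [show j + 1 - 1 = j by ring, show 2 * (n : ℤ) - b - j + 1 = 2 * n + 1 - b - j by ring] at this
    exact this
  · have := eta_mm (n := n) (k := j + 1) (p := 2 * n - b - j) (q := j - b) (by omega)
    rw [show 2 * (n : ℤ) + 1 - (j + 1 + (2 * n - b - j) - (j - b)) = j by ring,
      show 2 * (n : ℤ) - b - j = 2 * n + 1 - b - (j + 1) by ring,
      show j - b + 1 = j + 1 - b by ring] at this
    rw [← this]; congr 2; ring

theorem lk2e (n : ℕ) (b : ℤ) : LK2 n (zVe n (b - 1)) (zEe n b) := by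
  refine ⟨?_, ?_⟩ <;> intro j <;> unfold zEe zVe <;> by_cases h : 1 ≤ b
  · have := mm_eta (n := n) (k := j) (p := b - 1) (q := b - 1) (by omega)
    rw [show b - 1 + 1 = b by ring] at this
    exact this
  · rw [mm_bad (by omega), mm_bad (by omega), zero_mul]
  · have := eta_mm (n := n) (k := j + 1) (p := b - 1) (q := b - 1) (by omega)
    rw [show 2 * (n : ℤ) + 1 - (j + 1 + (b - 1) - (b - 1)) = 2 * n - j by ring,
      show b - 1 + 1 = b by ring] at this
    exact this
  · rw [mm_bad (by omega), mm_bad (by omega), mul_zero]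

theorem lk2o_a {n : ℕ} {b j : ℤ} (hj : b + 1 ≤ j) :
    zVo n (b + 1) j * xi n (2 * n - j) = zEo n b j := by
  unfold zEo zVo
  have := mm_eta (n := n) (k := j) (p := 2 * n + 1 - (b + 1) - j) (q := j - (b + 1)) (by omega)
  rw [this]; congr 1 <;> ring

theorem lk2o_b {n : ℕ} {b j : ℤ} (hj : j + 1 ≤ 2 * n - b) :
    xi n (2 * n - j) * zVo n (b + 1) (j + 1) = zEo n b j := by
  unfold zEo zVo
  have := xi_mm (n := n) (k := j + 1) (p := 2 * n + 1 - (b + 1) - (j + 1)) (q := j + 1 - (b + 1)) (by omega)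
  rw [show j + 1 + (2 * (n : ℤ) + 1 - (b + 1) - (j + 1)) - (j + 1 - (b + 1)) = 2 * n - j by ring] at this
  rw [this]; congr 1 <;> ring

end TPre

namespace TPre

/-! ### scalar lemmas -/

theorem const_on {w : ℤ → ℂ} {a e : ℤ} (h : ∀ j, a ≤ j → j < e → w (j + 1) = w j) :
    ∀ j, a ≤ j → j ≤ e → w j = w a := by
  intro j hj
  induction j, hj using Int.le_induction with
  | base => intro _; rfl
  | succ j hj ih => intro h'; rw [h j hj (by omega), ih (by omega)]

theorem tele_Icc (w : ℤ → ℂ) {a e : ℤ} (h : a - 1 ≤ e) :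
    ∑ j ∈ Finset.Icc a e, (w j - w (j - 1)) = w e - w (a - 1) := by
  induction e, h using Int.le_induction with
  | base => rw [Finset.Icc_eq_empty (by omega)]; simp
  | succ e he ih =>
    have : Finset.Icc a (e + 1) = insert (e + 1) (Finset.Icc a e) := by
      ext x; simp only [Finset.mem_Icc, Finset.mem_insert]; omega
    rw [this, Finset.sum_insert (by simp), ih, show e + 1 - 1 = e by ring]; ring

noncomputable def ps (lo hi : ℤ) (u : ℤ → ℂ) (j : ℤ) : ℂ :=
  (∑ i ∈ Finset.Icc lo hi, if i ≤ j then u i else - u i) / 2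

theorem ps_diff {lo hi : ℤ} {u : ℤ → ℂ} (h : ∀ j, ¬ (lo ≤ j ∧ j ≤ hi) → u j = 0) (j : ℤ) :
    ps lo hi u j - ps lo hi u (j - 1) = u j := by
  unfold ps
  rw [← sub_div, ← Finset.sum_sub_distrib]
  have : ∀ i ∈ Finset.Icc lo hi, ((if i ≤ j then u i else - u i) - (if i ≤ j - 1 then u i else - u i))
      = if i = j then 2 * u i else 0 := by
    intro i _
    split_ifs <;> first | omega | ring
  rw [Finset.sum_congr rfl this, Finset.sum_ite_eq']
  split_ifs with c
  · ring
  · rw [h j (by simpa using c)]; simp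

theorem ps_sym {lo hi N : ℤ} {u : ℤ → ℂ} {η : ℂ} (hN : lo + hi = N) (h : ∀ j, u (N - j) = η * u j) (j : ℤ) :
    ps lo hi u (N - 1 - j) = - η * ps lo hi u j := by
  unfold ps
  rw [mul_div_assoc', Finset.mul_sum]
  congr 1
  refine Finset.sum_bij' (fun i _ => N - i) (fun i _ => N - i) ?_ ?_ ?_ ?_ ?_
  · intro i hi; simp only [Finset.mem_Icc] at hi ⊢; omega
  · intro i hi; simp only [Finset.mem_Icc] at hi ⊢; omega
  · intro i _; ring
  · intro i _; ring
  · intro i _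
    have e : u i = η * u (N - i) := by rw [← h]; congr 1; ring
    by_cases c : i ≤ N - 1 - j
    · rw [if_pos c, if_neg (by omega), e]; ring
    · rw [if_neg c, if_pos (by omega), e]; ring

theorem ps_lo {lo hi : ℤ} {u : ℤ → ℂ} (h : ∑ i ∈ Finset.Icc lo hi, u i = 0) {j : ℤ} (hj : j < lo) :
    ps lo hi u j = 0 := by
  unfold ps
  rw [Finset.sum_congr rfl (g := fun i => - u i)]
  · rw [Finset.sum_neg_distrib, h]; simp
  · intro i hi; rw [Finset.mem_Icc] at hi; rw [if_neg (by omega)]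

theorem ps_hi {lo hi : ℤ} {u : ℤ → ℂ} (h : ∑ i ∈ Finset.Icc lo hi, u i = 0) {j : ℤ} (hj : hi ≤ j) :
    ps lo hi u j = 0 := by
  unfold ps
  rw [Finset.sum_congr rfl (g := fun i => u i)]
  · rw [h]; simp
  · intro i hi; rw [Finset.mem_Icc] at hi; rw [if_pos (by omega)]

theorem tot_anti {lo hi N : ℤ} {u : ℤ → ℂ} (hN : lo + hi = N) (h : ∀ j, u (N - j) = - u j) :
    ∑ i ∈ Finset.Icc lo hi, u i = 0 := by
  have : ∑ i ∈ Finset.Icc lo hi, u i = ∑ i ∈ Finset.Icc lo hi, - u i := by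
    refine Finset.sum_bij' (fun i _ => N - i) (fun i _ => N - i) ?_ ?_ ?_ ?_ ?_
    · intro i hi; simp only [Finset.mem_Icc] at hi ⊢; omega
    · intro i hi; simp only [Finset.mem_Icc] at hi ⊢; omega
    · intro i _; ring
    · intro i _; ring
    · intro i _; rw [h]; ring
  rw [Finset.sum_neg_distrib] at this
  exact self_eq_neg.mp this

/-! ### `fr` lemmas -/

theorem fr_zero {V : Type*} [AddCommGroup V] [Module ℂ V] {Z B : Submodule ℂ V} (h : ∀ z ∈ Z, z ∈ B) :
    fr Z B = 0 := by
  unfold fr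
  have : Submodule.comap Z.subtype B = ⊤ := by
    ext x; simp only [Submodule.mem_top, iff_true]; exact h x.1 x.2
  rw [this]
  exact Module.finrank_zero_of_subsingleton

theorem fr_one {V : Type*} [AddCommGroup V] [Module ℂ V] {Z B : Submodule ℂ V} (x : V) (hx : x ∈ Z)
    (hb : x ∉ B) (h : ∀ z ∈ Z, ∃ c : ℂ, z - c • x ∈ B) : fr Z B = 1 := by
  unfold fr
  refine finrank_eq_one (Submodule.Quotient.mk ⟨x, hx⟩) ?_ ?_
  · rw [Ne, Submodule.Quotient.mk_eq_zero]; exact hb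
  · intro w
    obtain ⟨⟨z, hz⟩, rfl⟩ := Submodule.Quotient.mk_surjective _ w
    obtain ⟨c, hc⟩ := h z hz
    refine ⟨c, ?_⟩
    rw [← Submodule.Quotient.mk_smul, eq_comm, Submodule.Quotient.eq]
    exact hc

theorem fr_bot {V : Type*} [AddCommGroup V] [Module ℂ V] {Z B : Submodule ℂ V} (h : ∀ b ∈ B, b = 0) :
    fr Z B = Module.finrank ℂ Z := by
  unfold fr
  have : Submodule.comap Z.subtype B = ⊥ := by
    rw [eq_bot_iff]
    intro x hx
    exact Subtype.ext (h x.1 hx)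
  rw [this]
  exact LinearEquiv.finrank_eq (Submodule.quotEquivOfEqBot _ rfl)

/-! ### differentials in coordinates -/

theorem D1_mkc {n : ℕ} {ze zv : ℤ → PiT n} {I : ℤ → Prop} (H : LK n ze zv I)
    (hs : ∀ j, zv (2 * n + 1 - j) = zv j) (ε : ℂ) {g : ℤ → ℂ} (hg : ∀ j, ¬ I j → g j = 0) :
    D1 n 0 ε (mkc ze g) =
      mkc zv (fun j => g j - g (j - 1) + ε * (g (2 * n + 1 - j) - g (2 * n - j))) := by
  have h1 : ∀ j, Lst n 0 (xi n j) (mkc ze g j) = g j • c0 n (zv j) := by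
    intro j
    rw [mkc_apply, map_smul, Lst_c0]
    by_cases hj : I j
    · rw [H.a j hj]
    · rw [hg j hj, zero_smul, zero_smul]
  have h2 : ∀ j, Fst n 0 (xi n j) (mkc ze g j) = g j • c0 n (zv (j + 1)) := by
    intro j
    rw [mkc_apply, map_smul, Fst_c0]
    by_cases hj : I j
    · rw [H.b j hj]
    · rw [hg j hj, zero_smul, zero_smul]
  funext j
  rw [D1_apply, h1, h2, h1, h2, mkc_apply, hs, show j - 1 + 1 = j by ring,
    show 2 * (n : ℤ) - j + 1 = 2 * n + 1 - j by ring, hs, ← sub_smul, ← sub_smul, smul_smul, ← add_smul]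

theorem D2_mkc {n : ℕ} {zy ze : ℤ → PiT n} {c : ℤ → ℂ}
    (ha : ∀ j, c j ≠ 0 → zy j * xi n (2 * n - j) = ze j)
    (hb : ∀ j, c (j + 1) ≠ 0 → xi n (2 * n - j) * zy (j + 1) = ze j) :
    D2 n 0 (mkc zy c) = mkc ze (fun j => c j - c (j + 1)) := by
  funext j
  rw [D2_apply, mkc_apply, mkc_apply, mkc_apply, map_smul, map_smul, Lst_c0, Fst_c0, sub_smul]
  congr 1
  · by_cases h : c j = 0
    · rw [h, zero_smul, zero_smul]
    · rw [ha j h]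
  · by_cases h : c (j + 1) = 0
    · rw [h, zero_smul, zero_smul]
    · rw [hb j h]

theorem D2_even {n : ℕ} (b : ℤ) (c : ℤ → ℂ) :
    D2 n 0 (mkc (zVe n (b - 1)) c) = mkc (zEe n b) (fun j => c j - c (j + 1)) :=
  D2_mkc (fun j _ => (lk2e n b).a j) (fun j _ => (lk2e n b).b j)

theorem D2_odd {n : ℕ} {b : ℤ} {c : ℤ → ℂ} (h : ∀ j, ¬ IVo n (b + 1) j → c j = 0) :
    D2 n 0 (mkc (zVo n (b + 1)) c) = mkc (zEo n b) (fun j => c j - c (j + 1)) := by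
  refine D2_mkc (fun j hj => ?_) (fun j hj => ?_)
  · apply lk2o_a
    have : IVo n (b + 1) j := by by_contra hc; exact hj (h j hc)
    exact this.2.1
  · apply lk2o_b
    have : IVo n (b + 1) (j + 1) := by by_contra hc; exact hj (h _ hc)
    have := this.2.2; omega

noncomputable def VV (n : ℕ) (ε : ℂ) (δ : ℤ) : Submodule ℂ (CF n 0) := XV n 0 ε ⊓ XG n 0 δ
noncomputable def EE (n : ℕ) (δ : ℤ) : Submodule ℂ (CF n 0) := XE n 0 ⊓ XG n 0 δ

theorem par (n : ℕ) (δ : ℤ) : (∃ b : ℤ, δ = 2 * b) ∨ ∃ b : ℤ, δ = 2 * n + 1 - 2 * b := by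
  rcases Int.even_or_odd' δ with ⟨k, hk | hk⟩
  · exact Or.inl ⟨k, hk⟩
  · exact Or.inr ⟨n - k, by omega⟩

theorem mkc_zero' {n : ℕ} {z : ℤ → PiT n} {c : ℤ → ℂ} (h : ∀ j, c j = 0) : mkc z c = 0 := by
  funext j; rw [mkc_apply, h, zero_smul]; rfl

theorem VV_zero {n : ℕ} {ε : ℂ} {δ : ℤ} (h : δ < 0 ∨ 2 * n - 1 < δ) {f} (hf : f ∈ VV n ε δ) : f = 0 := by
  rcases par n δ with ⟨b, rfl⟩ | ⟨b, rfl⟩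
  · obtain ⟨c, h1, -, rfl⟩ := (gVe n b).repV hf
    apply mkc_zero'
    intro j; apply h1; unfold IVe; omega
  · obtain ⟨c, h1, -, rfl⟩ := (gVo n b).repV hf
    apply mkc_zero'
    intro j; apply h1; unfold IVo; omega

theorem EE_zero {n : ℕ} {δ : ℤ} (h : δ < 0 ∨ 2 * n - 1 < δ) {f} (hf : f ∈ EE n δ) : f = 0 := by
  rcases par n (δ + 1) with ⟨b, hb⟩ | ⟨b, hb⟩
  · obtain rfl : δ = 2 * b - 1 := by omega
    obtain ⟨c, h1, rfl⟩ := (gEe n b).repE hf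
    apply mkc_zero'
    intro j; apply h1; unfold IE; omega
  · obtain rfl : δ = 2 * n - 2 * b := by omega
    obtain ⟨c, h1, rfl⟩ := (gEo n b).repE hf
    apply mkc_zero'
    intro j; apply h1; unfold IE; omega

theorem D3_zero {n : ℕ} {ε : ℂ} (hε : ε * ε = 1) {δ : ℤ} (h : δ ≠ 0) {f} (hf : f ∈ VV n ε δ) : D3 n 0 f = 0 := by
  rcases lt_or_gt_of_ne h with h | h
  · rw [VV_zero (Or.inl h) hf, map_zero]
  · have : D3 n 0 f ∈ VV n ε (δ + (2 * n - 1)) := ⟨D3_XV hε hf.1, D3_XG hf.2⟩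
    exact VV_zero (Or.inr (by omega)) this

end TPre

namespace TPre

theorem wdim_pos {n : ℕ} {d : ℤ} (b : ℤ) (h : d = 2 * b) (h0 : 0 ≤ b) (h1 : b < n) : wdim n d = 1 := by
  unfold wdim; rw [if_pos]; exact ⟨⟨b, by omega⟩, by omega, by omega⟩
theorem wdim_neg {n : ℕ} {d : ℤ} (h : ∀ b : ℤ, d = 2 * b → 0 ≤ b → b < n → False) : wdim n d = 0 := by
  unfold wdim; rw [if_neg]; rintro ⟨⟨b, hb⟩, h0, h1⟩; exact h b (by omega) (by omega) (by omega)

open Classical in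
theorem D1_solve {n : ℕ} {ze zv : ℤ → PiT n} {I IV : ℤ → Prop} {δ δe : ℤ} {ε : ℂ} (hε : ε * ε = 1)
    (H : LK n ze zv I) (GE : GM n 1 ze δe I) (GG : GV n zv δ IV) (hI : ∀ j, I j → I (2 * n - j))
    {P c : ℤ → ℂ} (hP : ∀ j, P j - P (j - 1) = c j) (hPs : ∀ j, P (2 * n - j) = - ε * P j)
    (h1 : ∀ j, IV j → (I j ∨ P j = 0) ∧ (I (j - 1) ∨ P (j - 1) = 0)) :
    mkc zv c ∈ Submodule.map (D1 n 0 ε) (EE n δe) := by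
  have hI' : ∀ j, ¬ I j → ¬ I (2 * n - j) := by
    intro j hj hc
    have := hI _ hc
    rw [show 2 * (n : ℤ) - (2 * n - j) = j by ring] at this
    exact hj this
  have key : ∀ i, (I i ∨ P i = 0) → (if I i then P i / 2 else 0) -
      ε * (if I (2 * n - i) then P (2 * n - i) / 2 else 0) = P i := by
    intro i hi
    by_cases hc : I i
    · rw [if_pos hc, if_pos (hI i hc), hPs]
      linear_combination (P i / 2) * hε
    · rw [if_neg hc, if_neg (hI' i hc), hi.resolve_left hc]; ring
  refine ⟨mkc ze (fun i => if I i then P i / 2 else 0), GE.mkE _, ?_⟩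
  rw [D1_mkc H GG.hs ε (fun j hj => if_neg hj)]
  apply GG.toGM.ext
  intro j hj
  have k1 := key j (h1 j hj).1
  have k2 := key (j - 1) (h1 j hj).2
  rw [show 2 * (n : ℤ) - (j - 1) = 2 * n + 1 - j by ring] at k2
  linear_combination k1 - k2 + hP j

theorem IE_sym {n : ℕ} {b j : ℤ} (h : IE n b j) : IE n b (2 * n - j) := by
  unfold IE at *; omega

theorem T0_even {n : ℕ} {b : ℤ} (hb : b ≠ 0) {ε : ℂ} (hε : ε * ε = 1) {z} (hz : z ∈ VV n ε (2 * b)) :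
    z ∈ Submodule.map (D1 n 0 ε) (EE n (2 * b - 1)) := by
  obtain ⟨c, h1, h2, rfl⟩ := (gVe n b).repV hz
  refine D1_solve hε (lke n b) (gEe n b) (gVe n b) (fun j => IE_sym) (P := ps 1 (2 * n) c)
    (ps_diff ?_) ?_ ?_
  · intro j hj; apply h1; unfold IVe; omega
  · intro j
    have := ps_sym (lo := 1) (hi := 2 * n) (N := 2 * n + 1) (by ring) h2 j
    rwa [show 2 * (n : ℤ) + 1 - 1 - j = 2 * n - j by ring] at this
  · intro j hj
    unfold IVe at hj; unfold IE
    constructor <;> left <;> omega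

theorem T0_odd {n : ℕ} {b : ℤ} {ε : ℂ} (hε : ε * ε = 1) {c : ℤ → ℂ} (h1 : ∀ j, ¬ IVo n b j → c j = 0)
    (h2 : ∀ j, c (2 * n + 1 - j) = ε * c j) (ht : ∑ i ∈ Finset.Icc b (2 * n + 1 - b), c i = 0) :
    mkc (zVo n b) c ∈ Submodule.map (D1 n 0 ε) (EE n (2 * n - 2 * b)) := by
  refine D1_solve hε (lko n b) (gEo n b) (gVo n b) (fun j => IE_sym) (P := ps b (2 * n + 1 - b) c)
    (ps_diff ?_) ?_ ?_
  · intro j hj; apply h1; unfold IVo; omega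
  · intro j
    have := ps_sym (lo := b) (hi := 2 * n + 1 - b) (N := 2 * n + 1) (by ring) h2 j
    rwa [show 2 * (n : ℤ) + 1 - 1 - j = 2 * n - j by ring] at this
  · intro j hj
    unfold IVo at hj; unfold IE
    constructor
    · by_cases hc : j ≤ 2 * n - b
      · left; omega
      · right; exact ps_hi ht (by omega)
    · by_cases hc : b ≤ j - 1
      · left; omega
      · right; exact ps_lo ht (by omega)

theorem T0m {n : ℕ} {δ : ℤ} (hδ : δ ≠ 0) :
    fr (VV n (-1) δ) (Submodule.map (D1 n 0 (-1)) (EE n (δ - 1))) = 0 := by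
  apply fr_zero
  intro z hz
  rcases par n δ with ⟨b, rfl⟩ | ⟨b, rfl⟩
  · exact T0_even (by omega) (by norm_num) hz
  · obtain ⟨c, h1, h2, rfl⟩ := (gVo n b).repV hz
    rw [show 2 * (n : ℤ) + 1 - 2 * b - 1 = 2 * n - 2 * b by ring]
    refine T0_odd (by norm_num) h1 h2 (tot_anti (N := 2 * n + 1) (by ring) ?_)
    intro j; rw [h2]; ring

theorem T0p {n : ℕ} {δ : ℤ} (hδ : δ ≠ 0) :
    fr (VV n 1 δ) (Submodule.map (D1 n 0 1) (EE n (δ - 1))) = wdim n (2 * n - 1 - δ) := by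
  rcases par n δ with ⟨b, rfl⟩ | ⟨b, rfl⟩
  · rw [wdim_neg (by intros; omega)]
    apply fr_zero
    intro z hz
    exact T0_even (by omega) (by norm_num) hz
  · by_cases hb : 1 ≤ b ∧ b ≤ n
    · rw [wdim_pos (b - 1) (by ring) (by omega) (by omega)]
      rw [show 2 * (n : ℤ) + 1 - 2 * b - 1 = 2 * n - 2 * b by ring]
      set x : ℤ → ℂ := fun j => (if j = b then 1 else 0) + (if j = 2 * n + 1 - b then 1 else 0) with hx
      have xs : ∀ j, ¬ IVo n b j → x j = 0 := by
        intro j hj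
        unfold IVo at hj
        simp only [hx]
        rw [if_neg (by omega), if_neg (by omega)]; simp
      have xsym : ∀ j, x (2 * n + 1 - j) = 1 * x j := by
        intro j
        simp only [hx]
        split_ifs <;> first | omega | ring
      have xt : ∑ i ∈ Finset.Icc b (2 * n + 1 - b), x i = 2 := by
        simp only [hx]
        rw [Finset.sum_add_distrib, Finset.sum_ite_eq', Finset.sum_ite_eq', if_pos, if_pos]
        · norm_num
        · rw [Finset.mem_Icc]; omega
        · rw [Finset.mem_Icc]; omega
      refine fr_one (mkc (zVo n b) x) ((gVo n b).mkV fun j _ => xsym j) ?_ ?_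
      · rintro ⟨f, hf, e⟩
        obtain ⟨g, hg, rfl⟩ := (gEo n b).repE hf
        rw [D1_mkc (lko n b) (gVo n b).hs 1 hg] at e
        have e1 : ∑ i ∈ Finset.Icc b (2 * n + 1 - b), x i =
            ∑ i ∈ Finset.Icc b (2 * n + 1 - b), ((fun i => g i - g (2 * n - i)) i -
              (fun i => g i - g (2 * n - i)) (i - 1)) := by
          apply Finset.sum_congr rfl
          intro i hi
          rw [Finset.mem_Icc] at hi
          have := (gVo n b).toGM.inj e (j := i) (by unfold IVo; omega)
          rw [← this]
          simp only
          rw [show 2 * (n : ℤ) - (i - 1) = 2 * n + 1 - i by ring]; ring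
        rw [xt, tele_Icc _ (by omega)] at e1
        rw [hg _ (by unfold IE; omega), hg _ (by unfold IE; omega), hg _ (by unfold IE; omega),
          hg _ (by unfold IE; omega)] at e1
        norm_num at e1
      · intro z hz
        obtain ⟨c, h1, h2, rfl⟩ := (gVo n b).repV hz
        refine ⟨(∑ i ∈ Finset.Icc b (2 * n + 1 - b), c i) / 2, ?_⟩
        rw [← mkc_smul, ← mkc_sub]
        apply T0_odd (by norm_num)
        · intro j hj
          simp only [Pi.sub_apply, Pi.smul_apply, smul_eq_mul]
          rw [h1 j hj, xs j hj]; ring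
        · intro j
          simp only [Pi.sub_apply, Pi.smul_apply, smul_eq_mul]
          rw [h2 j, xsym j]; ring
        · simp only [Pi.sub_apply, Pi.smul_apply, smul_eq_mul]
          rw [Finset.sum_sub_distrib, ← Finset.mul_sum, xt]; ring
    · rw [wdim_neg (by intros; omega)]
      apply fr_zero
      intro z hz
      rw [VV_zero (by omega) hz]; exact Submodule.zero_mem _

/-! ### T1 -/

theorem D2_solve_e {n : ℕ} {b : ℤ} {η : ℂ} {g : ℤ → ℂ} (hg : ∀ j, ¬ IE n b j → g j = 0)
    (hs : ∀ j, g (2 * n - j) = η * g j) :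
    mkc (zEe n b) g ∈ Submodule.map (D2 n 0) (VV n (-η) (2 * b - 1 - 1)) := by
  refine ⟨mkc (zVe n (b - 1)) (fun j => - ps 0 (2 * n) g (j - 1)), ?_, ?_⟩
  · have := (gVe n (b - 1)).mkV (ε := -η) (c := fun j => - ps 0 (2 * n) g (j - 1)) ?_
    · rwa [show 2 * (b - 1) = 2 * b - 1 - 1 by ring] at this
    · intro j _
      have := ps_sym (lo := 0) (hi := 2 * n) (N := 2 * n) (by ring) hs (j - 1)
      rw [show 2 * (n : ℤ) - 1 - (j - 1) = 2 * n + 1 - j - 1 by ring] at this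
      rw [this]; ring
  · rw [D2_even]
    congr 1
    funext j
    rw [show j + 1 - 1 = j by ring, ← ps_diff (lo := 0) (hi := 2 * n) (u := g) ?_ j]
    · ring
    · intro j hj; apply hg; unfold IE; omega

theorem D2_solve_o {n : ℕ} {b : ℤ} {η : ℂ} {g : ℤ → ℂ} (hg : ∀ j, ¬ IE n b j → g j = 0)
    (hs : ∀ j, g (2 * n - j) = η * g j) (ht : ∑ i ∈ Finset.Icc b (2 * n - b), g i = 0) :
    mkc (zEo n b) g ∈ Submodule.map (D2 n 0) (VV n (-η) (2 * n - 2 * b - 1)) := by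
  by_cases hb : 1 ≤ b
  · refine ⟨mkc (zVo n (b + 1)) (fun j => - ps b (2 * n - b) g (j - 1)), ?_, ?_⟩
    · have := (gVo n (b + 1)).mkV (ε := -η) (c := fun j => - ps b (2 * n - b) g (j - 1)) ?_
      · rwa [show 2 * (n : ℤ) + 1 - 2 * (b + 1) = 2 * n - 2 * b - 1 by ring] at this
      · intro j _
        have := ps_sym (lo := b) (hi := 2 * n - b) (N := 2 * n) (by ring) hs (j - 1)
        rw [show 2 * (n : ℤ) - 1 - (j - 1) = 2 * n + 1 - j - 1 by ring] at this
        rw [this]; ring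
    · rw [D2_odd]
      · congr 1
        funext j
        rw [show j + 1 - 1 = j by ring, ← ps_diff (lo := b) (hi := 2 * n - b) (u := g) ?_ j]
        · ring
        · intro j hj; apply hg; unfold IE; omega
      · intro j hj
        unfold IVo at hj
        by_cases hc : j - 1 < b
        · rw [ps_lo ht hc, neg_zero]
        · rw [ps_hi ht (by omega), neg_zero]
  · rw [mkc_zero' (fun j => hg j (by unfold IE; omega))]
    exact Submodule.zero_mem _

/-- elements of the kernel of `D1` -/
theorem ker_even {n : ℕ} {b : ℤ} {ε : ℂ} {g : ℤ → ℂ} (hb : b ≤ n) (hg : ∀ j, ¬ IE n b j → g j = 0)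
    (h : D1 n 0 ε (mkc (zEe n b) g) = 0) {j : ℤ} (hj : IE n b j) :
    g j - ε * g (2 * n - j) = g n - ε * g n := by
  rw [D1_mkc (lke n b) (gVe n b).hs ε hg, ← mkc_zero' (z := zVe n b) (c := 0) (fun j => rfl)] at h
  have hw := const_on (w := fun j => g j - ε * g (2 * n - j)) (a := b) (e := 2 * n - b) ?_
  · have h1 := hw j hj.2.1 hj.2.2
    have h2 := hw n hb (by omega)
    rw [h1, ← h2, show 2 * (n : ℤ) - n = n by ring]
  · intro i h1 h2
    have h3 := (gVe n b).toGM.inj h (j := i + 1) (by unfold IVe IE at *; omega)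
    simp only [Pi.zero_apply] at h3 ⊢
    rw [show i + 1 - 1 = i by ring, show 2 * (n : ℤ) + 1 - (i + 1) = 2 * n - i by ring] at h3
    rw [← sub_eq_zero, ← h3]; ring

theorem ker_odd {n : ℕ} {b : ℤ} {ε : ℂ} {g : ℤ → ℂ} (hg : ∀ j, ¬ IE n b j → g j = 0)
    (h : D1 n 0 ε (mkc (zEo n b) g) = 0) (j : ℤ) : g j = ε * g (2 * n - j) := by
  by_cases hj : IE n b j
  · rw [D1_mkc (lko n b) (gVo n b).hs ε hg, ← mkc_zero' (z := zVo n b) (c := 0) (fun j => rfl)] at h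
    have hw := const_on (w := fun j => g j - ε * g (2 * n - j)) (a := b - 1) (e := 2 * n + 1 - b) ?_
    · unfold IE at hj
      have h1 := hw j (by omega) (by omega)
      rw [hg (b - 1) (by unfold IE; omega), hg (2 * n - (b - 1)) (by unfold IE; omega)] at h1
      rw [← sub_eq_zero, h1]; ring
    · intro i h1 h2
      have h3 := (gVo n b).toGM.inj h (j := i + 1) (by unfold IVo IE at *; omega)
      simp only [Pi.zero_apply] at h3 ⊢
      rw [show i + 1 - 1 = i by ring, show 2 * (n : ℤ) + 1 - (i + 1) = 2 * n - i by ring] at h3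
      rw [← sub_eq_zero, ← h3]; ring
  · rw [hg j hj, hg, mul_zero]
    intro hc
    have := IE_sym hc
    rw [show 2 * (n : ℤ) - (2 * n - j) = j by ring] at this
    exact hj this

end TPre

namespace TPre

theorem parE (n : ℕ) (δ : ℤ) : (∃ b : ℤ, δ = 2 * b - 1) ∨ ∃ b : ℤ, δ = 2 * n - 2 * b := by
  rcases par n (δ + 1) with ⟨b, hb⟩ | ⟨b, hb⟩
  · exact Or.inl ⟨b, by omega⟩
  · exact Or.inr ⟨b, by omega⟩

theorem IE_sym' {n : ℕ} {b j : ℤ} (h : ¬ IE n b j) : ¬ IE n b (2 * n - j) := by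
  unfold IE at *; omega

open Classical in
noncomputable def oneE (n : ℕ) (b : ℤ) : ℤ → ℂ := fun j => if IE n b j then 1 else 0

theorem oneE_pos {n : ℕ} {b j : ℤ} (h : IE n b j) : oneE n b j = 1 := by rw [oneE, if_pos h]
theorem oneE_neg {n : ℕ} {b j : ℤ} (h : ¬ IE n b j) : oneE n b j = 0 := by rw [oneE, if_neg h]
theorem oneE_sym (n : ℕ) (b j : ℤ) : oneE n b (2 * n - j) = oneE n b j := by
  by_cases h : IE n b j
  · rw [oneE_pos h, oneE_pos (IE_sym h)]
  · rw [oneE_neg h, oneE_neg (IE_sym' h)]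

theorem T1p {n : ℕ} (δ : ℤ) :
    fr (EE n δ ⊓ LinearMap.ker (D1 n 0 1)) (Submodule.map (D2 n 0) (VV n (-1) (δ - 1))) =
      wdim n (2 * n - 2 - δ) := by
  rcases parE n δ with ⟨b, rfl⟩ | ⟨b, rfl⟩
  · rw [wdim_neg (by intros; omega)]
    apply fr_zero
    rintro z ⟨hz, hk⟩
    by_cases hb : b ≤ n
    · obtain ⟨g, hg, rfl⟩ := (gEe n b).repE hz
      refine D2_solve_e hg ?_
      intro j
      by_cases hj : IE n b j
      · have := ker_even hb hg hk hj
        linear_combination -this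
      · rw [hg j hj, hg _ (IE_sym' hj), mul_zero]
    · rw [EE_zero (by omega) hz]; exact Submodule.zero_mem _
  · by_cases hb : 1 ≤ b ∧ b ≤ n
    · rw [wdim_pos (b - 1) (by ring) (by omega) (by omega)]
      set N : ℂ := ∑ i ∈ Finset.Icc b (2 * n - b), oneE n b i with hN
      have hN0 : N ≠ 0 := by
        have : N = ∑ i ∈ Finset.Icc b (2 * n - b), (1 : ℂ) := by
          apply Finset.sum_congr rfl
          intro i hi
          rw [Finset.mem_Icc] at hi
          exact oneE_pos (by unfold IE; omega)
        rw [this, Finset.sum_const, nsmul_eq_mul, mul_one]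
        have h2 : (Finset.Icc b (2 * (n : ℤ) - b)).Nonempty := ⟨b, by rw [Finset.mem_Icc]; omega⟩
        exact_mod_cast h2.card_pos.ne'
      refine fr_one (mkc (zEo n b) (oneE n b)) ⟨(gEo n b).mkE _, ?_⟩ ?_ ?_
      · show D1 n 0 1 _ = 0
        rw [D1_mkc (lko n b) (gVo n b).hs 1 (fun j => oneE_neg)]
        apply mkc_zero'
        intro j
        have := oneE_sym n b (j - 1)
        rw [show 2 * (n : ℤ) - (j - 1) = 2 * n + 1 - j by ring] at this
        rw [oneE_sym, this]; ring
      · rintro ⟨f, hf, e⟩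
        rw [show 2 * (n : ℤ) - 2 * b - 1 = 2 * n + 1 - 2 * (b + 1) by ring] at hf
        obtain ⟨c, hc, -, rfl⟩ := (gVo n (b + 1)).repV hf
        rw [D2_odd hc] at e
        apply hN0
        have e1 : N = ∑ i ∈ Finset.Icc b (2 * n - b), ((fun i => - c (i + 1)) i -
            (fun i => - c (i + 1)) (i - 1)) := by
          apply Finset.sum_congr rfl
          intro i hi
          rw [Finset.mem_Icc] at hi
          have := (gEo n b).inj e (j := i) (by unfold IE; omega)
          rw [← this]
          simp only
          rw [show i - 1 + 1 = i by ring]; ring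
        rw [e1, tele_Icc _ (by omega), hc _ (by unfold IVo; omega), hc _ (by unfold IVo; omega)]
        ring
      · rintro z ⟨hz, hk⟩
        obtain ⟨g, hg, rfl⟩ := (gEo n b).repE hz
        refine ⟨(∑ i ∈ Finset.Icc b (2 * n - b), g i) / N, ?_⟩
        rw [← mkc_smul, ← mkc_sub]
        have hk' := ker_odd hg hk
        apply D2_solve_o
        · intro j hj
          simp only [Pi.sub_apply, Pi.smul_apply, smul_eq_mul]
          rw [hg j hj, oneE_neg hj]; ring
        · intro j
          simp only [Pi.sub_apply, Pi.smul_apply, smul_eq_mul]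
          rw [oneE_sym, hk' j]; ring
        · simp only [Pi.sub_apply, Pi.smul_apply, smul_eq_mul]
          rw [Finset.sum_sub_distrib, ← Finset.mul_sum, ← hN, div_mul_cancel₀ _ hN0, sub_self]
    · rw [wdim_neg (by intros; omega)]
      apply fr_zero
      rintro z ⟨hz, hk⟩
      have : z = 0 := by
        obtain ⟨g, hg, rfl⟩ := (gEo n b).repE hz
        apply mkc_zero'
        intro j; apply hg; unfold IE; omega
      rw [this]; exact Submodule.zero_mem _

theorem T1m {n : ℕ} (δ : ℤ) :
    fr (EE n δ ⊓ LinearMap.ker (D1 n 0 (-1))) (Submodule.map (D2 n 0) (VV n 1 (δ - 1))) =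
      wdim n (δ - 1) := by
  rcases parE n δ with ⟨b, rfl⟩ | ⟨b, rfl⟩
  · by_cases hb : 1 ≤ b ∧ b ≤ n
    · rw [wdim_pos (b - 1) (by ring) (by omega) (by omega)]
      have hIn : IE n b n := by unfold IE; omega
      refine fr_one (mkc (zEe n b) (oneE n b)) ⟨(gEe n b).mkE _, ?_⟩ ?_ ?_
      · show D1 n 0 (-1) _ = 0
        rw [D1_mkc (lke n b) (gVe n b).hs (-1) (fun j => oneE_neg),
          ← mkc_zero' (z := zVe n b) (c := 0) (fun j => rfl)]
        apply (gVe n b).toGM.ext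
        intro j hj
        unfold IVe at hj
        rw [oneE_pos (by unfold IE; omega), oneE_pos (by unfold IE; omega),
          oneE_pos (by unfold IE; omega), oneE_pos (by unfold IE; omega)]
        simp
      · rintro ⟨f, hf, e⟩
        rw [show 2 * b - 1 - 1 = 2 * (b - 1) by ring] at hf
        obtain ⟨c, hc, hs, rfl⟩ := (gVe n (b - 1)).repV hf
        rw [D2_even] at e
        have h1 := (gEe n b).inj e hIn
        have h2 := hs n
        rw [show 2 * (n : ℤ) + 1 - n = n + 1 by ring] at h2
        rw [oneE_pos hIn, h2] at h1
        simp at h1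
      · rintro z ⟨hz, hk⟩
        obtain ⟨g, hg, rfl⟩ := (gEe n b).repE hz
        refine ⟨g n, ?_⟩
        rw [← mkc_smul, ← mkc_sub]
        have := D2_solve_e (n := n) (b := b) (η := -1) (g := g - g n • oneE n b) ?_ ?_
        · rwa [neg_neg] at this
        · intro j hj
          simp only [Pi.sub_apply, Pi.smul_apply, smul_eq_mul]
          rw [hg j hj, oneE_neg hj]; ring
        · intro j
          simp only [Pi.sub_apply, Pi.smul_apply, smul_eq_mul]
          rw [oneE_sym]
          by_cases hj : IE n b j
          · have := ker_even hb.2 hg hk hj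
            rw [oneE_pos hj]
            linear_combination this
          · rw [hg j hj, hg _ (IE_sym' hj), oneE_neg hj]; ring
    · rw [wdim_neg (by intros; omega)]
      apply fr_zero
      rintro z ⟨hz, hk⟩
      have : z = 0 := by
        obtain ⟨g, hg, rfl⟩ := (gEe n b).repE hz
        apply mkc_zero'
        intro j; apply hg; unfold IE; omega
      rw [this]; exact Submodule.zero_mem _
  · rw [wdim_neg (by intros; omega)]
    apply fr_zero
    rintro z ⟨hz, hk⟩
    obtain ⟨g, hg, rfl⟩ := (gEo n b).repE hz
    have hs : ∀ j, g (2 * n - j) = -1 * g j := by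
      intro j
      have := ker_odd hg hk j
      linear_combination this
    have := D2_solve_o (n := n) (b := b) (η := -1) hg hs
      (tot_anti (N := 2 * n) (by ring) (fun j => by rw [hs]; ring))
    rwa [neg_neg] at this

/-! ### T2 -/

theorem T2_B {n : ℕ} {ε : ℂ} (hε : ε * ε = 1) {δ : ℤ} (hδ : δ ≠ 2 * n - 1) :
    ∀ x ∈ Submodule.map (D3 n 0) (VV n ε (δ - (2 * n - 1))), x = 0 := by
  rintro _ ⟨f, hf, rfl⟩
  exact D3_zero hε (by omega) hf

theorem T2_odd {n : ℕ} {ε : ℂ} {b : ℤ} (hb : b ≠ 0) {z} (hz : z ∈ VV n ε (2 * n + 1 - 2 * (b + 1)))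
    (hk : D2 n 0 z = 0) : z = 0 := by
  obtain ⟨c, hc, hs, rfl⟩ := (gVo n (b + 1)).repV hz
  rw [D2_odd hc, ← mkc_zero' (z := zEo n b) (c := 0) (fun j => rfl)] at hk
  apply mkc_zero'
  intro j
  by_cases hj : IVo n (b + 1) j
  · unfold IVo at hj
    have := const_on (w := c) (a := b) (e := 2 * n - b) ?_ j (by omega) (by omega)
    · rw [this]; apply hc; unfold IVo; omega
    · intro i h1 h2
      have := (gEo n b).inj hk (j := i) (by unfold IE; omega)
      simp only [Pi.zero_apply] at this
      linear_combination -this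
  · exact hc j hj

theorem T2_even {n : ℕ} {c : ℤ → ℂ} {b : ℤ} (hk : D2 n 0 (mkc (zVe n (b - 1)) c) = 0) {j : ℤ}
    (hj : IVe n (b - 1) j) : c j = c n := by
  rw [D2_even, ← mkc_zero' (z := zEe n b) (c := 0) (fun j => rfl)] at hk
  unfold IVe at hj
  have := const_on (w := c) (a := b) (e := 2 * n + 1 - b) ?_
  · rw [this j (by omega) (by omega), this n (by omega) (by omega)]
  · intro i h1 h2
    have := (gEe n b).inj hk (j := i) (by unfold IE; omega)
    simp only [Pi.zero_apply] at this
    linear_combination -this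

theorem par2 (n : ℕ) (δ : ℤ) : (∃ b : ℤ, δ = 2 * (b - 1)) ∨ ∃ b : ℤ, δ = 2 * n + 1 - 2 * (b + 1) := by
  rcases par n δ with ⟨b, hb⟩ | ⟨b, hb⟩
  · exact Or.inl ⟨b + 1, by omega⟩
  · exact Or.inr ⟨b - 1, by omega⟩

theorem T2m {n : ℕ} {δ : ℤ} (hδ : δ ≠ 2 * n - 1) (B : Submodule ℂ (CF n 0)) :
    fr (VV n (-1) δ ⊓ LinearMap.ker (D2 n 0)) B = 0 := by
  apply fr_zero
  rintro z ⟨hz, hk⟩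
  have : z = 0 := by
    rcases par2 n δ with ⟨b, rfl⟩ | ⟨b, rfl⟩
    · obtain ⟨c, hc, hs, rfl⟩ := (gVe n (b - 1)).repV hz
      apply mkc_zero'
      intro j
      by_cases hj : IVe n (b - 1) j
      · have h1 := T2_even hk hj
        have h2 := T2_even hk ((gVe n (b - 1)).hI j hj)
        rw [hs] at h2
        linear_combination (1 / 2) * h1 - (1 / 2) * h2
      · exact hc j hj
    · exact T2_odd (by omega) hz hk
  rw [this]; exact Submodule.zero_mem _

theorem T2p {n : ℕ} {δ : ℤ} (hδ : δ ≠ 2 * n - 1) :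
    fr (VV n 1 δ ⊓ LinearMap.ker (D2 n 0)) (Submodule.map (D3 n 0) (VV n 1 (δ - (2 * n - 1)))) =
      wdim n δ := by
  have hB := T2_B (n := n) (ε := 1) (by norm_num) hδ
  rcases par2 n δ with ⟨b, rfl⟩ | ⟨b, rfl⟩
  · by_cases hb : 1 ≤ b ∧ b ≤ n
    · rw [wdim_pos (b - 1) (by ring) (by omega) (by omega)]
      have hIn : IVe n (b - 1) n := by unfold IVe; omega
      refine fr_one (mkc (zVe n (b - 1)) (fun _ => 1)) ⟨(gVe n (b - 1)).mkV (fun _ _ => by ring), ?_⟩ ?_ ?_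
      · show D2 n 0 _ = 0
        rw [D2_even]
        exact mkc_zero' (fun j => by simp)
      · intro h
        have h0 := hB _ h
        rw [← mkc_zero' (z := zVe n (b - 1)) (c := 0) (fun j => rfl)] at h0
        have := (gVe n (b - 1)).toGM.inj h0 hIn
        simp at this
      · rintro z ⟨hz, hk⟩
        obtain ⟨c, hc, hs, rfl⟩ := (gVe n (b - 1)).repV hz
        refine ⟨c n, ?_⟩
        have : mkc (zVe n (b - 1)) c = c n • mkc (zVe n (b - 1)) (fun _ => 1) := by
          rw [← mkc_smul]
          apply (gVe n (b - 1)).toGM.ext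
          intro j hj
          rw [T2_even hk hj]; simp
        rw [← this, sub_self]
        exact Submodule.zero_mem _
    · rw [wdim_neg (by intros; omega)]
      apply fr_zero
      rintro z ⟨hz, hk⟩
      rw [VV_zero (by omega) hz]; exact Submodule.zero_mem _
  · rw [wdim_neg (by intros; omega)]
    apply fr_zero
    rintro z ⟨hz, hk⟩
    rw [T2_odd (by omega) hz hk]; exact Submodule.zero_mem _

/-! ### dimension of the extreme degrees -/

theorem VV_dim {n : ℕ} {z : ℤ → PiT n} {δ : ℤ} {I : ℤ → Prop} (H : GV n z δ I)
    (hI : ∀ j : ℤ, 1 ≤ j → j ≤ 2 * n → I j) {ε : ℂ} (hε : ε * ε = 1) :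
    Module.finrank ℂ (VV n ε δ) = n := by
  let e : Fin n → ℤ → ℂ := fun i j => (if j = i + 1 then 1 else 0) + ε * (if j = 2 * n - i then 1 else 0)
  have hsum : ∀ v : Fin n → ℂ, ∑ i, v i • mkc z (e i) = mkc z (fun j => ∑ i, v i * e i j) := by
    intro v
    funext j
    simp only [Finset.sum_apply, Pi.smul_apply, mkc_apply, Finset.sum_smul, mul_smul]
  have hval : ∀ (v : Fin n → ℂ) (k : Fin n), ∑ i, v i * e i (k + 1) = v k := by
    intro v k
    rw [Finset.sum_eq_single k]
    · simp only [e]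
      rw [if_pos trivial, if_neg (by have := k.2; omega)]; ring
    · intro i _ hik
      simp only [e]
      have : (i : ℕ) ≠ k := fun h => hik (Fin.ext h)
      rw [if_neg (by omega), if_neg (by have := k.2; have := i.2; omega)]; ring
    · simp
  have hli : LinearIndependent ℂ (fun i => mkc z (e i)) := by
    rw [Fintype.linearIndependent_iff]
    intro v hv k
    rw [hsum, ← mkc_zero' (z := z) (c := 0) (fun j => rfl)] at hv
    have := H.toGM.inj hv (j := k + 1) (hI _ (by omega) (by have := k.2; omega))
    rw [hval] at this
    exact this
  have hsp : VV n ε δ = Submodule.span ℂ (Set.range fun i => mkc z (e i)) := by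
    apply le_antisymm
    · intro f hf
      obtain ⟨c, hc, hs, rfl⟩ := H.repV hf
      have : mkc z c = ∑ i : Fin n, c (i + 1) • mkc z (e i) := by
        rw [hsum]
        apply H.toGM.ext
        intro j hj
        obtain ⟨h1, h2⟩ := H.hb j hj
        by_cases hjn : j ≤ n
        · have := hval (fun i => c (i + 1)) ⟨(j - 1).toNat, by omega⟩
          simp only at this
          rw [show (((j - 1).toNat : ℕ) : ℤ) + 1 = j by omega] at this
          exact this.symm
        · rw [Finset.sum_eq_single (⟨(2 * n - j).toNat, by omega⟩ : Fin n)]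
          · simp only [e]
            rw [show (((2 * (n : ℤ) - j).toNat : ℕ) : ℤ) = 2 * n - j by omega, if_neg (by omega),
              if_pos (by omega), show 2 * (n : ℤ) - j + 1 = 2 * n + 1 - j by ring, hs]
            linear_combination (- c j) * hε
          · intro i _ hi
            simp only [e]
            have : (i : ℕ) ≠ (2 * (n : ℤ) - j).toNat := fun h => hi (Fin.ext h)
            rw [if_neg (by have := i.2; omega), if_neg (by omega)]; ring
          · simp
      rw [this]
      exact Submodule.sum_mem _ fun i _ => Submodule.smul_mem _ _ (Submodule.subset_span ⟨i, rfl⟩)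
    · rw [Submodule.span_le]
      rintro _ ⟨i, rfl⟩
      apply H.mkV
      intro j hj
      simp only [e]
      by_cases c1 : j = i + 1
      · rw [if_neg (by have := i.2; omega), if_pos (by omega), if_pos c1, if_neg (by have := i.2; omega)]; ring
      · by_cases c2 : j = 2 * n - i
        · rw [if_pos (by omega), if_neg (by have := i.2; omega), if_neg c1, if_pos c2]
          linear_combination -hε
        · rw [if_neg (by omega), if_neg (by omega), if_neg c1, if_neg c2]; ring
  rw [hsp, finrank_span_eq_card hli, Fintype.card_fin]

theorem VV_dim0 {n : ℕ} {ε : ℂ} (hε : ε * ε = 1) : Module.finrank ℂ (VV n ε 0) = n := by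
  have := VV_dim (gVe n 0) (fun j h1 h2 => by unfold IVe; omega) hε
  rwa [mul_zero] at this
theorem VV_dim1 {n : ℕ} {ε : ℂ} (hε : ε * ε = 1) : Module.finrank ℂ (VV n ε (2 * n - 1)) = n := by
  have := VV_dim (gVo n 1) (fun j h1 h2 => by unfold IVo; omega) hε
  rwa [show 2 * (n : ℤ) + 1 - 2 * 1 = 2 * n - 1 by ring] at this

end TPre

namespace TPre

def Nf (n : ℕ) (k m : ℤ) : ℤ := max 0 (min (min k (2 * n + 1 - k)) (min m (2 * n + 1 - m)))

theorem Nf_count {n : ℕ} {k m : ℤ} (hk : 1 ≤ k ∧ k ≤ 2 * n) (hm : 1 ≤ m ∧ m ≤ 2 * n) (x : ℂ) :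
    ∑ p ∈ Finset.Icc (0 : ℤ) (2 * n), (if m ≤ k + p ∧ k + p ≤ 2 * n ∧ p ≤ m - 1 then x else 0) =
      (Nf n k m : ℂ) * x := by
  rw [← Finset.sum_filter, Finset.sum_const, nsmul_eq_mul]
  congr 1
  have : (Finset.Icc (0 : ℤ) (2 * n)).filter (fun p => m ≤ k + p ∧ k + p ≤ 2 * n ∧ p ≤ m - 1) =
      Finset.Icc (max 0 (m - k)) (min (2 * n - k) (m - 1)) := by
    ext p; simp only [Finset.mem_filter, Finset.mem_Icc]; omega
  rw [this, Int.card_Icc]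
  have h : ((min (2 * (n : ℤ) - k) (m - 1) + 1 - max 0 (m - k)).toNat : ℤ) = Nf n k m := by
    unfold Nf; omega
  rw [← h]; push_cast; rfl

theorem D3_term {n : ℕ} (k p m : ℤ) (hp : 0 ≤ p) (hm : 1 ≤ m ∧ m ≤ 2 * n) :
    mm n k p (k + p - m) * (zVe n 0 k * mm n m (2 * n - k - p) (m - 1 - p)) =
      if m ≤ k + p ∧ k + p ≤ 2 * n ∧ p ≤ m - 1 then zVo n 1 m else 0 := by
  split_ifs with h
  · unfold zVe zVo
    rw [mm_zero_zero, E_mm, if_pos (by omega), ← mm_sigma k]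
    have := mm_mul (n := n) (k := m) (p := 2 * n - k - p) (q := m - 1 - p) (p' := k + p - m) (q' := p)
      (by omega) (by omega) (by omega) (by omega)
    rw [show m + (2 * (n : ℤ) - k - p) - (m - 1 - p) = 2 * n + 1 - k by ring] at this
    rw [this]; congr 1 <;> ring
  · by_cases h1 : m ≤ k + p
    · rw [mm_bad (k := m) (by omega), mul_zero, mul_zero]
    · rw [mm_bad (k := k) (by omega), zero_mul]

theorem D3_0 {n : ℕ} (c : ℤ → ℂ) : D3 n 0 (mkc (zVe n 0) c) =
    mkc (zVo n 1) (fun m => ∑ k ∈ Finset.Icc (1 : ℤ) (2 * n), (Nf n k m : ℂ) * c k) := by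
  funext m
  rw [D3_apply, mkc_apply]
  by_cases hm : 1 ≤ m ∧ m ≤ 2 * n
  · have : ∀ x ∈ box n, Fst n 0 (mm n x.1 x.2 (x.1 + x.2 - m))
        (Lst n 0 (mm n m (2 * n - x.1 - x.2) (m - 1 - x.2)) (mkc (zVe n 0) c x.1)) =
        (if m ≤ x.1 + x.2 ∧ x.1 + x.2 ≤ 2 * n ∧ x.2 ≤ m - 1 then c x.1 else 0) • c0 n (zVo n 1 m) := by
      intro x hx
      rw [mem_box] at hx
      rw [mkc_apply, map_smul, map_smul, Lst_c0, Fst_c0, D3_term _ _ _ hx.2.1 hm]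
      split_ifs
      · rfl
      · rw [map_zero, smul_zero, zero_smul]
    rw [Finset.sum_congr rfl this, ← Finset.sum_smul]
    congr 1
    unfold box
    rw [Finset.sum_product]
    apply Finset.sum_congr rfl
    intro k hk
    rw [Finset.mem_Icc] at hk
    exact Nf_count hk hm (c k)
  · rw [(gVo n 1).hz m (by unfold IVo; omega), map_zero, smul_zero]
    apply Finset.sum_eq_zero
    intro x _
    rw [mm_bad (k := m) (by omega)]
    simp

theorem Nf_diff {n : ℕ} {k m : ℤ} (hk : 1 ≤ k ∧ k ≤ 2 * n) (hm : 1 ≤ m ∧ m ≤ 2 * n) :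
    2 * Nf n k m - Nf n k (m - 1) - Nf n k (m + 1) =
      (if k = m then 1 else 0) + (if k = 2 * n + 1 - m then 1 else 0) := by
  unfold Nf
  split_ifs <;> omega

theorem D3_anti {n : ℕ} {f} (hf : f ∈ VV n (-1) 0) : D3 n 0 f = 0 := by
  have hf' : f ∈ VV n (-1) (2 * 0) := by rwa [show (2 * 0 : ℤ) = 0 by norm_num]
  obtain ⟨c, hc, hs, rfl⟩ := (gVe n 0).repV hf'
  rw [D3_0]
  apply mkc_zero'
  intro m
  apply tot_anti (u := fun k => (Nf n k m : ℂ) * c k) (N := 2 * n + 1) (by ring)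
  intro j
  rw [hs]
  have : Nf n (2 * n + 1 - j) m = Nf n j m := by unfold Nf; omega
  rw [this]; ring

theorem D3_inj {n : ℕ} {f} (hf : f ∈ VV n 1 0) (h : D3 n 0 f = 0) : f = 0 := by
  have hf' : f ∈ VV n (1) (2 * 0) := by rwa [show (2 * 0 : ℤ) = 0 by norm_num]
  obtain ⟨c, hc, hs, rfl⟩ := (gVe n 0).repV hf'
  rw [D3_0, ← mkc_zero' (z := zVo n 1) (c := 0) (fun j => rfl)] at h
  apply mkc_zero'
  intro m
  by_cases hm : 1 ≤ m ∧ m ≤ 2 * n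
  · have hy : ∀ m : ℤ, 0 ≤ m → m ≤ 2 * n + 1 →
        ∑ k ∈ Finset.Icc (1 : ℤ) (2 * n), (Nf n k m : ℂ) * c k = 0 := by
      intro m h0 h1
      by_cases hI : IVo n 1 m
      · exact (gVo n 1).toGM.inj h hI
      · unfold IVo at hI
        apply Finset.sum_eq_zero
        intro k hk
        have : Nf n k m = 0 := by unfold Nf; omega
        rw [this]; simp
    have e : ∑ k ∈ Finset.Icc (1 : ℤ) (2 * n), ((if k = m then c k else 0) +
        (if k = 2 * n + 1 - m then c k else 0)) = 0 := by
      have e1 : ∑ k ∈ Finset.Icc (1 : ℤ) (2 * n), ((if k = m then c k else 0) +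
          (if k = 2 * n + 1 - m then c k else 0)) =
          ∑ k ∈ Finset.Icc (1 : ℤ) (2 * n), (2 * ((Nf n k m : ℂ) * c k) -
            (Nf n k (m - 1) : ℂ) * c k - (Nf n k (m + 1) : ℂ) * c k) := by
        apply Finset.sum_congr rfl
        intro k hk
        rw [Finset.mem_Icc] at hk
        have h2 := congrArg (Int.cast (R := ℂ)) (Nf_diff hk hm)
        push_cast at h2
        have h3 : ((if k = m then c k else 0) + (if k = 2 * n + 1 - m then c k else 0)) =
            ((if k = m then (1 : ℂ) else 0) + (if k = 2 * n + 1 - m then 1 else 0)) * c k := by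
          split_ifs <;> ring
        rw [h3, ← h2]; ring
      rw [e1, Finset.sum_sub_distrib, Finset.sum_sub_distrib, ← Finset.mul_sum,
        hy m (by omega) (by omega), hy (m - 1) (by omega) (by omega),
        hy (m + 1) (by omega) (by omega)]
      ring
    rw [Finset.sum_add_distrib, Finset.sum_ite_eq', Finset.sum_ite_eq',
      if_pos (by rw [Finset.mem_Icc]; omega), if_pos (by rw [Finset.mem_Icc]; omega), hs] at e
    linear_combination (1 / 2) * e
  · exact hc m (by unfold IVe; omega)

/-! ### the remaining degrees -/

theorem ker_D3 {n : ℕ} {ε : ℂ} (hε : ε * ε = 1) {δ : ℤ} (h : δ ≠ 0) :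
    VV n ε δ ⊓ LinearMap.ker (D3 n 0) = VV n ε δ :=
  inf_eq_left.mpr fun _ hf => D3_zero hε h hf

theorem D1_bot {n : ℕ} (ε : ℂ) : ∀ b ∈ Submodule.map (D1 n 0 ε) (EE n (0 - 1)), b = 0 := by
  rintro _ ⟨f, hf, rfl⟩
  rw [EE_zero (by omega) hf, map_zero]

theorem R0 {n : ℕ} (δ : ℤ) :
    fr (VV n 1 δ) (Submodule.map (D1 n 0 1) (EE n (δ - 1))) =
      (if δ = 0 then n else 0) + wdim n (2 * n - 1 - δ) := by
  split_ifs with h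
  · subst h
    rw [fr_bot (D1_bot 1), VV_dim0 (by norm_num), wdim_neg (by intros; omega), add_zero]
  · rw [T0p h, zero_add]

theorem R3 {n : ℕ} (δ : ℤ) :
    fr (VV n (-1) δ ⊓ LinearMap.ker (D3 n 0)) (Submodule.map (D1 n 0 (-1)) (EE n (δ - 1))) =
      if δ = 0 then n else 0 := by
  split_ifs with h
  · subst h
    rw [fr_bot (D1_bot (-1)), inf_eq_left.mpr (fun _ hf => D3_anti hf), VV_dim0 (by norm_num)]
  · rw [ker_D3 (by norm_num) h, T0m h]

theorem R6 {n : ℕ} (δ : ℤ) :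
    fr (VV n 1 δ ⊓ LinearMap.ker (D3 n 0)) (Submodule.map (D1 n 0 1) (EE n (δ - 1))) =
      wdim n (2 * n - 1 - δ) := by
  by_cases h : δ = 0
  · subst h
    rw [wdim_neg (by intros; omega)]
    apply fr_zero
    rintro z ⟨hz, hk⟩
    rw [D3_inj hz hk]; exact Submodule.zero_mem _
  · rw [ker_D3 (by norm_num) h, T0p h]

theorem R2 {n : ℕ} (δ : ℤ) :
    fr (VV n (-1) δ ⊓ LinearMap.ker (D2 n 0)) (Submodule.map (D3 n 0) (VV n (-1) (δ - (2 * n - 1)))) =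
      if δ = 2 * n - 1 then n else 0 := by
  split_ifs with h
  · subst h
    rw [fr_bot, inf_eq_left.mpr, VV_dim1 (by norm_num)]
    · intro f hf
      have : D2 n 0 f ∈ EE n (2 * n - 1 + 1) := ⟨D2_XE hf.1, D2_XG hf.2⟩
      exact EE_zero (by omega) this
    · rintro _ ⟨f, hf, rfl⟩
      rw [sub_self] at hf
      exact D3_anti hf
  · exact T2m h _

theorem R5 {n : ℕ} (hn : 1 ≤ n) (δ : ℤ) :
    fr (VV n 1 δ ⊓ LinearMap.ker (D2 n 0)) (Submodule.map (D3 n 0) (VV n 1 (δ - (2 * n - 1)))) =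
      wdim n δ := by
  by_cases h : δ = 2 * n - 1
  · subst h
    rw [wdim_neg (by intros; omega)]
    apply fr_zero
    rintro z ⟨hz, -⟩
    rw [sub_self]
    have hd1 := VV_dim1 (n := n) (ε := 1) (by norm_num)
    have : Module.Finite ℂ (VV n 1 (2 * n - 1)) :=
      Module.finite_of_finrank_pos (by rw [hd1]; omega)
    have hle : Submodule.map (D3 n 0) (VV n 1 0) ≤ VV n 1 (2 * n - 1) := by
      rintro _ ⟨f, hf, rfl⟩
      have h2 := D3_XG hf.2
      rw [zero_add] at h2
      exact ⟨D3_XV (by norm_num) hf.1, h2⟩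
    have hfr : Module.finrank ℂ (Submodule.map (D3 n 0) (VV n 1 0)) = n := by
      rw [finrank_map_fr, fr_congr (B' := ⊥), fr_bot, VV_dim0 (by norm_num)]
      · intro b hb; exact hb
      · intro x hx
        constructor
        · intro hk; exact D3_inj hx hk
        · intro h0
          rw [(Submodule.mem_bot ℂ).mp h0]; exact Submodule.zero_mem _
    rw [Submodule.eq_of_le_of_finrank_eq hle (by rw [hfr, hd1])]
    exact hz
  · exact T2p h

/-! ### assembly -/

theorem XX_V {n p : ℕ} {d : ℤ} (h : p % 3 ≠ 1) : XX n p 0 d = VV n (eps p) (d - sh n p) := by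
  rw [XX, XR_V h, VV]
theorem XX_E {n p : ℕ} {d : ℤ} (h : p % 3 = 1) : XX n p 0 d = EE n (d - sh n p) := by
  rw [XX, XR_E h, EE]

theorem ZR_succ (n p : ℕ) (d : ℤ) : ZR n (p + 1) d = XX n (p + 1) 0 d ⊓ LinearMap.ker (dh n 0 p) := rfl
theorem ZR_zero (n : ℕ) (d : ℤ) : ZR n 0 d = XX n 0 0 d := inf_top_eq _

theorem BR_0 {n p : ℕ} {d : ℤ} (h : p % 3 = 0) :
    BR n p d = Submodule.map (D1 n 0 (eps p)) (EE n (d - sh n p - 1)) := by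
  rw [BR, XX_E (by omega), dh_0 h, sh_1 (by omega), sub_sub]
theorem BR_1 {n p : ℕ} {d : ℤ} (h : p % 3 = 1) :
    BR n p d = Submodule.map (D2 n 0) (VV n (eps (p + 1)) (d - sh n p - 1)) := by
  rw [BR, XX_V (by omega), dh_1 h, sh_1 (by omega), sub_sub]
theorem BR_2 {n p : ℕ} {d : ℤ} (h : p % 3 = 2) :
    BR n p d = Submodule.map (D3 n 0) (VV n (eps (p + 1)) (d - sh n p - (2 * n - 1))) := by
  rw [BR, XX_V (by omega), dh_2 h, sh_2 (by omega), sub_sub]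

theorem sh_per (n p k : ℕ) : sh n (p + 6 * k) = sh n p + 2 * k * (2 * n + 1) := by
  unfold sh
  rw [show (p + 6 * k) / 3 = p / 3 + 2 * k by omega, show (p + 6 * k) % 3 = p % 3 by omega]
  push_cast; ring

theorem eps_per (p k : ℕ) : eps (p + 6 * k) = eps p := by
  unfold eps
  rw [show (p + 6 * k + 1) / 3 = (p + 1) / 3 + 2 * k by omega, pow_add, pow_mul]; simp

theorem XX_per (n p k : ℕ) (d : ℤ) : XX n (p + 6 * k) 0 (d + 2 * k * (2 * n + 1)) = XX n p 0 d := by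
  unfold XX XR
  rw [eps_per, sh_per, show (p + 6 * k) % 3 = p % 3 by omega,
    show d + 2 * k * (2 * n + 1) - (sh n p + 2 * k * (2 * n + 1)) = d - sh n p by ring]

theorem dh_per (n p k : ℕ) : dh n 0 (p + 6 * k) = dh n 0 p := by
  unfold dh
  rw [eps_per, show (p + 6 * k) % 3 = p % 3 by omega]

theorem per (n i k d : ℕ) (hi : 1 ≤ i) : Module.finrank ℂ (HHhoDeg n (i + 6 * k) (d + 2 * k * (2 * n + 1)))
    = Module.finrank ℂ (HHhoDeg n i d) := by
  rw [HH_red, HH_red]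
  obtain ⟨p, rfl⟩ : ∃ p, i = p + 1 := ⟨i - 1, by omega⟩
  have h1 : ZR n (p + 1 + 6 * k) ((d + 2 * k * (2 * n + 1) : ℕ) : ℤ) = ZR n (p + 1) d := by
    have := XX_per n (p + 1) k d
    rw [show p + 1 + 6 * k = p + 6 * k + 1 by ring] at this ⊢
    rw [ZR_succ, ZR_succ, dh_per, ← this]; push_cast; rfl
  have h2 : BR n (p + 1 + 6 * k) ((d + 2 * k * (2 * n + 1) : ℕ) : ℤ) = BR n (p + 1) d := by
    have := XX_per n (p + 1 + 1) k d
    rw [show p + 1 + 1 + 6 * k = p + 1 + 6 * k + 1 by ring] at this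
    rw [BR, BR, dh_per, ← this]; push_cast; rfl
  rw [h1, h2]

theorem e0 : eps 0 = 1 := eps_zero
theorem e2 : eps 2 = -1 := by norm_num [eps]
theorem e3 : eps 3 = -1 := by norm_num [eps]
theorem e5 : eps 5 = 1 := by norm_num [eps]
theorem e6 : eps 6 = 1 := by norm_num [eps]
theorem s1 (n : ℕ) : sh n 1 = 1 := by norm_num [sh]
theorem s2 (n : ℕ) : sh n 2 = 2 := by norm_num [sh]
theorem s3 (n : ℕ) : sh n 3 = 2 * n + 1 := by norm_num [sh]
theorem s4 (n : ℕ) : sh n 4 = 2 * n + 1 + 1 := by norm_num [sh]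
theorem s5 (n : ℕ) : sh n 5 = 2 * n + 1 + 2 := by norm_num [sh]
theorem s6 (n : ℕ) : sh n 6 = 2 * (2 * n + 1) := by norm_num [sh]

end TPre

/-- **Theorem (Hochschild homology of `A = Π_{T_n}`).**  As graded vector spaces
(recorded through the dimensions of all graded components; `h = 2n+1`):
`HH_0(A) = U^*[h] ⊕ R`, `HH_1(A) = U^*[h]`, `HH_2(A) = K^*[h]`, `HH_3(A) = K[h]`,
`HH_4(A) = U[h]`, `HH_5(A) = U[h]`, `HH_6(A) = U^*[3h]`, and
`HH_{6k+i}(A) = HH_i(A)[2kh]` for all `i ≥ 1` and `k ≥ 0`. -/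
theorem hochschild_homology_of_PiT (n : ℕ) (hn : 1 ≤ n) :
    (∀ d : ℕ, Module.finrank ℂ (HHhoDeg n 0 d)
        = (if d = 0 then n else 0) + wdim n (2 * (n : ℤ) - 1 - (d : ℤ))) ∧
    (∀ d : ℕ, Module.finrank ℂ (HHhoDeg n 1 d) = wdim n (2 * (n : ℤ) - 1 - (d : ℤ))) ∧
    (∀ d : ℕ, Module.finrank ℂ (HHhoDeg n 2 d)
        = if (d : ℤ) = 2 * (n : ℤ) + 1 then n else 0) ∧
    (∀ d : ℕ, Module.finrank ℂ (HHhoDeg n 3 d)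
        = if (d : ℤ) = 2 * (n : ℤ) + 1 then n else 0) ∧
    (∀ d : ℕ, Module.finrank ℂ (HHhoDeg n 4 d) = wdim n ((d : ℤ) - 2 * (n : ℤ) - 3)) ∧
    (∀ d : ℕ, Module.finrank ℂ (HHhoDeg n 5 d) = wdim n ((d : ℤ) - 2 * (n : ℤ) - 3)) ∧
    (∀ d : ℕ, Module.finrank ℂ (HHhoDeg n 6 d) = wdim n (6 * (n : ℤ) + 1 - (d : ℤ))) ∧
    (∀ i : ℕ, 1 ≤ i → ∀ k : ℕ, ∀ d : ℕ,
      Module.finrank ℂ (HHhoDeg n (i + 6 * k) (d + 2 * k * (2 * n + 1)))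
        = Module.finrank ℂ (HHhoDeg n i d)) := by
  refine ⟨?_, ?_, ?_, ?_, ?_, ?_, ?_, ?_⟩
  · intro d
    rw [HH_red, ZR_zero, XX_V (by norm_num), BR_0 (by norm_num), e0, sh_zero, R0, sub_zero]
    congr 1
    simp only [Nat.cast_eq_zero]
  · intro d
    rw [HH_red, ZR_succ, XX_E (by norm_num), BR_1 (by norm_num), dh_0 (by norm_num), e0, e2, s1, T1p]
    congr 1; ring
  · intro d
    rw [HH_red, ZR_succ, XX_V (by norm_num), BR_2 (by norm_num), dh_1 (by norm_num), e2, e3, s2, R2]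
    congr 1
    rw [eq_iff_iff]; omega
  · intro d
    rw [HH_red, ZR_succ, XX_V (by norm_num), BR_0 (by norm_num), dh_2 (by norm_num), e3, s3, R3]
    congr 1
    rw [eq_iff_iff]; omega
  · intro d
    rw [HH_red, ZR_succ, XX_E (by norm_num), BR_1 (by norm_num), dh_0 (by norm_num), e3, e5, s4, T1m]
    congr 1; ring
  · intro d
    rw [HH_red, ZR_succ, XX_V (by norm_num), BR_2 (by norm_num), dh_1 (by norm_num), e5, e6, s5, R5 hn]
    congr 1; ring
  · intro d
    rw [HH_red, ZR_succ, XX_V (by norm_num), BR_0 (by norm_num), dh_2 (by norm_num), e6, s6, R6]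
    congr 1; ring
  · intro i hi k d
    exact per n i k d hi
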